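/- arXiv:1909.08262 — 4 statements merged into one kernel-verified Lean document; each statement's English description precedes it below -/
import Mathlib

section
/- (Intermediate inequality (7.4) in the proof of Theorem 7.3.) Let 2 ≤ p ≤ n and let K₁, …, K_p, L₁, …, L_{n−p} be nonempty compact convex sets in ℝⁿ. Then Π_{s=1}^{p} Π_{i ≠ s} MV(K_i^{(p−1)}, K_s, L₁, …, L_{n−p}) ≥ Π_{s=1}^{p} MV(K_s^{(p)}, L₁, …, L_{n−p})^{p−1}. -/
open scoped Pointwise
open MeasureTheory Finset

/-- Lebesgue volume of a subset of ℝⁿ, as a real number. -/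
noncomputable def vol {n : ℕ} (A : Set (Fin n → ℝ)) : ℝ := (volume A).toReal

/-- The mixed volume of `n` convex bodies in ℝⁿ, defined by the inclusion–exclusion
formula. -/
noncomputable def MV (n : ℕ) (K : Fin n → Set (Fin n → ℝ)) : ℝ :=
  ∑ j ∈ Finset.Icc 1 n, (-1 : ℝ) ^ (n - j) *
    ∑ S ∈ Finset.univ.powersetCard j, vol (∑ i ∈ S, K i)

/-- The family `(A₁, …, A_{p−1}, H, L₁, …, L_{n−p})` of `n` sets. -/
def fam {n p : ℕ} (hp1 : 1 ≤ p) (hpn : p ≤ n) {α : Type*}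
    (A : Fin (p - 1) → α) (H : α) (L : Fin (n - p) → α) : Fin n → α :=
  fun i =>
    if h : (i : ℕ) < p - 1 then A ⟨i, h⟩
    else if h2 : (i : ℕ) = p - 1 then H
    else L ⟨(i : ℕ) - p, by have := i.isLt; omega⟩

set_option linter.all false


namespace AFProof

section Alg
open MvPolynomial

variable {ι κ : Type} [Fintype ι] [DecidableEq ι] [Fintype κ] [DecidableEq κ]

/-- Directional derivative of a polynomial. -/
noncomputable def dir (v : ι → ℝ) : Derivation ℝ (MvPolynomial ι ℝ) (MvPolynomial ι ℝ) :=
  mkDerivation ℝ (fun i => C (v i))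

lemma dir_X (v : ι → ℝ) (i : ι) : dir v (X i) = C (v i) := mkDerivation_X _ _ _

lemma dir_C (v : ι → ℝ) (c : ℝ) : dir v (C c) = 0 := by
  simp [dir]

lemma dir_single (i : ι) : dir (Pi.single i (1:ℝ)) = pderiv i := by
  apply MvPolynomial.derivation_ext
  intro j
  rw [dir_X, pderiv_X]
  by_cases h : j = i
  · subst h; simp
  · simp [h]

lemma dir_add (v w : ι → ℝ) (f : MvPolynomial ι ℝ) : dir (v + w) f = dir v f + dir w f := by
  have : dir (v + w) = dir v + dir w := by
    apply MvPolynomial.derivation_ext; intro j; simp [dir_X]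
  rw [this]; rfl

lemma dir_smul (c : ℝ) (v : ι → ℝ) (f : MvPolynomial ι ℝ) : dir (c • v) f = c • dir v f := by
  have : dir (c • v) = c • dir v := by
    apply MvPolynomial.derivation_ext; intro j; simp [dir_X, smul_eq_C_mul]
  rw [this]; rfl

lemma dir_comm (v w : ι → ℝ) (f : MvPolynomial ι ℝ) : dir v (dir w f) = dir w (dir v f) := by
  have : ⁅dir v, dir w⁆ = 0 := by
    apply MvPolynomial.derivation_ext; intro j
    simp [Derivation.commutator_apply, dir_X, dir_C]
  have h2 := congrArg (fun d => d f) this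
  simp only [Derivation.commutator_apply, Derivation.coe_zero, Pi.zero_apply] at h2
  exact sub_eq_zero.mp h2

lemma dir_sum (v : ι → ℝ) (f : MvPolynomial ι ℝ) : dir v f = ∑ i, v i • pderiv i f := by
  have : dir v = ∑ i, v i • pderiv i := by
    apply MvPolynomial.derivation_ext; intro j
    rw [dir_X]
    have h2 := congrFun (map_sum (Derivation.coeFnAddMonoidHom (R := ℝ) (A := MvPolynomial ι ℝ)
      (M := MvPolynomial ι ℝ)) (fun i => v i • pderiv i) Finset.univ) (X j)
    simp only [Derivation.coeFnAddMonoidHom_apply] at h2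
    rw [h2]
    simp [pderiv_X, Pi.single_apply, smul_eq_C_mul]
  rw [this]
  have h2 := congrFun (map_sum (Derivation.coeFnAddMonoidHom (R := ℝ) (A := MvPolynomial ι ℝ)
      (M := MvPolynomial ι ℝ)) (fun i => v i • pderiv i) Finset.univ) f
  simp only [Derivation.coeFnAddMonoidHom_apply] at h2
  rw [h2]
  simp

/-- Pullback of a polynomial by a linear map. -/
noncomputable def pull (π : (ι → ℝ) →ₗ[ℝ] (κ → ℝ)) : MvPolynomial κ ℝ →ₐ[ℝ] MvPolynomial ι ℝ :=
  aeval (fun k => ∑ i, C (π (Pi.single i 1) k) * X i)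

lemma lin_expand (π : (ι → ℝ) →ₗ[ℝ] (κ → ℝ)) (h : ι → ℝ) (k : κ) :
    π h k = ∑ i, h i * π (Pi.single i 1) k := by
  conv_lhs => rw [pi_eq_sum_univ' h]
  simp [map_sum, Finset.sum_apply, Pi.single_apply, ← Pi.single_apply]

lemma eval_pull (π : (ι → ℝ) →ₗ[ℝ] (κ → ℝ)) (h : ι → ℝ) (g : MvPolynomial κ ℝ) :
    eval h (pull π g) = eval (π h) g := by
  induction g using MvPolynomial.induction_on with
  | C a => simp [pull]
  | add p q hp hq => simp [hp, hq]
  | mul_X p k hp =>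
    rw [map_mul, map_mul, hp, map_mul]
    congr 1
    rw [eval_X, lin_expand]
    simp [pull, mul_comm]

lemma dir_pull (π : (ι → ℝ) →ₗ[ℝ] (κ → ℝ)) (v : ι → ℝ) (g : MvPolynomial κ ℝ) :
    dir v (pull π g) = pull π (dir (π v) g) := by
  induction g using MvPolynomial.induction_on with
  | C a => simp [pull, dir_C]
  | add p q hp hq => simp [hp, hq]
  | mul_X p k hp =>
    have hX : dir v (pull π (X k)) = C (π v k) := by
      rw [lin_expand]
      simp [pull, dir_X, dir_C, Derivation.leibniz, mul_comm]
    rw [map_mul, Derivation.leibniz, Derivation.leibniz, hp, hX, dir_X]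
    simp [pull]

lemma pull_homog (π : (ι → ℝ) →ₗ[ℝ] (κ → ℝ)) {g : MvPolynomial κ ℝ} {n : ℕ}
    (hg : g.IsHomogeneous n) : (pull π g).IsHomogeneous n := by
  have := hg.aeval (fun k => ∑ i, C (π (Pi.single i 1) k) * X i) (n := 1) (fun k =>
    IsHomogeneous.sum _ _ _ fun i _ => by
      simpa using (isHomogeneous_C ι _).mul (isHomogeneous_X ℝ i))
  simpa [pull] using this

/-- Iterated directional derivative, evaluated at zero. -/
noncomputable def T (f : MvPolynomial ι ℝ) : List (ι → ℝ) → ℝ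
  | [] => eval 0 f
  | v :: l => T (dir v f) l

lemma T_nil (f : MvPolynomial ι ℝ) : T f [] = eval 0 f := by rw [T]
lemma T_cons (f : MvPolynomial ι ℝ) (v : ι → ℝ) (l : List (ι → ℝ)) :
    T f (v :: l) = T (dir v f) l := by rw [T]

lemma T_add (f g : MvPolynomial ι ℝ) (l : List (ι → ℝ)) : T (f + g) l = T f l + T g l := by
  induction l generalizing f g with
  | nil => simp [T_nil]
  | cons v l ih => simp [T_cons, ih]

lemma T_smul (c : ℝ) (f : MvPolynomial ι ℝ) (l : List (ι → ℝ)) : T (c • f) l = c * T f l := by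
  induction l generalizing f with
  | nil => simp [T_nil]
  | cons v l ih => simp [T_cons, ih]

lemma T_zero (l : List (ι → ℝ)) : T (0 : MvPolynomial ι ℝ) l = 0 := by
  have := T_smul 0 (0 : MvPolynomial ι ℝ) l
  simpa using this

/-- `T` as a linear map in the polynomial. -/
noncomputable def Tl (l : List (ι → ℝ)) : MvPolynomial ι ℝ →ₗ[ℝ] ℝ where
  toFun f := T f l
  map_add' f g := T_add f g l
  map_smul' c f := T_smul c f l

lemma T_sum {α : Type} (s : Finset α) (f : α → MvPolynomial ι ℝ) (l : List (ι → ℝ)) :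
    T (∑ i ∈ s, f i) l = ∑ i ∈ s, T (f i) l := map_sum (Tl l) f s

lemma T_perm (f : MvPolynomial ι ℝ) {l l' : List (ι → ℝ)} (h : l.Perm l') : T f l = T f l' := by
  induction h generalizing f with
  | nil => rfl
  | cons x _ ih => simp [T_cons, ih]
  | swap x y l => simp [T_cons, dir_comm]
  | trans _ _ h1 h2 => rw [h1, h2]

lemma T_cons_add (f : MvPolynomial ι ℝ) (v w : ι → ℝ) (l : List (ι → ℝ)) :
    T f ((v + w) :: l) = T f (v :: l) + T f (w :: l) := by
  simp [T_cons, dir_add, T_add]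

lemma T_cons_smul (f : MvPolynomial ι ℝ) (c : ℝ) (v : ι → ℝ) (l : List (ι → ℝ)) :
    T f ((c • v) :: l) = c * T f (v :: l) := by
  simp [T_cons, dir_smul, T_smul]

lemma T_cons_sum (f : MvPolynomial ι ℝ) (v : ι → ℝ) (l : List (ι → ℝ)) :
    T f (v :: l) = ∑ i, v i * T (pderiv i f) l := by
  simp [T_cons, dir_sum, T_sum, T_smul]

lemma T_pull (π : (ι → ℝ) →ₗ[ℝ] (κ → ℝ)) (g : MvPolynomial κ ℝ) (l : List (ι → ℝ)) :
    T (pull π g) l = T g (l.map π) := by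
  induction l generalizing g with
  | nil => rw [T_nil, eval_pull, map_zero]; rfl
  | cons v l ih => simp [T_cons, dir_pull, ih]

lemma coeff_T (f : MvPolynomial ι ℝ) (l : List ι) (hl : l.Nodup) :
    T f (l.map fun i => Pi.single i 1) = coeff ((l.map fun i => Finsupp.single i 1).sum) f := by
  suffices H : ∀ (m : ι →₀ ℕ), (∀ i ∈ l, m i = 0) →
      ∀ f : MvPolynomial ι ℝ,
      coeff m ((l.map fun i => (Pi.single i 1 : ι → ℝ)).foldl (fun f v => dir v f) f) =
        coeff (m + (l.map fun i => Finsupp.single i 1).sum) f by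
    have h0 : ∀ (l : List (ι → ℝ)) f, T f l = coeff 0 (l.foldl (fun f v => dir v f) f) := by
      intro l
      induction l with
      | nil => intro f; rw [T_nil, ← constantCoeff_eq, ← eval_zero']; simp
      | cons v l ih => intro f; rw [T_cons, ih]; rfl
    rw [h0, H 0 (by simp)]; simp
  clear f
  induction l with
  | nil => simp
  | cons i l ih =>
    intro m hm f
    simp only [List.map_cons, List.foldl_cons, List.sum_cons]
    rw [List.nodup_cons] at hl
    rw [ih hl.2 m (fun j hj => hm j (by simp [hj])), dir_single, coeff_pderiv]
    have h1 : (m + (l.map fun i => (Finsupp.single i 1 : ι →₀ ℕ)).sum) i = 0 := by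
      rw [Finsupp.add_apply, hm i (by simp), zero_add]
      have : ∀ l : List ι, i ∉ l → ((l.map fun i => Finsupp.single i 1).sum : ι →₀ ℕ) i = 0 := by
        intro l
        induction l with
        | nil => simp
        | cons j l ih2 =>
          intro h
          simp only [List.mem_cons, not_or] at h
          simp only [List.map_cons, List.sum_cons, Finsupp.add_apply, ih2 h.2, add_zero]
          exact Finsupp.single_eq_of_ne (by exact h.1)
      exact this l hl.1
    rw [h1]
    simp only [Nat.cast_zero, zero_add, mul_one]
    congr 1
    abel

lemma sum_alt_monomial {n : ℕ} (g : MvPolynomial (Fin n) ℝ) (hg : g.IsHomogeneous n) :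
    ∑ S : Finset (Fin n), (-1 : ℝ) ^ (n - S.card) * eval (∑ i ∈ S, Pi.single i 1) g =
      coeff (∑ i, Finsupp.single i 1) g := by
  have h1 : ∀ α : Fin n →₀ ℕ, ∀ S : Finset (Fin n),
      ∏ i, ((∑ i ∈ S, Pi.single i (1:ℝ)) : Fin n → ℝ) i ^ α i = ∏ i ∈ Sᶜ, (0:ℝ) ^ α i := by
    intro α S
    rw [← Finset.prod_mul_prod_compl S]
    rw [Finset.prod_eq_one, one_mul]
    · refine Finset.prod_congr rfl fun i hi => ?_
      congr 1
      simp only [Finset.mem_compl] at hi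
      simp [Finset.sum_apply, Pi.single_apply, hi]
    · intro i hi
      simp [Finset.sum_apply, Pi.single_apply, hi]
  have h2 : ∀ α : Fin n →₀ ℕ, ∑ S : Finset (Fin n), (-1 : ℝ) ^ (n - S.card) *
      ∏ i, ((∑ i ∈ S, Pi.single i (1:ℝ)) : Fin n → ℝ) i ^ α i = ∏ i, (1 - (0:ℝ) ^ α i) := by
    intro α
    have := Finset.prod_add (fun _ : Fin n => (1:ℝ)) (fun i => - (0:ℝ) ^ α i) Finset.univ
    simp only [← sub_eq_add_neg] at this
    rw [this]
    rw [Finset.powerset_univ]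
    refine Finset.sum_congr rfl fun S _ => ?_
    rw [h1, ← Finset.compl_eq_univ_sdiff, Finset.prod_neg, Finset.card_compl, Fintype.card_fin]
    simp
  have h3 : ∀ S : Finset (Fin n), eval (∑ i ∈ S, Pi.single i (1:ℝ)) g =
      ∑ α ∈ g.support, coeff α g * ∏ i, ((∑ i ∈ S, Pi.single i (1:ℝ)) : Fin n → ℝ) i ^ α i :=
    fun S => eval_eq' _ _
  simp_rw [h3, Finset.mul_sum]
  rw [Finset.sum_comm]
  have h4 : ∀ α : Fin n →₀ ℕ, α ∈ g.support → ∑ S : Finset (Fin n), (-1 : ℝ) ^ (n - S.card) *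
      (coeff α g * ∏ i, ((∑ i ∈ S, Pi.single i (1:ℝ)) : Fin n → ℝ) i ^ α i) =
      if α = ∑ i, Finsupp.single i 1 then coeff α g else 0 := by
    intro α hα
    have : ∑ S : Finset (Fin n), (-1 : ℝ) ^ (n - S.card) *
      (coeff α g * ∏ i, ((∑ i ∈ S, Pi.single i (1:ℝ)) : Fin n → ℝ) i ^ α i) =
      coeff α g * ∏ i, (1 - (0:ℝ) ^ α i) := by
      rw [← h2, Finset.mul_sum]
      exact Finset.sum_congr rfl fun S _ => by ring
    rw [this]
    have hdeg : ∑ i, α i = n := by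
      have := hg (mem_support_iff.mp hα)
      rw [Finsupp.weight_apply, Finsupp.sum_fintype _ _ (by simp)] at this
      simpa using this
    have hone : ∀ i, (∑ i, Finsupp.single i 1 : Fin n →₀ ℕ) i = 1 := by
      intro i
      simp [Finsupp.finsetSum_apply, Finsupp.single_apply]
    split_ifs with h
    · rw [Finset.prod_eq_one, mul_one]
      intro i _
      rw [h, hone]; simp
    · have : ∃ i, α i = 0 := by
        by_contra hcon
        push Not at hcon
        apply h
        ext i
        rw [hone]
        have hle : ∀ i ∈ (Finset.univ : Finset (Fin n)), 1 ≤ α i :=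
          fun i _ => Nat.one_le_iff_ne_zero.mpr (hcon i)
        have := (Finset.sum_eq_sum_iff_of_le hle).mp (by simp [hdeg])
        exact (this i (by simp)).symm
      obtain ⟨i, hi⟩ := this
      rw [Finset.prod_eq_zero (Finset.mem_univ i), mul_zero]
      simp [hi]
  rw [Finset.sum_congr rfl h4, Finset.sum_ite_eq']
  split_ifs with h
  · rfl
  · exact (notMem_support_iff.mp h).symm

lemma polarization {n : ℕ} (f : MvPolynomial ι ℝ) (hf : f.IsHomogeneous n)
    (h : Fin n → ι → ℝ) :
    ∑ S : Finset (Fin n), (-1 : ℝ) ^ (n - S.card) * eval (∑ i ∈ S, h i) f =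
      T f (List.ofFn h) := by
  let π : (Fin n → ℝ) →ₗ[ℝ] (ι → ℝ) := Fintype.linearCombination ℝ h
  have hπ : ∀ i, π (Pi.single i 1) = h i := fun i => by
    simp [π, Fintype.linearCombination_apply_single]
  have h1 := sum_alt_monomial (pull π f) (pull_homog π hf)
  have h2 := coeff_T (pull π f) (List.finRange n) (List.nodup_finRange n)
  have h3 : ((List.finRange n).map fun i => (Finsupp.single i 1 : Fin n →₀ ℕ)).sum =
      ∑ i, Finsupp.single i 1 := by
    rw [← List.ofFn_eq_map, List.sum_ofFn]
  rw [h3, ← h1, T_pull, List.map_map] at h2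
  have h4 : (List.finRange n).map (π ∘ fun i => Pi.single i 1) = List.ofFn h := by
    rw [List.ofFn_eq_map]
    exact List.map_congr_left fun i _ => hπ i
  rw [h4] at h2
  rw [h2]
  refine Finset.sum_congr rfl fun S _ => ?_
  rw [eval_pull, map_sum]
  simp_rw [hπ]

lemma hasDerivAt_eval_line (f : MvPolynomial ι ℝ) (h v : ι → ℝ) (t : ℝ) :
    HasDerivAt (fun t : ℝ => eval (h + t • v) f) (eval (h + t • v) (dir v f)) t := by
  induction f using MvPolynomial.induction_on with
  | C a => simpa [dir_C] using hasDerivAt_const t a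
  | add p q hp hq =>
    simp only [map_add]
    exact hp.add hq
  | mul_X p i hp =>
    have hX : HasDerivAt (fun t : ℝ => h i + t * v i) (v i) t := by
      simpa using ((hasDerivAt_id t).mul_const (v i)).const_add (h i)
    have := hp.mul hX
    simp only [map_mul, eval_X, Derivation.leibniz, dir_X, smul_eq_mul, map_add, eval_C,
      Pi.add_apply, Pi.smul_apply]
    exact this.congr_deriv (by ring)

lemma eq_of_eqOn_open {f g : MvPolynomial ι ℝ} {U : Set (ι → ℝ)} (hU : IsOpen U)
    (hne : U.Nonempty) (h : ∀ x ∈ U, eval x f = eval x g) : f = g := by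
  obtain ⟨x, hx⟩ := hne
  obtain ⟨ε, hε, hb⟩ := Metric.isOpen_iff.mp hU x hx
  apply MvPolynomial.funext_set (fun i => Metric.ball (x i) ε)
  · intro i
    rw [Real.ball_eq_Ioo]
    exact Set.Ioo_infinite (by linarith)
  · intro y hy
    apply h y (hb _)
    rw [Metric.mem_ball, dist_pi_lt_iff hε]
    intro i
    exact hy i trivial

end Alg


/-- Combinatorial data of a family of strongly isomorphic simple polytopes. -/
structure PDat (n : ℕ) (ι : Type) [Fintype ι] [DecidableEq ι] where
  a : ι → (Fin n → ℝ) →ₗ[ℝ] ℝ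
  B : Finset (Finset ι)
  X : Finset ι → (ι → ℝ) →ₗ[ℝ] (Fin n → ℝ)
  hX : ∀ I ∈ B, ∀ h, ∀ i ∈ I, a i (X I h) = h i
  huniq : ∀ I ∈ B, ∀ y, (∀ i ∈ I, a i y = 0) → y = 0
  ne : B.Nonempty
  pivot : ∀ I ∈ B, ∀ k ∈ I, ∃ I' ∈ B, I.erase k ⊆ I' ∧ k ∉ I'

namespace PDat

variable {n : ℕ} {ι : Type} [Fintype ι] [DecidableEq ι] (D : PDat n ι)

/-- The open chamber. -/
def Ch : Set (ι → ℝ) := {h | ∀ I ∈ D.B, ∀ j, j ∉ I → D.a j (D.X I h) < h j}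

/-- The polytope. -/
def P (h : ι → ℝ) : Set (Fin n → ℝ) := {y | ∀ i, D.a i y ≤ h i}

/-- Essential indices. -/
def Ess (i : ι) : Prop := ∃ I ∈ D.B, i ∈ I

variable {D}

lemma Ch_add {h h' : ι → ℝ} (H : h ∈ D.Ch) (H' : h' ∈ D.Ch) : h + h' ∈ D.Ch := by
  intro I hI j hj
  have h1 := H I hI j hj
  have h2 := H' I hI j hj
  simp only [map_add, Pi.add_apply]
  linarith

lemma Ch_smul {h : ι → ℝ} (H : h ∈ D.Ch) {c : ℝ} (hc : 0 < c) : c • h ∈ D.Ch := by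
  intro I hI j hj
  have h1 := H I hI j hj
  simp only [map_smul, Pi.smul_apply, smul_eq_mul]
  exact mul_lt_mul_of_pos_left h1 hc

lemma Ch_isOpen : IsOpen D.Ch := by
  have : D.Ch = ⋂ I ∈ D.B, ⋂ j, ⋂ (_ : j ∉ I), {h : ι → ℝ | D.a j (D.X I h) < h j} := by
    ext h; simp [Ch]
  rw [this]
  refine isOpen_biInter_finset fun I _ => isOpen_iInter_of_finite fun j =>
    isOpen_iInter_of_finite fun _ => ?_
  apply isOpen_lt
  · exact ((D.a j).comp (D.X I)).continuous_of_finiteDimensional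
  · exact continuous_apply j

lemma X_eq {I : Finset ι} (hI : I ∈ D.B) {h : ι → ℝ} {y : Fin n → ℝ}
    (hy : ∀ i ∈ I, D.a i y = h i) : D.X I h = y := by
  rw [← sub_eq_zero]
  apply D.huniq I hI
  intro i hi
  rw [map_sub, D.hX I hI h i hi, hy i hi, sub_self]

lemma rep {I : Finset ι} (hI : I ∈ D.B) (y : Fin n → ℝ) :
    y = ∑ i ∈ I, D.a i y • D.X I (Pi.single i 1) := by
  have : D.X I (∑ i ∈ I, D.a i y • (Pi.single i 1 : ι → ℝ)) = y := by
    apply X_eq hI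
    intro i hi
    simp [Finset.sum_apply, Pi.single_apply, hi]
  rw [map_sum] at this
  simpa using this.symm

lemma pivot_step {h : ι → ℝ} (H : h ∈ D.Ch) (c : (Fin n → ℝ) →ₗ[ℝ] ℝ) {I : Finset ι}
    (hI : I ∈ D.B) {k : ι} (hk : k ∈ I) (hneg : c (D.X I (Pi.single k 1)) < 0) :
    ∃ I' ∈ D.B, I.erase k ⊆ I' ∧ k ∉ I' ∧ c (D.X I h) < c (D.X I' h) := by
  obtain ⟨I', hI', hsub, hk'⟩ := D.pivot I hI k hk
  refine ⟨I', hI', hsub, hk', ?_⟩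
  have h1 := rep hI (D.X I' h - D.X I h)
  rw [← Finset.add_sum_erase _ _ hk] at h1
  rw [Finset.sum_eq_zero, add_zero] at h1
  · have h2 := congrArg c h1
    rw [map_smul, map_sub, map_sub, D.hX I hI h k hk, smul_eq_mul] at h2
    have h3 := H I' hI' k hk'
    nlinarith
  · intro i hi
    rw [map_sub, D.hX I' hI' h i (hsub hi), D.hX I hI h i (Finset.mem_of_mem_erase hi), sub_self,
      zero_smul]

lemma complete (hC : D.Ch.Nonempty) (c : (Fin n → ℝ) →ₗ[ℝ] ℝ) :
    ∃ I ∈ D.B, ∀ i ∈ I, 0 ≤ c (D.X I (Pi.single i 1)) := by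
  obtain ⟨h, H⟩ := hC
  obtain ⟨I, hI, hmax⟩ := D.B.exists_max_image (fun I => c (D.X I h)) D.ne
  refine ⟨I, hI, fun i hi => ?_⟩
  by_contra hneg
  obtain ⟨I', hI', _, _, hlt⟩ := pivot_step H c hI hi (not_le.mp hneg)
  exact absurd (hmax I' hI') (not_le.mpr hlt)

lemma X_mem_P {h : ι → ℝ} (H : ∀ I ∈ D.B, ∀ j, j ∉ I → D.a j (D.X I h) ≤ h j)
    {I : Finset ι} (hI : I ∈ D.B) : D.X I h ∈ D.P h := by
  intro i
  by_cases hi : i ∈ I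
  · exact (D.hX I hI h i hi).le
  · exact H I hI i hi

lemma P_convex (h : ι → ℝ) : Convex ℝ (D.P h) := by
  have : D.P h = ⋂ i, {y | D.a i y ≤ h i} := by ext; simp [P]
  rw [this]
  exact convex_iInter fun i => convex_halfSpace_le (D.a i).isLinear _

lemma P_closed (h : ι → ℝ) : IsClosed (D.P h) := by
  have : D.P h = ⋂ i, {y | D.a i y ≤ h i} := by ext; simp [P]
  rw [this]
  exact isClosed_iInter fun i =>
    isClosed_le (D.a i).continuous_of_finiteDimensional continuous_const

lemma P_eq (hC : D.Ch.Nonempty) {h : ι → ℝ}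
    (H : ∀ I ∈ D.B, ∀ j, j ∉ I → D.a j (D.X I h) ≤ h j) :
    D.P h = convexHull ℝ ((fun I => D.X I h) '' D.B) := by
  apply Set.Subset.antisymm
  · intro y hy
    by_contra hcon
    have hfin : ((fun I => D.X I h) '' (D.B : Set (Finset ι))).Finite :=
      D.B.finite_toSet.image _
    obtain ⟨c, u, hc1, hc2⟩ := geometric_hahn_banach_closed_point (convex_convexHull ℝ _)
      (hfin.isCompact_convexHull ℝ).isClosed hcon
    obtain ⟨I, hI, hpos⟩ := complete hC (c : (Fin n → ℝ) →ₗ[ℝ] ℝ)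
    have h1 := hc1 (D.X I h) (subset_convexHull ℝ _ ⟨I, hI, rfl⟩)
    have h3 : c y ≤ c (D.X I h) := by
      rw [rep hI y, rep hI (D.X I h)]
      simp only [map_sum, map_smul, smul_eq_mul]
      refine Finset.sum_le_sum fun i hi => ?_
      rw [D.hX I hI h i hi]
      exact mul_le_mul_of_nonneg_right (hy i) (hpos i hi)
    linarith
  · apply convexHull_min _ (P_convex h)
    rintro _ ⟨I, hI, rfl⟩
    exact X_mem_P H hI

lemma Ch_le {h : ι → ℝ} (H : h ∈ D.Ch) : ∀ I ∈ D.B, ∀ j, j ∉ I → D.a j (D.X I h) ≤ h j :=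
  fun I hI j hj => (H I hI j hj).le

lemma P_compact {h : ι → ℝ} (H : h ∈ D.Ch) : IsCompact (D.P h) := by
  rw [P_eq ⟨h, H⟩ (Ch_le H)]
  exact (D.B.finite_toSet.image _).isCompact_convexHull ℝ

lemma P_add {h h' : ι → ℝ} (H : h ∈ D.Ch) (H' : h' ∈ D.Ch) :
    D.P (h + h') = D.P h + D.P h' := by
  apply Set.Subset.antisymm
  · rw [P_eq ⟨h, H⟩ (Ch_le (Ch_add H H'))]
    apply convexHull_min _ ((P_convex h).add (P_convex h'))
    rintro _ ⟨I, hI, rfl⟩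
    simp only [map_add]
    exact Set.add_mem_add (X_mem_P (Ch_le H) hI) (X_mem_P (Ch_le H') hI)
  · rintro _ ⟨y, hy, z, hz, rfl⟩ i
    simp only [map_add, Pi.add_apply]
    exact add_le_add (hy i) (hz i)

lemma P_smul (h : ι → ℝ) {c : ℝ} (hc : 0 < c) : D.P (c • h) = c • D.P h := by
  ext y
  rw [Set.mem_smul_set_iff_inv_smul_mem₀ hc.ne']
  refine forall_congr' fun i => ?_
  rw [map_smul, smul_eq_mul, Pi.smul_apply, smul_eq_mul, inv_mul_le_iff₀ hc]

lemma P_sum {α : Type} [DecidableEq α] (S : Finset α) (hS : S.Nonempty) (h : α → ι → ℝ)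
    (H : ∀ i, h i ∈ D.Ch) :
    (∑ i ∈ S, h i) ∈ D.Ch ∧ D.P (∑ i ∈ S, h i) = ∑ i ∈ S, D.P (h i) := by
  induction hS using Finset.Nonempty.cons_induction with
  | singleton a => simpa using H a
  | cons a s ha hs ih =>
    rw [Finset.sum_cons, Finset.sum_cons]
    exact ⟨Ch_add (H a) ih.1, by rw [P_add (H a) ih.1, ih.2]⟩

lemma exists_interior {h : ι → ℝ} (H : h ∈ D.Ch) : ∃ z, ∀ j, D.a j z < h j := by
  have hB : (0:ℝ) < D.B.card := by exact_mod_cast D.ne.card_pos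
  refine ⟨∑ I ∈ D.B, (D.B.card : ℝ)⁻¹ • D.X I h, fun j => ?_⟩
  simp only [map_sum, map_smul, smul_eq_mul]
  have hj : h j = ∑ I ∈ D.B, (D.B.card : ℝ)⁻¹ * h j := by
    rw [Finset.sum_const, nsmul_eq_mul]; field_simp
  rw [hj]
  apply Finset.sum_lt_sum
  · intro I hI
    exact mul_le_mul_of_nonneg_left (X_mem_P (Ch_le H) hI j) (by positivity)
  · have : ∃ I ∈ D.B, j ∉ I := by
      obtain ⟨I, hI⟩ := D.ne
      by_cases hj : j ∈ I
      · obtain ⟨I', hI', _, hk⟩ := D.pivot I hI j hj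
        exact ⟨I', hI', hk⟩
      · exact ⟨I, hI, hj⟩
    obtain ⟨I, hI, hj⟩ := this
    exact ⟨I, hI, mul_lt_mul_of_pos_left (H I hI j hj) (by positivity)⟩

lemma volume_pos {h : ι → ℝ} (H : h ∈ D.Ch) : 0 < vol (D.P h) := by
  obtain ⟨z, hz⟩ := exists_interior H
  have hopen : IsOpen {y | ∀ i, D.a i y < h i} := by
    have : {y | ∀ i, D.a i y < h i} = ⋂ i, {y | D.a i y < h i} := by ext; simp
    rw [this]
    exact isOpen_iInter_of_finite fun i =>
      isOpen_lt (D.a i).continuous_of_finiteDimensional continuous_const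
  have hsub : {y | ∀ i, D.a i y < h i} ⊆ D.P h := fun y hy i => (hy i).le
  have h1 := hopen.measure_pos volume ⟨z, hz⟩
  exact ENNReal.toReal_pos (h1.trans_le (measure_mono hsub)).ne' (P_compact H).measure_lt_top.ne

lemma I_nonempty {D : PDat (n + 1) ι} {I : Finset ι} (hI : I ∈ D.B) : I.Nonempty := by
  by_contra hcon
  rw [Finset.not_nonempty_iff_eq_empty] at hcon
  have := D.huniq I hI (fun _ => 1) (by simp [hcon])
  exact one_ne_zero (congrFun this 0)

lemma I_erase_nonempty {D : PDat (n + 2) ι} {I : Finset ι} (hI : I ∈ D.B) (k : ι) :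
    (I.erase k).Nonempty := by
  by_contra hcon
  rw [Finset.not_nonempty_iff_eq_empty] at hcon
  have hinj : Function.Injective (D.a k) := by
    rw [injective_iff_map_eq_zero]
    intro y hy
    apply D.huniq I hI
    intro i hi
    by_cases hik : i = k
    · rw [hik, hy]
    · have : i ∈ I.erase k := Finset.mem_erase.mpr ⟨hik, hi⟩
      simp [hcon] at this
  have := LinearMap.finrank_le_finrank_of_injective hinj
  simp at this

lemma connected {D : PDat (n + 2) ι} (hC : D.Ch.Nonempty) (g : ι → ℝ)
    (hg : ∀ I ∈ D.B, ∀ i ∈ I, ∀ j ∈ I, g i = g j) {i j : ι} (hi : D.Ess i) (hj : D.Ess j) :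
    g i = g j := by
  obtain ⟨h, H⟩ := hC
  obtain ⟨I0, hI0, hi0⟩ := hi
  obtain ⟨J, hJ, hjJ⟩ := hj
  by_contra hne
  let c : (Fin (n + 2) → ℝ) →ₗ[ℝ] ℝ := ∑ k ∈ I0, D.a k
  have hcv : ∀ y, c y = ∑ k ∈ I0, D.a k y := fun y => by simp [c]
  let S := D.B.filter fun I => ∃ k ∈ I, g k ≠ g i
  have hS : S.Nonempty := ⟨J, Finset.mem_filter.mpr ⟨hJ, j, hjJ, fun h => hne h.symm⟩⟩
  obtain ⟨I, hI, hmax⟩ := S.exists_max_image (fun I => c (D.X I h)) hS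
  obtain ⟨hIB, k, hk, hgk⟩ := Finset.mem_filter.mp hI
  have hle : c (D.X I0 h) ≤ c (D.X I h) := by
    have hpos : ∀ l ∈ I, 0 ≤ c (D.X I (Pi.single l 1)) := by
      intro l hl
      by_contra hneg
      obtain ⟨I', hI', hsub, _, hlt⟩ := pivot_step H c hIB hl (not_le.mp hneg)
      obtain ⟨m, hm⟩ := I_erase_nonempty hIB l
      have : I' ∈ S := Finset.mem_filter.mpr ⟨hI', m, hsub hm, by
        rw [hg I hIB m (Finset.mem_of_mem_erase hm) k hk]; exact hgk⟩
      exact absurd (hmax I' this) (not_le.mpr hlt)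
    rw [rep hIB (D.X I0 h), rep hIB (D.X I h)]
    simp only [map_sum, map_smul, smul_eq_mul]
    refine Finset.sum_le_sum fun l hl => ?_
    rw [D.hX I hIB h l hl]
    exact mul_le_mul_of_nonneg_right (X_mem_P (Ch_le H) hI0 l) (hpos l hl)
  rw [hcv, hcv] at hle
  have hi0I : i ∉ I := fun hiI => hgk (hg I hIB k hk i hiI)
  have hlt : ∑ k ∈ I0, D.a k (D.X I h) < ∑ k ∈ I0, D.a k (D.X I0 h) := by
    apply Finset.sum_lt_sum
    · intro l hl
      rw [D.hX I0 hI0 h l hl]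
      exact X_mem_P (Ch_le H) hIB l
    · refine ⟨i, hi0, ?_⟩
      rw [D.hX I0 hI0 h i hi0]
      exact H I hIB i hi0I
  linarith

end PDat


lemma exists_Phi {n : ℕ} (l : (Fin (n + 1) → ℝ) →ₗ[ℝ] ℝ) (u : Fin (n + 1) → ℝ) (hu : l u = 1) :
    ∃ Φ : (ℝ × (Fin n → ℝ)) ≃ₗ[ℝ] (Fin (n + 1) → ℝ), ∀ s y, l (Φ (s, y)) = s := by
  have hsurj : Function.Surjective l := fun c => ⟨c • u, by simp [hu]⟩
  have hfin : Module.finrank ℝ (LinearMap.ker l) = n := by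
    have h1 := LinearMap.finrank_range_add_finrank_ker l
    rw [LinearMap.range_eq_top.mpr hsurj] at h1
    simp at h1
    omega
  let e : (Fin n → ℝ) ≃ₗ[ℝ] LinearMap.ker l := LinearEquiv.ofFinrankEq _ _ (by simp [hfin])
  have he : ∀ y, l (e y) = 0 := fun y => (e y).2
  let L : (ℝ × (Fin n → ℝ)) →ₗ[ℝ] (Fin (n + 1) → ℝ) :=
    LinearMap.coprod (LinearMap.toSpanSingleton ℝ _ u) ((LinearMap.ker l).subtype ∘ₗ e.toLinearMap)
  have hL : ∀ s y, L (s, y) = s • u + (e y : Fin (n + 1) → ℝ) := fun s y => by simp [L]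
  have hlL : ∀ s y, l (L (s, y)) = s := fun s y => by simp [hL, hu, he]
  have hinj : Function.Injective L := by
    rw [injective_iff_map_eq_zero]
    rintro ⟨s, y⟩ h
    have hs : s = 0 := by rw [← hlL s y, h, map_zero]
    subst hs
    rw [hL, zero_smul, zero_add] at h
    have : e y = 0 := Subtype.ext h
    simp at this
    simp [this]
  have hfr : Module.finrank ℝ (ℝ × (Fin n → ℝ)) = Module.finrank ℝ (Fin (n + 1) → ℝ) := by
    simp; omega
  exact ⟨LinearEquiv.ofBijective L ⟨hinj,
    (LinearMap.injective_iff_surjective_of_finrank_eq_finrank hfr).mp hinj⟩, fun s y => hlL s y⟩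

namespace PDat
variable {n : ℕ} {ι : Type} [Fintype ι] [DecidableEq ι]

/-- Extend a set of facet indices. -/
def up (i : ι) (I : Finset {j // j ≠ i}) : Finset ι :=
  insert i (I.map (Function.Embedding.subtype _))

lemma mem_up {i : ι} {I : Finset {j // j ≠ i}} {j : {j // j ≠ i}} : (j : ι) ∈ up i I ↔ j ∈ I := by
  simp [up, j.2]

lemma self_mem_up {i : ι} {I : Finset {j // j ≠ i}} : i ∈ up i I := by simp [up]

lemma up_subtype {i : ι} {I : Finset ι} (hi : i ∈ I) : up i (I.subtype (· ≠ i)) = I := by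
  ext j
  by_cases hj : j = i
  · subst hj; simp [hi, self_mem_up]
  · have := mem_up (i := i) (I := I.subtype (· ≠ i)) (j := ⟨j, hj⟩)
    simpa using this

/-- Extension by zero. -/
def ext0 (i : ι) : ({j // j ≠ i} → ℝ) →ₗ[ℝ] (ι → ℝ) where
  toFun h j := if hj : j ≠ i then h ⟨j, hj⟩ else 0
  map_add' x y := by ext j; by_cases hj : j = i <;> simp [hj]
  map_smul' c x := by ext j; by_cases hj : j = i <;> simp [hj]

lemma ext0_self (i : ι) (h : {j // j ≠ i} → ℝ) : ext0 i h i = 0 := by simp [ext0]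
lemma ext0_coe (i : ι) (h : {j // j ≠ i} → ℝ) (j : {j // j ≠ i}) : ext0 i h j = h j := by
  simp [ext0, j.2]

lemma Phi_zero {i : ι} {D : PDat (n + 1) ι} {Φ : (ℝ × (Fin n → ℝ)) ≃ₗ[ℝ] (Fin (n + 1) → ℝ)}
    (hΦ : ∀ s y, D.a i (Φ (s, y)) = s) {x : Fin (n + 1) → ℝ} (hx : D.a i x = 0) :
    Φ (0, (Φ.symm x).2) = x := by
  have h1 := hΦ (Φ.symm x).1 (Φ.symm x).2
  simp only [Prod.mk.eta, LinearEquiv.apply_symm_apply, hx] at h1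
  rw [h1]
  simp

/-- The facet datum. -/
noncomputable def facet (D : PDat (n + 1) ι) (i : ι)
    (Φ : (ℝ × (Fin n → ℝ)) ≃ₗ[ℝ] (Fin (n + 1) → ℝ))
    (hΦ : ∀ s y, D.a i (Φ (s, y)) = s) (hi : D.Ess i) : PDat n {j // j ≠ i} where
  a j := D.a j ∘ₗ Φ.toLinearMap ∘ₗ LinearMap.inr ℝ ℝ (Fin n → ℝ)
  B := Finset.univ.filter fun I => up i I ∈ D.B
  X I := LinearMap.snd ℝ ℝ (Fin n → ℝ) ∘ₗ Φ.symm.toLinearMap ∘ₗ D.X (up i I) ∘ₗ ext0 i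
  hX := by
    intro I hI h j hj
    replace hI := (Finset.mem_filter.mp hI).2
    have h0 : D.a i (D.X (up i I) (ext0 i h)) = 0 := by
      rw [D.hX _ hI _ _ self_mem_up, ext0_self]
    have := Phi_zero hΦ h0
    simp only [LinearMap.comp_apply, LinearMap.inr_apply, LinearMap.snd_apply,
      LinearEquiv.coe_coe]
    rw [this, D.hX _ hI _ _ (mem_up.mpr hj), ext0_coe]
  huniq := by
    intro I hI y hy
    replace hI := (Finset.mem_filter.mp hI).2
    have : Φ (0, y) = 0 := by
      apply D.huniq _ hI
      intro j hj
      by_cases hji : j = i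
      · rw [hji, hΦ]
      · exact hy ⟨j, hji⟩ (mem_up.mp hj)
    have h2 : ((0 : ℝ), y) = 0 := by simpa using this
    exact (Prod.mk.inj h2).2
  ne := by
    obtain ⟨I, hI, hiI⟩ := hi
    exact ⟨I.subtype (· ≠ i), Finset.mem_filter.mpr ⟨Finset.mem_univ _, by rwa [up_subtype hiI]⟩⟩
  pivot := by
    intro I hI k hk
    replace hI := (Finset.mem_filter.mp hI).2
    obtain ⟨J, hJ, hsub, hkJ⟩ := D.pivot _ hI k (mem_up.mpr hk)
    have hiJ : i ∈ J := hsub (Finset.mem_erase.mpr ⟨fun h => k.2 h.symm, self_mem_up⟩)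
    refine ⟨J.subtype (· ≠ i), Finset.mem_filter.mpr ⟨Finset.mem_univ _, by rwa [up_subtype hiJ]⟩,
      ?_, ?_⟩
    · intro j hj
      rw [Finset.mem_subtype]
      apply hsub
      rw [Finset.mem_erase] at hj ⊢
      exact ⟨fun h => hj.1 (Subtype.ext h), mem_up.mpr hj.2⟩
    · rw [Finset.mem_subtype]; exact hkJ

/-- The facet projection. -/
noncomputable def proj (D : PDat (n + 1) ι) (i : ι)
    (Φ : (ℝ × (Fin n → ℝ)) ≃ₗ[ℝ] (Fin (n + 1) → ℝ)) : (ι → ℝ) →ₗ[ℝ] ({j // j ≠ i} → ℝ) where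
  toFun h j := h j - h i * D.a j (Φ (1, 0))
  map_add' x y := by ext j; simp; ring
  map_smul' c x := by ext j; simp; ring

lemma exists_scale (Φ : (ℝ × (Fin n → ℝ)) ≃ₗ[ℝ] (Fin (n + 1) → ℝ)) :
    ∃ c : ℝ, 0 < c ∧ ∀ S : Set (Fin (n + 1) → ℝ), MeasurableSet S →
      volume S = ENNReal.ofReal c * volume (Φ ⁻¹' S) := by
  let Ψ := Φ.toContinuousLinearEquiv
  let μ : Measure (Fin (n + 1) → ℝ) := Measure.map Ψ volume
  have hμ : μ.IsAddHaarMeasure := by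
    have : (volume : Measure (ℝ × (Fin n → ℝ))).IsAddHaarMeasure := by
      rw [Measure.volume_eq_prod]; infer_instance
    exact Ψ.isAddHaarMeasure_map volume
  have h1 := Measure.isAddLeftInvariant_eq_smul (volume : Measure (Fin (n + 1) → ℝ)) μ
  have h2 := Measure.addHaarScalarFactor_pos_of_isAddHaarMeasure
    (volume : Measure (Fin (n + 1) → ℝ)) μ
  refine ⟨(volume : Measure (Fin (n + 1) → ℝ)).addHaarScalarFactor μ, h2, fun S hS => ?_⟩
  conv_lhs => rw [h1]
  rw [ENNReal.ofReal_coe_nnreal, Measure.smul_apply,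
    Measure.map_apply Ψ.continuous.measurable hS]
  rfl

lemma facet_exists (D : PDat (n + 1) ι) {i : ι} (hi : D.Ess i) :
    ∃ (F : PDat n {j // j ≠ i}) (π : (ι → ℝ) →ₗ[ℝ] ({j // j ≠ i} → ℝ)) (c : ℝ), 0 < c ∧
      (∀ h ∈ D.Ch, π h ∈ F.Ch) ∧
      (∀ j : {j // j ≠ i}, π (Pi.single (j : ι) 1) = Pi.single j 1) ∧
      (∀ j : {j // j ≠ i}, F.Ess j ↔ ∃ I ∈ D.B, i ∈ I ∧ (j : ι) ∈ I) ∧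
      (∀ (h : ι → ℝ) (s t : ℝ), s ≤ t → volume (D.P (h + t • Pi.single i 1)) =
        volume (D.P (h + s • Pi.single i 1)) + ENNReal.ofReal c *
          ∫⁻ r in Set.Ioc s t, volume (F.P (π (h + r • Pi.single i 1)))) := by
  obtain ⟨I0, hI0, hiI0⟩ := id hi
  obtain ⟨Φ, hΦ⟩ := exists_Phi (D.a i) (D.X I0 (Pi.single i 1)) (by
    rw [D.hX _ hI0 _ _ hiI0]; simp)
  obtain ⟨c, hc, hvol⟩ := exists_scale Φ
  have hsplit : ∀ (j : ι) (s : ℝ) (y : Fin n → ℝ), D.a j (Φ (s, y)) =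
      s * D.a j (Φ (1, 0)) + D.a j (Φ (0, y)) := by
    intro j s y
    have : (s, y) = s • ((1 : ℝ), (0 : Fin n → ℝ)) + (0, y) := by simp
    rw [this, map_add, map_smul, map_add, map_smul, smul_eq_mul]
  have hFa : ∀ j y, (D.facet i Φ hΦ hi).a j y = D.a j (Φ (0, y)) := fun j y => rfl
  have hπ : ∀ h j, D.proj i Φ h j = h j - h i * D.a j (Φ (1, 0)) := fun h j => rfl
  refine ⟨D.facet i Φ hΦ hi, D.proj i Φ, c, hc, ?_, ?_, ?_, ?_⟩
  · intro h H I hI j hj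
    have hI' : up i I ∈ D.B := (Finset.mem_filter.mp hI).2
    have hB : D.X (up i I) h = Φ (h i, (D.facet i Φ hΦ hi).X I (D.proj i Φ h)) := by
      apply X_eq hI'
      intro k hk
      by_cases hki : k = i
      · rw [hki, hΦ]
      · have h1 := (D.facet i Φ hΦ hi).hX I hI (D.proj i Φ h) ⟨k, hki⟩ (mem_up.mp hk)
        rw [hFa, hπ] at h1
        rw [hsplit, h1]
        ring
    have h2 := H (up i I) hI' j (fun h => hj (mem_up.mp h))
    rw [hB, hsplit] at h2
    rw [hFa, hπ]
    linarith
  · intro j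
    ext k
    rw [hπ]
    have : (Pi.single (j : ι) (1 : ℝ) : ι → ℝ) i = 0 := Pi.single_eq_of_ne j.2.symm _
    rw [this, zero_mul, sub_zero]
    simp [Pi.single_apply, Subtype.ext_iff]
  · intro j
    constructor
    · rintro ⟨I, hI, hj⟩
      exact ⟨up i I, (Finset.mem_filter.mp hI).2, self_mem_up, mem_up.mpr hj⟩
    · rintro ⟨I, hI, hiI, hj⟩
      refine ⟨I.subtype (· ≠ i), Finset.mem_filter.mpr ⟨Finset.mem_univ _, by
        rwa [up_subtype hiI]⟩, by rwa [Finset.mem_subtype]⟩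
  · intro h s t hst
    have hmem : ∀ (t σ : ℝ) (y : Fin n → ℝ), Φ (h i + σ, y) ∈ D.P (h + t • Pi.single i 1) ↔
        σ ≤ t ∧ y ∈ (D.facet i Φ hΦ hi).P (D.proj i Φ (h + σ • Pi.single i 1)) := by
      intro t σ y
      constructor
      · intro hy
        refine ⟨?_, fun j => ?_⟩
        · have := hy i
          rw [hΦ] at this
          simpa using this
        · have := hy j
          rw [hsplit] at this
          rw [hFa, hπ]
          simp [Pi.single_eq_of_ne j.2] at this ⊢
          linarith
      · rintro ⟨h1, h2⟩ j
        by_cases hji : j = i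
        · subst hji
          rw [hΦ]; simpa using h1
        · have := h2 ⟨j, hji⟩
          rw [hFa, hπ] at this
          rw [hsplit]
          simp [Pi.single_eq_of_ne hji] at this ⊢
          linarith
    have hV : ∀ t : ℝ, volume (D.P (h + t • (Pi.single i 1 : ι → ℝ))) = ENNReal.ofReal c *
        ∫⁻ σ in Set.Iic t,
          volume ((D.facet i Φ hΦ hi).P (D.proj i Φ (h + σ • Pi.single i 1))) := by
      intro t
      rw [hvol _ (P_closed _).measurableSet]
      congr 1
      have hmeas : MeasurableSet (Φ ⁻¹' D.P (h + t • Pi.single i 1)) :=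
        (Φ.toContinuousLinearEquiv.continuous.measurable) (P_closed _).measurableSet
      rw [Measure.volume_eq_prod, Measure.prod_apply hmeas,
        ← lintegral_add_left_eq_self _ (h i), ← lintegral_indicator measurableSet_Iic]
      refine lintegral_congr fun σ => ?_
      by_cases hσ : σ ≤ t
      · rw [Set.indicator_of_mem (by exact hσ)]
        congr 1
        ext y
        simp only [Set.mem_preimage, hmem, hσ, true_and]
      · rw [Set.indicator_of_notMem (by exact hσ)]
        refine Eq.trans (congrArg _ ?_) measure_empty
        ext y
        simp only [Set.mem_preimage, hmem, hσ, false_and, Set.mem_empty_iff_false]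
    rw [hV t, hV s, ← mul_add, ← lintegral_union measurableSet_Ioc]
    · rw [Set.Iic_union_Ioc_eq_Iic hst]
    · exact Set.disjoint_left.mpr fun x hx hx' => not_lt.mpr hx hx'.1

end PDat

section Partials
variable {ι : Type} [Fintype ι] [DecidableEq ι]

lemma hasDerivAt_of_partials {V : (ι → ℝ) → ℝ} {U : Set (ι → ℝ)} (hU : IsOpen U)
    (G : ι → (ι → ℝ) → ℝ) (hG : ∀ i, Continuous (G i))
    (hV : ∀ (y : ι → ℝ) (i : ι) (u : ℝ), y + u • (Pi.single i 1 : ι → ℝ) ∈ U →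
      HasDerivAt (fun t : ℝ => V (y + t • (Pi.single i 1 : ι → ℝ)))
        (G i (y + u • (Pi.single i 1 : ι → ℝ))) u)
    {h : ι → ℝ} (hh : h ∈ U) (v : ι → ℝ) :
    HasDerivAt (fun t : ℝ => V (h + t • v)) (∑ i, v i * G i h) 0 := by
  have key : ∀ S : Finset ι, HasDerivAt
      (fun t : ℝ => V (h + t • ∑ i ∈ S, v i • (Pi.single i 1 : ι → ℝ)))
      (∑ i ∈ S, v i * G i h) 0 := by
    intro S
    induction S using Finset.induction_on with
    | empty => simpa using hasDerivAt_const (0:ℝ) (V h)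
    | insert a S ha ih =>
      set w := ∑ i ∈ S, v i • (Pi.single i 1 : ι → ℝ) with hw
      set e : ι → ℝ := Pi.single a 1 with he
      have hne : ‖e‖ = 1 := by rw [he, Pi.norm_single, norm_one]
      have hd : HasDerivAt (fun t : ℝ => V (h + t • w + (t * v a) • e) - V (h + t • w))
          (v a * G a h) 0 := by
        rw [hasDerivAt_iff_isLittleO, Asymptotics.isLittleO_iff]
        intro c hc
        have hc' : 0 < c / (|v a| + 1) := by positivity
        have hnb : ∀ᶠ y in nhds h, y ∈ U ∧ |G a y - G a h| < c / (|v a| + 1) := by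
          refine Filter.Eventually.and (hU.mem_nhds hh) ?_
          have := Metric.tendsto_nhds.mp ((hG a).tendsto h) (c / (|v a| + 1)) hc'
          simpa [Real.dist_eq] using this
        obtain ⟨δ, hδ, hb⟩ := Metric.eventually_nhds_iff.mp hnb
        have hev : ∀ᶠ t in nhds (0:ℝ), |t| * (‖w‖ + |v a|) < δ := by
          have hcont : Continuous (fun t : ℝ => |t| * (‖w‖ + |v a|)) := by fun_prop
          have := hcont.tendsto 0
          simp only [abs_zero, zero_mul] at this
          exact this.eventually_lt_const hδ
        filter_upwards [hev] with t ht
        have hin : ∀ u ∈ Metric.closedBall (0:ℝ) |t * v a|,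
            h + t • w + u • e ∈ U ∧ |G a (h + t • w + u • e) - G a h| < c / (|v a| + 1) := by
          intro u hu
          apply hb
          rw [dist_eq_norm]
          have : h + t • w + u • e - h = t • w + u • e := by abel
          rw [this]
          refine lt_of_le_of_lt (norm_add_le _ _) ?_
          rw [norm_smul, norm_smul, hne, mul_one]
          simp only [Metric.mem_closedBall, dist_zero_right, Real.norm_eq_abs] at hu ⊢
          rw [abs_mul] at hu
          nlinarith
        have hmv := Convex.norm_image_sub_le_of_norm_hasDerivWithin_le
          (f := fun u : ℝ => V (h + t • w + u • e) - u * G a h)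
          (f' := fun u : ℝ => G a (h + t • w + u • e) - G a h) (C := c / (|v a| + 1))
          (s := Metric.closedBall (0:ℝ) |t * v a|) (x := 0) (y := t * v a)
          (fun u hu => by
            have h1 := hV (h + t • w) a u (hin u hu).1
            have h2 := (hasDerivAt_id u).mul_const (G a h)
            exact ((h1.sub h2).congr_deriv (by simp [he])).hasDerivWithinAt)
          (fun u hu => (hin u hu).2.le) (convex_closedBall _ _) (by simp; positivity) (by simp)
        have hR : c / (|v a| + 1) * ‖t * v a - 0‖ ≤ c * ‖t - 0‖ := by
          simp only [sub_zero, Real.norm_eq_abs, abs_mul]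
          rw [div_mul_eq_mul_div, div_le_iff₀ (by positivity)]
          have := abs_nonneg t
          have := abs_nonneg (v a)
          nlinarith [mul_nonneg hc.le (abs_nonneg t)]
        refine le_trans (le_of_eq ?_) (hmv.trans hR)
        congr 1
        simp
        ring
      refine ((ih.add hd).congr_deriv ?_).congr_of_eventuallyEq (Filter.Eventually.of_forall ?_)
      · rw [Finset.sum_insert ha]; ring
      · intro t
        simp only [Pi.add_apply]
        rw [Finset.sum_insert ha]
        have : h + t • (v a • (Pi.single a 1 : ι → ℝ) + ∑ x ∈ S, v x • (Pi.single x 1 : ι → ℝ)) =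
          h + t • w + (t * v a) • e := by rw [smul_add, ← hw, smul_smul, he]; abel
        rw [this]; ring
  have := key Finset.univ
  have hv : ∑ i, v i • (Pi.single i 1 : ι → ℝ) = v := by
    ext j; simp [Finset.sum_apply, Pi.single_apply]
  rwa [hv] at this

end Partials

open MvPolynomial in
/-- `f` is the volume polynomial of the datum `D`. -/
def IsVol {n : ℕ} {ι : Type} [Fintype ι] [DecidableEq ι] (D : PDat n ι) (f : MvPolynomial ι ℝ) :
    Prop := f.IsHomogeneous n ∧ ∀ h ∈ D.Ch, vol (D.P h) = eval h f

section VolPoly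
open MvPolynomial PDat
variable {n : ℕ} {ι : Type} [Fintype ι] [DecidableEq ι]

lemma deriv_iness {D : PDat n ι} {i : ι} (hi : ¬ D.Ess i) (y : ι → ℝ) (u : ℝ)
    (hu : y + u • (Pi.single i 1 : ι → ℝ) ∈ D.Ch) :
    HasDerivAt (fun t : ℝ => vol (D.P (y + t • (Pi.single i 1 : ι → ℝ)))) 0 u := by
  have hcont : Continuous fun t : ℝ => y + t • (Pi.single i 1 : ι → ℝ) := by fun_prop
  have hev : ∀ᶠ t in nhds u, y + t • (Pi.single i 1 : ι → ℝ) ∈ D.Ch :=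
    hcont.continuousAt.eventually (Ch_isOpen.mem_nhds hu)
  refine (hasDerivAt_const u (vol (D.P (y + u • (Pi.single i 1 : ι → ℝ))))).congr_of_eventuallyEq ?_
  filter_upwards [hev] with t ht
  have hx : ∀ I ∈ D.B, D.X I (Pi.single i 1) = 0 := by
    intro I hI
    apply X_eq hI
    intro j hj
    have : j ≠ i := fun h => hi ⟨I, hI, h ▸ hj⟩
    simp [Pi.single_eq_of_ne this]
  rw [P_eq ⟨_, hu⟩ (Ch_le ht), P_eq ⟨_, hu⟩ (Ch_le hu)]
  congr 2
  refine Set.image_congr fun I hI => ?_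
  simp [hx I hI]

lemma deriv_ess {D : PDat (n + 1) ι} {i : ι} {F : PDat n {j // j ≠ i}}
    {π : (ι → ℝ) →ₗ[ℝ] ({j // j ≠ i} → ℝ)} {c : ℝ} (hc : 0 < c)
    (hπ : ∀ h ∈ D.Ch, π h ∈ F.Ch)
    (hv : ∀ (h : ι → ℝ) (s t : ℝ), s ≤ t → volume (D.P (h + t • Pi.single i 1)) =
        volume (D.P (h + s • Pi.single i 1)) + ENNReal.ofReal c *
          ∫⁻ r in Set.Ioc s t, volume (F.P (π (h + r • Pi.single i 1))))
    {g : MvPolynomial {j // j ≠ i} ℝ} (hg : IsVol F g) (y : ι → ℝ) (u : ℝ)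
    (hu : y + u • (Pi.single i 1 : ι → ℝ) ∈ D.Ch) :
    HasDerivAt (fun t : ℝ => vol (D.P (y + t • (Pi.single i 1 : ι → ℝ))))
      (eval (y + u • (Pi.single i 1 : ι → ℝ)) (c • pull π g)) u := by
  have hcont : Continuous fun t : ℝ => y + t • (Pi.single i 1 : ι → ℝ) := by fun_prop
  have hev : ∀ᶠ t in nhds u, y + t • (Pi.single i 1 : ι → ℝ) ∈ D.Ch :=
    hcont.continuousAt.eventually (Ch_isOpen.mem_nhds hu)
  obtain ⟨δ, hδ, hb⟩ := Metric.eventually_nhds_iff.mp hev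
  set φ : ℝ → ℝ := fun r => eval (y + r • (Pi.single i 1 : ι → ℝ)) (pull π g) with hφ
  have hφc : Continuous φ := (MvPolynomial.continuous_eval _).comp hcont
  have hFTC := intervalIntegral.integral_hasDerivAt_right
    (hφc.intervalIntegrable (u - δ/2) u) (hφc.stronglyMeasurableAtFilter _ _) hφc.continuousAt
  have h2 := (hFTC.const_mul c).const_add (vol (D.P (y + (u - δ/2) • (Pi.single i 1 : ι → ℝ))))
  refine (h2.congr_of_eventuallyEq ?_).congr_deriv (by simp [hφ, smul_eval])
  have hs : y + (u - δ/2) • (Pi.single i 1 : ι → ℝ) ∈ D.Ch := hb (by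
    rw [Real.dist_eq, abs_lt]; constructor <;> linarith)
  filter_upwards [Metric.ball_mem_nhds u (half_pos hδ)] with t ht
  rw [Metric.mem_ball, Real.dist_eq, abs_lt] at ht
  have hst : u - δ/2 ≤ t := by linarith
  have hIn : ∀ r ∈ Set.Ioc (u - δ/2) t, y + r • (Pi.single i 1 : ι → ℝ) ∈ D.Ch := by
    intro r hr
    apply hb
    rw [Real.dist_eq, abs_lt]; constructor <;> linarith [hr.1, hr.2]
  have hval : ∀ r ∈ Set.Ioc (u - δ/2) t,
      volume (F.P (π (y + r • (Pi.single i 1 : ι → ℝ)))) = ENNReal.ofReal (φ r) := by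
    intro r hr
    have h3 := hπ _ (hIn r hr)
    rw [hφ]
    simp only
    rw [eval_pull, ← hg.2 _ h3, vol, ENNReal.ofReal_toReal (P_compact h3).measure_lt_top.ne]
  have hnn : ∀ r ∈ Set.Ioc (u - δ/2) t, 0 ≤ φ r := by
    intro r hr
    have h3 := hπ _ (hIn r hr)
    rw [hφ]
    simp only
    rw [eval_pull, ← hg.2 _ h3]
    exact ENNReal.toReal_nonneg
  have hint : IntegrableOn φ (Set.Ioc (u - δ/2) t) :=
    (hφc.integrableOn_Icc).mono_set Set.Ioc_subset_Icc_self
  have h4 := hv y _ _ hst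
  rw [setLIntegral_congr_fun measurableSet_Ioc hval,
    ← ofReal_integral_eq_lintegral_ofReal hint
      ((ae_restrict_iff' measurableSet_Ioc).mpr (Filter.Eventually.of_forall hnn)),
    ← intervalIntegral.integral_of_le hst] at h4
  have hI0 : 0 ≤ ∫ r in (u - δ/2)..t, φ r := by
    rw [intervalIntegral.integral_of_le hst]
    exact setIntegral_nonneg measurableSet_Ioc hnn
  rw [vol, h4, ENNReal.toReal_add (P_compact hs).measure_lt_top.ne
    (ENNReal.mul_ne_top ENNReal.ofReal_ne_top ENNReal.ofReal_ne_top), ENNReal.toReal_mul,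
    ENNReal.toReal_ofReal hc.le, ENNReal.toReal_ofReal hI0, vol]

lemma exists_isVol : ∀ (n : ℕ) (ι : Type) [Fintype ι] [DecidableEq ι] (D : PDat n ι),
    ∃ f, IsVol D f := by
  intro n
  induction n with
  | zero =>
    intro ι _ _ D
    refine ⟨1, isHomogeneous_one _ _, fun h H => ?_⟩
    have : D.P h = Set.univ := by
      obtain ⟨z, hz⟩ := exists_interior H
      ext y
      simp only [Set.mem_univ, iff_true]
      rw [Subsingleton.elim y z]
      exact fun i => (hz i).le
    rw [this, vol, map_one, volume_pi, Measure.pi_of_empty (x := 0)]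
    simp
  | succ n ih =>
    intro ι _ _ D
    have hex : ∀ i, ∃ G : MvPolynomial ι ℝ, G.IsHomogeneous n ∧
        ∀ (y : ι → ℝ) (u : ℝ), y + u • (Pi.single i 1 : ι → ℝ) ∈ D.Ch →
          HasDerivAt (fun t : ℝ => vol (D.P (y + t • (Pi.single i 1 : ι → ℝ))))
            (eval (y + u • (Pi.single i 1 : ι → ℝ)) G) u := by
      intro i
      by_cases hi : D.Ess i
      · obtain ⟨F, π, c, hc, hπ, -, -, hv⟩ := facet_exists D hi
        obtain ⟨g, hg⟩ := ih _ F
        refine ⟨c • pull π g, ?_, deriv_ess hc hπ hv hg⟩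
        rw [smul_eq_C_mul]
        simpa using (isHomogeneous_C ι c).mul (pull_homog π hg.1)
      · exact ⟨0, isHomogeneous_zero _ _ _, fun y u hu => by
          rw [map_zero]; exact deriv_iness hi y u hu⟩
    choose G hGh hGd using hex
    refine ⟨C ((n:ℝ) + 1)⁻¹ * ∑ i, MvPolynomial.X i * G i, ?_, fun h H => ?_⟩
    · have h1 : (∑ i, MvPolynomial.X i * G i : MvPolynomial ι ℝ).IsHomogeneous (n + 1) :=
        IsHomogeneous.sum _ _ _ fun i _ => by
          rw [add_comm]; exact (isHomogeneous_X ℝ i).mul (hGh i)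
      simpa using (isHomogeneous_C ι ((n:ℝ) + 1)⁻¹).mul h1
    · have h1 := hasDerivAt_of_partials (V := fun h => vol (D.P h)) Ch_isOpen (fun i h => eval h (G i))
        (fun i => MvPolynomial.continuous_eval _) (fun y i u hu => hGd i y u hu) H h
      have h2 : HasDerivAt (fun t : ℝ => (1 + t) ^ (n + 1) * vol (D.P h))
          (((n:ℝ) + 1) * vol (D.P h)) 0 := by
        have := (((hasDerivAt_id (0:ℝ)).const_add 1).pow (n + 1)).mul_const (vol (D.P h))
        exact this.congr_deriv (by simp)
      have h3 : HasDerivAt (fun t : ℝ => vol (D.P (h + t • h)))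
          (((n:ℝ) + 1) * vol (D.P h)) 0 := by
        refine h2.congr_of_eventuallyEq ?_
        filter_upwards [lt_mem_nhds (show (-1:ℝ) < 0 by norm_num)] with t ht
        have ht' : 0 < 1 + t := by linarith
        have : h + t • h = (1 + t) • h := by rw [add_smul, one_smul]
        rw [this, P_smul h ht', vol, Measure.addHaar_smul, ENNReal.toReal_mul, vol]
        rw [ENNReal.toReal_ofReal (abs_nonneg _), abs_of_pos (by positivity)]
        simp
      have h4 := h1.unique h3
      rw [map_mul, eval_C, map_sum]
      simp only [map_mul, eval_X]
      rw [h4]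
      field_simp

lemma pderiv_of_hasDeriv {D : PDat n ι} (hC : D.Ch.Nonempty) {f G : MvPolynomial ι ℝ}
    (hf : IsVol D f) (i : ι)
    (hG : ∀ (y : ι → ℝ) (u : ℝ), y + u • (Pi.single i 1 : ι → ℝ) ∈ D.Ch →
          HasDerivAt (fun t : ℝ => vol (D.P (y + t • (Pi.single i 1 : ι → ℝ))))
            (eval (y + u • (Pi.single i 1 : ι → ℝ)) G) u) : pderiv i f = G := by
  apply eq_of_eqOn_open Ch_isOpen hC
  intro h H
  have h1 := hG h 0 (by simpa using H)
  have h2 := hasDerivAt_eval_line f h (Pi.single i 1) 0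
  have hcont : Continuous fun t : ℝ => h + t • (Pi.single i 1 : ι → ℝ) := by fun_prop
  have hev : ∀ᶠ t in nhds (0:ℝ), h + t • (Pi.single i 1 : ι → ℝ) ∈ D.Ch :=
    hcont.continuousAt.eventually (Ch_isOpen.mem_nhds (by simpa using H))
  have h3 := h2.unique (h1.congr_of_eventuallyEq (by
    filter_upwards [hev] with t ht
    exact (hf.2 _ ht).symm))
  simpa [dir_single] using h3

lemma pderiv_iness {D : PDat n ι} (hC : D.Ch.Nonempty) {f : MvPolynomial ι ℝ}
    (hf : IsVol D f) {i : ι} (hi : ¬ D.Ess i) : pderiv i f = 0 :=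
  pderiv_of_hasDeriv hC hf i fun y u hu => by rw [map_zero]; exact deriv_iness hi y u hu

lemma facet_alg {D : PDat (n + 1) ι} (hC : D.Ch.Nonempty) {f : MvPolynomial ι ℝ}
    (hf : IsVol D f) {i : ι} (hi : D.Ess i) :
    ∃ (F : PDat n {j // j ≠ i}) (π : (ι → ℝ) →ₗ[ℝ] ({j // j ≠ i} → ℝ)) (c : ℝ)
      (g : MvPolynomial {j // j ≠ i} ℝ), 0 < c ∧ IsVol F g ∧
      (∀ h ∈ D.Ch, π h ∈ F.Ch) ∧
      (∀ j : {j // j ≠ i}, π (Pi.single (j : ι) 1) = Pi.single j 1) ∧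
      (∀ j : {j // j ≠ i}, F.Ess j ↔ ∃ I ∈ D.B, i ∈ I ∧ (j : ι) ∈ I) ∧
      pderiv i f = c • pull π g := by
  obtain ⟨F, π, c, hc, hπ, hs, hE, hv⟩ := facet_exists D hi
  obtain ⟨g, hg⟩ := exists_isVol _ _ F
  exact ⟨F, π, c, g, hc, hg, hπ, hs, hE,
    pderiv_of_hasDeriv hC hf i (deriv_ess hc hπ hv hg)⟩

lemma facet_T {D : PDat (n + 1) ι} {i : ι} {π : (ι → ℝ) →ₗ[ℝ] ({j // j ≠ i} → ℝ)} {c : ℝ}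
    {f : MvPolynomial ι ℝ} {g : MvPolynomial {j // j ≠ i} ℝ} (h : pderiv i f = c • pull π g)
    (l : List (ι → ℝ)) : T f (Pi.single i 1 :: l) = c * T g (l.map π) := by
  rw [T_cons, dir_single, h, T_smul, T_pull]

end VolPoly

section Pos
open MvPolynomial PDat
variable {n : ℕ} {ι : Type} [Fintype ι] [DecidableEq ι]

lemma dir_lin {D : PDat n ι} (hC : D.Ch.Nonempty) {f : MvPolynomial ι ℝ} (hf : IsVol D f)
    (z : Fin n → ℝ) : dir (fun j => D.a j z) f = 0 := by
  apply eq_of_eqOn_open Ch_isOpen hC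
  intro h H
  set v : ι → ℝ := fun j => D.a j z with hv
  have h2 := hasDerivAt_eval_line f h v 0
  have hX : ∀ I ∈ D.B, D.X I v = z := fun I hI => X_eq hI fun i _ => rfl
  have hin : ∀ t : ℝ, h + t • v ∈ D.Ch := by
    intro t I hI j hj
    have h1 := H I hI j hj
    simp only [map_add, map_smul, hX I hI, Pi.add_apply, Pi.smul_apply, smul_eq_mul]
    have : v j = D.a j z := rfl
    rw [this]
    linarith
  have hvol : ∀ t : ℝ, vol (D.P (h + t • v)) = vol (D.P h) := by
    intro t
    have : D.P (h + t • v) = (fun y => -(t • z) + y) ⁻¹' D.P h := by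
      ext y
      refine forall_congr' fun i => ?_
      have : v i = D.a i z := rfl
      simp only [Pi.add_apply, Pi.smul_apply, smul_eq_mul, map_add, map_neg, map_smul, this]
      constructor <;> intro h <;> linarith
    rw [vol, this, measure_preimage_add, vol]
  have h3 := h2.unique ((hasDerivAt_const (0:ℝ) (vol (D.P h))).congr_of_eventuallyEq
    (Filter.Eventually.of_forall fun t => by
      simp only
      rw [← hf.2 _ (hin t), hvol]))
  simpa using h3

lemma T_sub_lin {D : PDat n ι} (hC : D.Ch.Nonempty) {f : MvPolynomial ι ℝ} (hf : IsVol D f)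
    (z : Fin n → ℝ) (v : ι → ℝ) (l : List (ι → ℝ)) :
    T f ((v - fun j => D.a j z) :: l) = T f (v :: l) := by
  have : v = (v - fun j => D.a j z) + fun j => D.a j z := by simp
  conv_rhs => rw [this, T_cons_add]
  rw [T_cons f (fun j => D.a j z), dir_lin hC hf, T_zero, add_zero]

lemma T_e_iness {D : PDat n ι} (hC : D.Ch.Nonempty) {f : MvPolynomial ι ℝ} (hf : IsVol D f)
    {i : ι} (hi : ¬ D.Ess i) (l : List (ι → ℝ)) : T f (Pi.single i 1 :: l) = 0 := by
  rw [T_cons, dir_single, pderiv_iness hC hf hi, T_zero]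

lemma T_pos : ∀ (n : ℕ) (ι : Type) [Fintype ι] [DecidableEq ι] (D : PDat n ι)
    (f : MvPolynomial ι ℝ), D.Ch.Nonempty → IsVol D f → ∀ l : List (ι → ℝ), l.length = n →
    (∀ h ∈ l, h ∈ D.Ch) → 0 < T f l := by
  intro n
  induction n with
  | zero =>
    intro ι _ _ D f hC hf l hl _
    rw [List.length_eq_zero_iff] at hl
    subst hl
    obtain ⟨h, H⟩ := hC
    have h1 := volume_pos H
    rw [hf.2 h H] at h1
    have h2 : f = C (coeff 0 f) := by
      rw [← totalDegree_eq_zero_iff_eq_C]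
      exact Nat.le_zero.mp hf.1.totalDegree_le
    rw [T_nil]
    rw [h2] at h1 ⊢
    simpa using h1
  | succ n ih =>
    intro ι _ _ D f hC hf l hl hlC
    obtain ⟨v, l, rfl⟩ := List.exists_cons_of_length_eq_add_one hl
    have hl' : l.length = n := by simpa using hl
    have hlC' : ∀ h ∈ l, h ∈ D.Ch := fun h hh => hlC h (List.mem_cons_of_mem _ hh)
    have hpos : ∀ i, D.Ess i → 0 < T (pderiv i f) l := by
      intro i hi
      obtain ⟨F, π, c, g, hc, hg, hπ, -, -, hd⟩ := facet_alg hC hf hi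
      rw [hd, T_smul, T_pull]
      refine mul_pos hc (ih _ F g ?_ hg _ (by simpa using hl') ?_)
      · obtain ⟨h, H⟩ := hC
        exact ⟨π h, hπ h H⟩
      · intro h hh
        obtain ⟨h', hh', rfl⟩ := List.mem_map.mp hh
        exact hπ _ (hlC' _ hh')
    obtain ⟨z, hz⟩ := exists_interior (hlC v List.mem_cons_self)
    rw [← T_sub_lin hC hf z, T_cons_sum]
    apply Finset.sum_pos'
    · intro i _
      by_cases hi : D.Ess i
      · exact mul_nonneg (sub_nonneg.mpr (hz i).le) (hpos i hi).le
      · rw [pderiv_iness hC hf hi, T_zero, mul_zero]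
    · obtain ⟨I, hI⟩ := D.ne
      obtain ⟨i, hi⟩ := I_nonempty hI
      exact ⟨i, Finset.mem_univ _, mul_pos (sub_pos.mpr (hz i)) (hpos i ⟨I, hI, hi⟩)⟩

lemma T_e_pos {D : PDat (n + 1) ι} (hC : D.Ch.Nonempty) {f : MvPolynomial ι ℝ}
    (hf : IsVol D f) {i : ι} (hi : D.Ess i) {l : List (ι → ℝ)} (hl : l.length = n)
    (hlC : ∀ h ∈ l, h ∈ D.Ch) : 0 < T f (Pi.single i 1 :: l) := by
  obtain ⟨F, π, c, g, hc, hg, hπ, -, -, hd⟩ := facet_alg hC hf hi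
  rw [T_cons, dir_single, hd, T_smul, T_pull]
  refine mul_pos hc (T_pos _ _ F g ?_ hg _ (by simpa using hl) ?_)
  · obtain ⟨h, H⟩ := hC
    exact ⟨π h, hπ h H⟩
  · intro h hh
    obtain ⟨h', hh', rfl⟩ := List.mem_map.mp hh
    exact hπ _ (hlC _ hh')

lemma T_ee_pos {D : PDat (n + 2) ι} (hC : D.Ch.Nonempty) {f : MvPolynomial ι ℝ}
    (hf : IsVol D f) {i j : ι} (hij : j ≠ i) {I : Finset ι} (hI : I ∈ D.B) (hi : i ∈ I)
    (hj : j ∈ I) {l : List (ι → ℝ)} (hl : l.length = n)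
    (hlC : ∀ h ∈ l, h ∈ D.Ch) : 0 < T f (Pi.single i 1 :: Pi.single j 1 :: l) := by
  obtain ⟨F, π, c, g, hc, hg, hπ, hs, hE, hd⟩ := facet_alg hC hf ⟨I, hI, hi⟩
  rw [T_cons, dir_single, hd, T_smul, T_pull, List.map_cons, hs ⟨j, hij⟩]
  refine mul_pos hc (T_e_pos ?_ hg ((hE _).mpr ⟨I, hI, hi, hj⟩) (by simpa using hl) ?_)
  · obtain ⟨h, H⟩ := hC
    exact ⟨π h, hπ h H⟩
  · intro h hh
    obtain ⟨h', hh', rfl⟩ := List.mem_map.mp hh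
    exact hπ _ (hlC _ hh')

lemma T_ee_nonneg {D : PDat (n + 2) ι} (hC : D.Ch.Nonempty) {f : MvPolynomial ι ℝ}
    (hf : IsVol D f) {i j : ι} (hij : j ≠ i) {l : List (ι → ℝ)} (hl : l.length = n)
    (hlC : ∀ h ∈ l, h ∈ D.Ch) : 0 ≤ T f (Pi.single i 1 :: Pi.single j 1 :: l) := by
  by_cases hi : D.Ess i
  · obtain ⟨F, π, c, g, hc, hg, hπ, hs, hE, hd⟩ := facet_alg hC hf hi
    rw [T_cons, dir_single, hd, T_smul, T_pull, List.map_cons, hs ⟨j, hij⟩]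
    have hFC : F.Ch.Nonempty := by
      obtain ⟨h, H⟩ := hC
      exact ⟨π h, hπ h H⟩
    by_cases hj : F.Ess ⟨j, hij⟩
    · refine (mul_pos hc (T_e_pos hFC hg hj (by simpa using hl) ?_)).le
      intro h hh
      obtain ⟨h', hh', rfl⟩ := List.mem_map.mp hh
      exact hπ _ (hlC _ hh')
    · rw [T_e_iness hFC hg hj, mul_zero]
  · rw [T_e_iness hC hf hi]

end Pos

section Boch
variable {ι : Type} [Fintype ι] [DecidableEq ι]

lemma spectral (M : ι → ι → ℝ) (hM : ∀ i j, M i j = M j i) :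
    ∃ (lam : ι → ℝ) (b : ι → ι → ℝ), (∀ k i, ∑ j, M i j * b k j = lam k * b k i) ∧
      (∀ k, ∑ i, b k i * b k i = 1) ∧
      (∀ y z : ι → ℝ, ∑ k, (∑ i, y i * b k i) * (∑ i, b k i * z i) = ∑ i, y i * z i) := by
  have hH : (Matrix.of M).IsHermitian := by
    ext i j
    simp [Matrix.conjTranspose_apply, hM i j]
  refine ⟨hH.eigenvalues, fun k => (hH.eigenvectorBasis k).ofLp, ?_, ?_, ?_⟩
  · intro k i
    have := congrFun (hH.mulVec_eigenvectorBasis k) i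
    simpa [Matrix.mulVec, dotProduct] using this
  · intro k
    have h1 := hH.eigenvectorBasis.orthonormal.1 k
    have h2 := EuclideanSpace.real_norm_sq_eq (hH.eigenvectorBasis k)
    rw [h1] at h2
    rw [one_pow] at h2
    rw [h2]
    exact Finset.sum_congr rfl fun i _ => (sq _).symm
  · intro y z
    have := hH.eigenvectorBasis.sum_inner_mul_inner (WithLp.toLp 2 y) (WithLp.toLp 2 z)
    simp only [PiLp.inner_apply, RCLike.inner_apply, conj_trivial] at this
    convert this using 2
    · congr 1 <;> exact Finset.sum_congr rfl fun i _ => mul_comm _ _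
    · ring

lemma q_ident (A : ι → ι → ℝ) (hA : ∀ i j, A i j = A j i) (v : ι → ℝ) (hv : ∀ i, 0 < v i)
    (x : ι → ℝ) :
    ∑ i, (∑ j, A i j * v j) / v i * x i ^ 2 - ∑ i, ∑ j, A i j * x i * x j =
      (1/2) * ∑ i, ∑ j, A i j * v i * v j * (x i / v i - x j / v j) ^ 2 := by
  have h1 : ∀ i j, A i j * v i * v j * (x i / v i - x j / v j) ^ 2 =
      A i j * v j / v i * x i ^ 2 - 2 * (A i j * x i * x j) + A j i * v i / v j * x j ^ 2 := by
    intro i j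
    have := hv i
    have := hv j
    rw [hA j i]
    field_simp
    ring
  simp only [h1, Finset.sum_add_distrib, Finset.sum_sub_distrib]
  have h2 : ∑ i, ∑ j, A j i * v i / v j * x j ^ 2 = ∑ i, ∑ j, A i j * v j / v i * x i ^ 2 :=
    Finset.sum_comm
  have h3 : ∑ i, (∑ j, A i j * v j) / v i * x i ^ 2 = ∑ i, ∑ j, A i j * v j / v i * x i ^ 2 := by
    refine Finset.sum_congr rfl fun i _ => ?_
    rw [Finset.sum_div, Finset.sum_mul]
  rw [h2, h3]
  simp only [← Finset.mul_sum]
  ring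

lemma bochner (A : ι → ι → ℝ) (hA : ∀ i j, A i j = A j i) (hoff : ∀ i j, j ≠ i → 0 ≤ A i j)
    (v : ι → ℝ) (hv : ∀ i, 0 < v i) (p : ι → ℝ) (hpd : ∀ i, p i = ∑ j, A i j * v j)
    (hp : ∀ i, 0 < p i ∨ (p i = 0 ∧ ∀ j, A i j = 0))
    (conn : ∀ g : ι → ℝ, (∀ i j, j ≠ i → 0 < A i j → g i = g j) →
      ∀ i j, 0 < p i → 0 < p j → g i = g j)
    (hB : ∀ x : ι → ℝ, ∑ i, ∑ j, A i j * x i * x j ≤ ∑ i, v i / p i * (∑ j, A i j * x j) ^ 2)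
    (x : ι → ℝ) (hx : ∑ i, x i * p i = 0) : ∑ i, ∑ j, A i j * x i * x j ≤ 0 := by
  set r : ι → ℝ := fun i => √(v i / p i) with hr
  have hr2 : ∀ i, r i ^ 2 = v i / p i := fun i => Real.sq_sqrt (by
    rcases hp i with h | h
    · exact (div_pos (hv i) h).le
    · rw [h.1, div_zero])
  have hr0 : ∀ i, 0 < p i → 0 < r i := fun i h => Real.sqrt_pos.mpr (div_pos (hv i) h)
  obtain ⟨lam, b, hb1, hb2, hb3⟩ := spectral (fun i j => r i * A i j * r j) (fun i j => by
    simp only [hA i j]; ring)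
  have hq : ∀ y : ι → ℝ, ∑ i, ∑ j, A i j * (r i * y i) * (r j * y j) =
      ∑ i, y i * ∑ j, r i * A i j * r j * y j := by
    intro y
    refine Finset.sum_congr rfl fun i _ => ?_
    rw [Finset.mul_sum]
    exact Finset.sum_congr rfl fun j _ => by ring
  set y : ι → ℝ := fun i => if 0 < p i then x i / r i else 0 with hy
  have hyr : ∀ i j, A i j * x i * x j = A i j * (r i * y i) * (r j * y j) := by
    intro i j
    rcases hp i with h | h
    · rcases hp j with h' | h'
      · have := hr0 i h
        have := hr0 j h'
        simp only [hy, h, h', if_true]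
        field_simp
      · rw [hA i j, h'.2 i]; ring
    · rw [h.2 j]; ring
  have hqx : ∑ i, ∑ j, A i j * x i * x j = ∑ k, lam k * (∑ i, y i * b k i) ^ 2 := by
    simp only [hyr]
    rw [hq, ← hb3]
    refine Finset.sum_congr rfl fun k _ => ?_
    have : ∑ i, b k i * ∑ j, r i * A i j * r j * y j = lam k * ∑ i, y i * b k i := by
      simp only [Finset.mul_sum]
      rw [Finset.sum_comm]
      refine Finset.sum_congr rfl fun j _ => ?_
      have := hb1 k j
      calc ∑ i, b k i * (r i * A i j * r j * y j) = y j * ∑ i, r j * A j i * r i * b k i := by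
            rw [Finset.mul_sum]
            exact Finset.sum_congr rfl fun i _ => by rw [hA j i]; ring
        _ = _ := by rw [this]; ring
    rw [this]; ring
  rw [hqx]
  apply Finset.sum_nonpos
  intro k _
  by_cases hlam : lam k ≤ 0
  · exact mul_nonpos_of_nonpos_of_nonneg hlam (sq_nonneg _)
  push Not at hlam
  -- eigenvector `b k` is proportional to the distinguished one
  set e := b k with he
  have hqe : ∑ i, ∑ j, A i j * (r i * e i) * (r j * e j) = lam k := by
    rw [hq]
    simp only [he, hb1]
    calc ∑ i, b k i * (lam k * b k i) = lam k * ∑ i, b k i * b k i := by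
          rw [Finset.mul_sum]
          exact Finset.sum_congr rfl fun i _ => by ring
      _ = lam k := by rw [hb2, mul_one]
  have hBe := hB (fun i => r i * e i)
  rw [hqe] at hBe
  have hsq : ∑ i, v i / p i * (∑ j, A i j * (r j * e j)) ^ 2 = lam k ^ 2 := by
    calc ∑ i, v i / p i * (∑ j, A i j * (r j * e j)) ^ 2
        = ∑ i, (∑ j, r i * A i j * r j * b k j) ^ 2 := by
          refine Finset.sum_congr rfl fun i _ => ?_
          rw [← hr2, ← mul_pow, Finset.mul_sum]
          congr 1
          exact Finset.sum_congr rfl fun j _ => by ring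
      _ = lam k ^ 2 * ∑ i, b k i * b k i := by
          simp only [hb1]
          rw [Finset.mul_sum]
          exact Finset.sum_congr rfl fun i _ => by ring
      _ = lam k ^ 2 := by rw [hb2, mul_one]
  rw [hsq] at hBe
  have hlam1 : 1 ≤ lam k := by nlinarith
  have hid := q_ident A hA v hv (fun i => r i * e i)
  simp only [← hpd] at hid
  rw [hqe] at hid
  have hterm : ∀ i, p i / v i * (r i * e i) ^ 2 ≤ e i * e i ∧
      (p i = 0 → p i / v i * (r i * e i) ^ 2 = 0) := by
    intro i
    refine ⟨?_, fun h => by rw [h]; ring⟩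
    rcases hp i with h | h
    · rw [mul_pow, hr2]
      have := hv i
      apply le_of_eq
      field_simp
    · rw [h.1, zero_div, zero_mul]; exact mul_self_nonneg _
  have hle : ∑ i, p i / v i * (r i * e i) ^ 2 ≤ 1 := by
    rw [← hb2 k]
    exact Finset.sum_le_sum fun i _ => (hterm i).1
  have hQterm : ∀ i j, 0 ≤ A i j * v i * v j * (r i * e i / v i - r j * e j / v j) ^ 2 := by
    intro i j
    by_cases hij : j = i
    · subst hij; simp
    · exact mul_nonneg (mul_nonneg (mul_nonneg (hoff i j hij) (hv i).le) (hv j).le) (sq_nonneg _)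
  have hQ : ∑ i, ∑ j, A i j * v i * v j * (r i * e i / v i - r j * e j / v j) ^ 2 = 0 := by
    apply le_antisymm
    · linarith
    · exact Finset.sum_nonneg fun i _ => Finset.sum_nonneg fun j _ => hQterm i j
  have hQ0 : ∀ i j, A i j * v i * v j * (r i * e i / v i - r j * e j / v j) ^ 2 = 0 := by
    intro i j
    have h1 := (Finset.sum_eq_zero_iff_of_nonneg
      (fun i _ => Finset.sum_nonneg fun j _ => hQterm i j)).mp hQ i (Finset.mem_univ _)
    exact (Finset.sum_eq_zero_iff_of_nonneg (fun j _ => hQterm i j)).mp h1 j (Finset.mem_univ _)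
  have hconst := conn (fun i => r i * e i / v i) (fun i j hij hpos => by
    have h1 := hQ0 i j
    have h2 : A i j * v i * v j ≠ 0 := by
      have := hv i
      have := hv j
      positivity
    have h3 := (mul_eq_zero.mp h1).resolve_left h2
    exact sub_eq_zero.mp (pow_eq_zero_iff (two_ne_zero) |>.mp h3))
  have hzero : ∑ i, y i * e i = 0 := by
    by_cases hex : ∃ i0, 0 < p i0
    · obtain ⟨i0, hi0⟩ := hex
      have : ∀ i, y i * e i = (r i0 * e i0 / v i0) * (x i * p i) := by
        intro i
        rcases hp i with h | h
        · rw [← hconst i i0 h hi0]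
          have h1 := hr0 i h
          have h2 := hr2 i
          have h3 := hv i
          simp only [hy, h, if_true]
          have h4 : r i ^ 2 * p i = v i := by rw [h2]; field_simp
          rw [← h4]
          field_simp
        · simp [hy, h.1]
      simp only [this]
      rw [← Finset.mul_sum, hx, mul_zero]
    · push Not at hex
      apply Finset.sum_eq_zero
      intro i _
      simp [hy, not_lt.mpr (hex i)]
  rw [hzero]
  simp

end Boch

section Plane

lemma bm1 {A B : Set ℝ} (hA : IsCompact A) (hB : IsCompact B) (hA' : A.Nonempty)
    (hB' : B.Nonempty) : volume A + volume B ≤ volume (A + B) := by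
  have ha := hA.sSup_mem hA'
  have hb := hB.sInf_mem hB'
  set a := sSup A
  set b := sInf B
  have h1 : volume A = volume ((fun x => x + b) '' A) := by
    rw [Set.image_add_right, measure_preimage_add_right]
  have h2 : volume B = volume ((fun x => a + x) '' B) := by
    rw [Set.image_add_left, measure_preimage_add]
  rw [h1, h2, ← measure_union₀]
  · apply measure_mono
    rintro _ (⟨x, hx, rfl⟩ | ⟨x, hx, rfl⟩)
    · exact Set.add_mem_add hx hb
    · exact Set.add_mem_add ha hx
  · exact ((hB.image (by fun_prop)).measurableSet).nullMeasurableSet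
  · have : ((fun x => x + b) '' A) ∩ ((fun x => a + x) '' B) ⊆ {a + b} := by
      rintro _ ⟨⟨x, hx, rfl⟩, ⟨y, hy, hxy⟩⟩
      have h3 : x ≤ a := le_csSup hA.bddAbove hx
      have h4 : b ≤ y := csInf_le hB.bddBelow hy
      simp only at hxy
      simp only [Set.mem_singleton_iff]
      linarith
    exact measure_mono_null this (by simp)

lemma bm1' {A B C : Set ℝ} (hA : MeasurableSet A) (hB : MeasurableSet B) (hA' : A.Nonempty)
    (hB' : B.Nonempty) (hC : A + B ⊆ C) : volume A + volume B ≤ volume C := by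
  obtain ⟨a, ha⟩ := hA'
  obtain ⟨b, hb⟩ := hB'
  rw [hA.measure_eq_iSup_isCompact, hB.measure_eq_iSup_isCompact]
  simp only [iSup_and']
  refine ENNReal.biSup_add_biSup_le' ⟨∅, by simp, isCompact_empty⟩ ⟨∅, by simp, isCompact_empty⟩ ?_
  rintro A' ⟨hA1, hA2⟩ B' ⟨hB1, hB2⟩
  refine le_trans ?_ (measure_mono hC)
  refine le_trans (add_le_add (measure_mono (Set.subset_insert a A'))
    (measure_mono (Set.subset_insert b B'))) ?_
  refine le_trans (bm1 (hA2.insert a) (hB2.insert b) ⟨a, by simp⟩ ⟨b, by simp⟩) ?_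
  exact measure_mono (Set.add_subset_add (Set.insert_subset ha hA1) (Set.insert_subset hb hB1))

/-- Vertical slice. -/
def sl (K : Set (Fin 2 → ℝ)) (s : ℝ) : Set ℝ := {y | ![s, y] ∈ K}

/-- Slice length. -/
noncomputable def kk (K : Set (Fin 2 → ℝ)) (s : ℝ) : ℝ := (volume (sl K s)).toReal

lemma sl_compact {K : Set (Fin 2 → ℝ)} (hK : IsCompact K) (s : ℝ) : IsCompact (sl K s) := by
  have : sl K s = (fun x : Fin 2 → ℝ => x 1) '' (K ∩ {x | x 0 = s}) := by
    ext y
    constructor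
    · intro hy
      exact ⟨![s, y], ⟨hy, rfl⟩, rfl⟩
    · rintro ⟨x, ⟨hx, hx0⟩, rfl⟩
      have : ![s, x 1] = x := by
        ext i; fin_cases i
        · exact hx0.symm
        · rfl
      simpa [sl, this] using hx
  rw [this]
  exact (hK.inter_right (isClosed_eq (continuous_apply 0) continuous_const)).image
    (continuous_apply 1)

lemma sl_meas {K : Set (Fin 2 → ℝ)} (hK : MeasurableSet K) :
    volume K = ∫⁻ s, volume (sl K s) ∧ Measurable fun s => volume (sl K s) := by
  have hp := (volume_preserving_finTwoArrow ℝ).symm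
  have hm : MeasurableSet ((MeasurableEquiv.finTwoArrow (α := ℝ)).symm ⁻¹' K) :=
    MeasurableEquiv.finTwoArrow.symm.measurable hK
  constructor
  · rw [← hp.measure_preimage hK.nullMeasurableSet, Measure.volume_eq_prod, Measure.prod_apply hm]
    rfl
  · exact measurable_measure_prodMk_left hm

lemma kk_ofReal {K : Set (Fin 2 → ℝ)} (hK : IsCompact K) (s : ℝ) :
    ENNReal.ofReal (kk K s) = volume (sl K s) :=
  ENNReal.ofReal_toReal (sl_compact hK s).measure_lt_top.ne

lemma kk_meas {K : Set (Fin 2 → ℝ)} (hK : IsCompact K) : Measurable (kk K) :=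
  (sl_meas hK.measurableSet).2.ennreal_toReal

lemma kk_nonneg (K : Set (Fin 2 → ℝ)) (s : ℝ) : 0 ≤ kk K s := ENNReal.toReal_nonneg

lemma cake {K : Set (Fin 2 → ℝ)} (hK : IsCompact K) :
    volume K = ∫⁻ t in Set.Ioi (0:ℝ), volume {s | t < kk K s} := by
  rw [(sl_meas hK.measurableSet).1]
  simp only [← kk_ofReal hK]
  exact lintegral_eq_lintegral_meas_lt _ (Filter.Eventually.of_forall (kk_nonneg K))
    (kk_meas hK).aemeasurable

lemma cake1 {K : Set (Fin 2 → ℝ)} (hK : IsCompact K) (h1 : ∀ s, kk K s ≤ 1) :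
    volume K ≤ ∫⁻ t in Set.Ioo (0:ℝ) 1, volume {s | t < kk K s} := by
  rw [cake hK, ← lintegral_indicator measurableSet_Ioi, ← lintegral_indicator measurableSet_Ioo]
  refine lintegral_mono fun t => ?_
  by_cases ht : t ∈ Set.Ioo (0:ℝ) 1
  · rw [Set.indicator_of_mem ht]
    exact Set.indicator_le_self _ _ _
  · rw [Set.indicator_of_notMem ht]
    by_cases ht0 : t ∈ Set.Ioi (0:ℝ)
    · rw [Set.indicator_of_mem ht0]
      have : {s | t < kk K s} = ∅ := by
        ext s
        simp only [Set.mem_setOf_eq, Set.mem_empty_iff_false, iff_false, not_lt]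
        exact (h1 s).trans (not_lt.mp fun h => ht ⟨ht0, h⟩)
      rw [this, measure_empty]
    · rw [Set.indicator_of_notMem ht0]

lemma plane_norm {K L : Set (Fin 2 → ℝ)} (hK : IsCompact K) (hL : IsCompact L)
    (hK1 : ∀ s, kk K s ≤ 1) (hL1 : ∀ s, kk L s ≤ 1)
    (hK2 : ∀ t < 1, ∃ s, t < kk K s) (hL2 : ∀ t < 1, ∃ s, t < kk L s) :
    2 * (volume K + volume L) ≤ volume (K + L) := by
  have hKL := hK.add hL
  have hhalf : volume (K + L) =
      2 * ∫⁻ t in Set.Ioi (0:ℝ), volume {s | t < kk (K + L) s / 2} := by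
    rw [← lintegral_eq_lintegral_meas_lt _
      (Filter.Eventually.of_forall fun s => div_nonneg (kk_nonneg _ s) zero_le_two)
      ((kk_meas hKL).div_const 2).aemeasurable, ← lintegral_const_mul _ (by
        exact ((kk_meas hKL).div_const 2).ennreal_ofReal), (sl_meas hKL.measurableSet).1]
    refine lintegral_congr fun s => ?_
    rw [← kk_ofReal hKL, ← ENNReal.ofReal_ofNat 2, ← ENNReal.ofReal_mul zero_le_two]
    congr 1
    ring
  rw [hhalf]
  gcongr
  refine le_trans (add_le_add (cake1 hK hK1) (cake1 hL hL1)) ?_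
  rw [← lintegral_add_left' (by
    apply Measurable.aemeasurable
    apply Antitone.measurable
    intro t t' htt
    exact measure_mono fun s hs => lt_of_le_of_lt htt hs)]
  refine le_trans ?_ (lintegral_mono_set (s := Set.Ioo (0:ℝ) 1) fun x hx => hx.1)
  apply setLIntegral_mono_ae' measurableSet_Ioo
  refine Filter.Eventually.of_forall fun t ht => ?_
  apply bm1' (measurableSet_lt measurable_const (kk_meas hK))
    (measurableSet_lt measurable_const (kk_meas hL)) (hK2 t ht.2) (hL2 t ht.2)
  rintro _ ⟨a, ha, b, hb, rfl⟩
  simp only [Set.mem_setOf_eq] at ha hb ⊢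
  have hne : ∀ {K : Set (Fin 2 → ℝ)} {s : ℝ}, t < kk K s → (sl K s).Nonempty := by
    intro K s h
    by_contra hcon
    rw [Set.not_nonempty_iff_eq_empty] at hcon
    rw [kk, hcon, measure_empty, ENNReal.toReal_zero] at h
    linarith [ht.1]
  have h1 := bm1 (sl_compact hK a) (sl_compact hL b) (hne ha) (hne hb)
  have h2 : sl K a + sl L b ⊆ sl (K + L) (a + b) := by
    rintro _ ⟨x, hx, y, hy, rfl⟩
    have : ![a + b, x + y] = ![a, x] + ![b, y] := by simp
    change ![a + b, x + y] ∈ K + L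
    rw [this]
    exact Set.add_mem_add hx hy
  have h3 := h1.trans (measure_mono h2)
  rw [← kk_ofReal hK, ← kk_ofReal hL, ← kk_ofReal hKL,
    ← ENNReal.ofReal_add (kk_nonneg _ _) (kk_nonneg _ _),
    ENNReal.ofReal_le_ofReal_iff (kk_nonneg _ _)] at h3
  linarith

lemma plane_scale {K : Set (Fin 2 → ℝ)} (hK : IsCompact K) (hpos : 0 < vol K) :
    ∃ α : ℝ, 0 < α ∧ (∀ s, kk (α • K) s ≤ 1) ∧ (∀ t < 1, ∃ s, t < kk (α • K) s) := by
  have hbdd : BddAbove (Set.range (kk K)) := by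
    refine ⟨(volume ((fun x : Fin 2 → ℝ => x 1) '' K)).toReal, ?_⟩
    rintro _ ⟨s, rfl⟩
    apply ENNReal.toReal_mono (hK.image (continuous_apply 1)).measure_lt_top.ne
    apply measure_mono
    intro y hy
    exact ⟨![s, y], hy, rfl⟩
  have hex : ∃ s, 0 < kk K s := by
    by_contra hcon
    push Not at hcon
    have h0 : volume K = 0 := by
      rw [(sl_meas hK.measurableSet).1]
      simp only [← kk_ofReal hK]
      simp [ENNReal.ofReal_eq_zero.mpr (hcon _)]
    rw [vol, h0] at hpos
    simp at hpos
  obtain ⟨s0, hs0⟩ := hex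
  set M := ⨆ s, kk K s with hM
  have hMpos : 0 < M := hs0.trans_le (le_ciSup hbdd s0)
  have hsl : ∀ s, kk (M⁻¹ • K) s = M⁻¹ * kk K (M * s) := by
    intro s
    have : sl (M⁻¹ • K) s = M⁻¹ • sl K (M * s) := by
      ext y
      rw [Set.mem_smul_set_iff_inv_smul_mem₀ (inv_pos.mpr hMpos).ne', inv_inv]
      change ![s, y] ∈ M⁻¹ • K ↔ ![M * s, M • y] ∈ K
      rw [Set.mem_smul_set_iff_inv_smul_mem₀ (inv_pos.mpr hMpos).ne', inv_inv]
      simp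
    rw [kk, this, Measure.addHaar_smul, ENNReal.toReal_mul,
      ENNReal.toReal_ofReal (abs_nonneg _), kk]
    simp [abs_of_pos hMpos]
  refine ⟨M⁻¹, inv_pos.mpr hMpos, fun s => ?_, fun t ht => ?_⟩
  · rw [hsl, inv_mul_le_iff₀ hMpos, mul_one]
    exact le_ciSup hbdd _
  · obtain ⟨s, hs⟩ := exists_lt_of_lt_ciSup (show t * M < ⨆ s, kk K s by
      rw [← hM]; nlinarith)
    refine ⟨M⁻¹ * s, ?_⟩
    rw [hsl, mul_inv_cancel_left₀ hMpos.ne', lt_inv_mul_iff₀ hMpos]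
    linarith

lemma plane {K L : Set (Fin 2 → ℝ)} (hK : IsCompact K) (hL : IsCompact L)
    (hK' : 0 < vol K) (hL' : 0 < vol L) :
    ∃ α β : ℝ, 0 < α ∧ 0 < β ∧ 2 * (α ^ 2 * vol K + β ^ 2 * vol L) ≤ vol (α • K + β • L) := by
  obtain ⟨α, hα, h1, h2⟩ := plane_scale hK hK'
  obtain ⟨β, hβ, h3, h4⟩ := plane_scale hL hL'
  refine ⟨α, β, hα, hβ, ?_⟩
  have h5 := plane_norm (hK.smul α) (hL.smul β) h1 h3 h2 h4
  have h6 := ENNReal.toReal_mono ((hK.smul α).add (hL.smul β)).measure_lt_top.ne h5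
  rw [ENNReal.toReal_mul, ENNReal.toReal_add (hK.smul α).measure_lt_top.ne
    (hL.smul β).measure_lt_top.ne, Measure.addHaar_smul, Measure.addHaar_smul,
    ENNReal.toReal_mul, ENNReal.toReal_mul, ENNReal.toReal_ofReal (abs_nonneg _),
    ENNReal.toReal_ofReal (abs_nonneg _), abs_of_nonneg (by positivity),
    abs_of_nonneg (by positivity)] at h6
  simpa [vol] using h6

open MvPolynomial PDat
variable {n : ℕ} {ι : Type} [Fintype ι] [DecidableEq ι]

lemma T_swap (f : MvPolynomial ι ℝ) (x y : ι → ℝ) (l : List (ι → ℝ)) :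
    T f (x :: y :: l) = T f (y :: x :: l) := T_perm f (List.Perm.swap y x l)

/-- Reduction of the quadratic inequality to chamber vectors. -/
lemma reduce_Ch {D : PDat n ι} (f : MvPolynomial ι ℝ) (l : List (ι → ℝ)) {v : ι → ℝ}
    (hv : v ∈ D.Ch)
    (H : ∀ x ∈ D.Ch, T f (x :: x :: l) * T f (v :: v :: l) ≤ T f (x :: v :: l) ^ 2)
    (x : ι → ℝ) : T f (x :: x :: l) * T f (v :: v :: l) ≤ T f (x :: v :: l) ^ 2 := by
  have hcont : Continuous fun t : ℝ => v + t • x := by fun_prop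
  have hev : ∀ᶠ t in nhds (0:ℝ), v + t • x ∈ D.Ch :=
    hcont.continuousAt.eventually (Ch_isOpen.mem_nhds (by simpa using hv))
  obtain ⟨δ, hδ, hb⟩ := Metric.eventually_nhds_iff.mp hev
  have hin := hb (y := δ / 2) (by rw [Real.dist_eq, sub_zero, abs_of_pos (half_pos hδ)]; linarith)
  have h1 := H _ hin
  set e := δ / 2 with he
  have he0 : 0 < e := half_pos hδ
  have h2 : ∀ y, T f ((v + e • x) :: y :: l) = T f (v :: y :: l) + e * T f (x :: y :: l) := by
    intro y; rw [T_cons_add, T_cons_smul]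
  rw [h2, h2, T_swap f v (v + e • x), T_swap f x (v + e • x), h2, h2, T_swap f v x] at h1
  have h3 : 0 < e ^ 2 := by positivity
  refine le_of_mul_le_mul_left ?_ h3
  nlinarith

lemma eval_two {f : MvPolynomial ι ℝ} (hf : f.IsHomogeneous 2) (h : ι → ℝ) :
    eval h f = 1 / 2 * T f [h, h] := by
  have h1 := polarization f hf (fun _ => h)
  have hu : (Finset.univ : Finset (Finset (Fin 2))) = {∅, {0}, {1}, {0, 1}} := by decide
  have h0 : eval 0 f = 0 := by
    have := hf.coeff_eq_zero (d := 0) (by simp)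
    rw [eval_zero, constantCoeff_eq, this]
  have hd : eval (h + h) f = 4 * eval h f := by
    rw [eval_eq, eval_eq, Finset.mul_sum]
    refine Finset.sum_congr rfl fun d hd => ?_
    have hdeg : ∑ i ∈ d.support, d i = 2 := by
      have := hf (mem_support_iff.mp hd)
      simpa [Finsupp.weight_apply, Finsupp.sum] using this
    have : ∏ i ∈ d.support, (h + h) i ^ d i = 4 * ∏ i ∈ d.support, h i ^ d i := by
      have : ∀ i, (h + h) i = 2 * h i := fun i => by simp; ring
      simp only [this, mul_pow]
      rw [Finset.prod_mul_distrib, Finset.prod_pow_eq_pow_sum, hdeg]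
      norm_num
    rw [this]; ring
  rw [hu] at h1
  rw [Finset.sum_insert (by decide), Finset.sum_insert (by decide), Finset.sum_insert (by decide),
    Finset.sum_singleton] at h1
  have hd' : ∑ i ∈ ({0, 1} : Finset (Fin 2)), h = h + h := by
    rw [Finset.sum_insert (by decide), Finset.sum_singleton]
  simp only [Finset.sum_empty, Finset.sum_singleton, h0] at h1
  rw [hd', hd] at h1
  simp at h1
  linarith

lemma AF_two {D : PDat 2 ι} {f : MvPolynomial ι ℝ} (hf : IsVol D f) {v : ι → ℝ}
    (hv : v ∈ D.Ch) (x : ι → ℝ) : T f [x, x] * T f [v, v] ≤ T f [x, v] ^ 2 := by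
  refine reduce_Ch f [] hv (fun x hx => ?_) x
  obtain ⟨α, β, hα, hβ, h⟩ := plane (P_compact hx) (P_compact hv) (volume_pos hx) (volume_pos hv)
  rw [← P_smul x hα, ← P_smul v hβ, ← P_add (Ch_smul hx hα) (Ch_smul hv hβ),
    hf.2 _ (Ch_add (Ch_smul hx hα) (Ch_smul hv hβ)), hf.2 _ hx, hf.2 _ hv,
    eval_two hf.1, eval_two hf.1, eval_two hf.1] at h
  have e1 : ∀ y, T f [α • x + β • v, y] = α * T f [x, y] + β * T f [v, y] := by
    intro y; rw [T_cons_add, T_cons_smul, T_cons_smul]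
  rw [e1, T_swap f x (α • x + β • v), T_swap f v (α • x + β • v), e1, e1, T_swap f v x] at h
  have ha : 0 < T f [x, x] := T_pos _ _ D f ⟨x, hx⟩ hf _ rfl (by simp [hx])
  have hb : 0 < T f [v, v] := T_pos _ _ D f ⟨x, hx⟩ hf _ rfl (by simp [hv])
  generalize T f [x, x] = a at *
  generalize T f [v, v] = b at *
  generalize T f [x, v] = m at *
  have hk : α ^ 2 * a + β ^ 2 * b ≤ 2 * (α * β * m) := by nlinarith
  have hk2 : (α ^ 2 * a + β ^ 2 * b) ^ 2 ≤ (2 * (α * β * m)) ^ 2 :=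
    pow_le_pow_left₀ (by positivity) hk 2
  have hab : 0 < (α * β) ^ 2 := by positivity
  refine le_of_mul_le_mul_left ?_ hab
  nlinarith [sq_nonneg (α ^ 2 * a - β ^ 2 * b)]

end Plane

section AF
open MvPolynomial PDat

lemma T_expand {ι : Type} [Fintype ι] [DecidableEq ι] (f : MvPolynomial ι ℝ) (v : ι → ℝ)
    (l : List (ι → ℝ)) : T f (v :: l) = ∑ i, v i * T f (Pi.single i 1 :: l) := by
  rw [T_cons_sum]
  refine Finset.sum_congr rfl fun i _ => ?_
  rw [T_cons, dir_single]

lemma AF : ∀ (n : ℕ) (ι : Type) [Fintype ι] [DecidableEq ι] (D : PDat (n + 2) ι)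
    (f : MvPolynomial ι ℝ), IsVol D f → ∀ v ∈ D.Ch, ∀ l : List (ι → ℝ), l.length = n →
    (∀ h ∈ l, h ∈ D.Ch) → ∀ x : ι → ℝ,
    T f (x :: x :: l) * T f (v :: v :: l) ≤ T f (x :: v :: l) ^ 2 := by
  intro n
  induction n with
  | zero =>
    intro ι _ _ D f hf v hv l hl _ x
    rw [List.length_eq_zero_iff] at hl
    subst hl
    exact AF_two hf hv x
  | succ n ih =>
    intro ι _ _ D f hf v hv l hl hlC
    have hC : D.Ch.Nonempty := ⟨v, hv⟩
    obtain ⟨w0, l, rfl⟩ := List.exists_cons_of_length_eq_add_one hl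
    have hl' : l.length = n := by simpa using hl
    have hlC' : ∀ h ∈ l, h ∈ D.Ch := fun h hh => hlC h (List.mem_cons_of_mem _ hh)
    have hw0 : w0 ∈ D.Ch := hlC w0 List.mem_cons_self
    obtain ⟨z, hz⟩ := exists_interior hw0
    set w : ι → ℝ := w0 - fun j => D.a j z with hw
    have hwpos : ∀ i, 0 < w i := fun i => sub_pos.mpr (hz i)
    set A : ι → ι → ℝ := fun i j => T f (Pi.single i 1 :: Pi.single j 1 :: w0 :: l) with hA
    set p : ι → ℝ := fun i => T f (Pi.single i 1 :: w0 :: w0 :: l) with hp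
    have hrow : ∀ (i : ι) (x : ι → ℝ),
        T f (Pi.single i 1 :: x :: w0 :: l) = ∑ j, A i j * x j := by
      intro i x
      rw [T_swap, T_expand]
      refine Finset.sum_congr rfl fun j _ => ?_
      rw [T_swap, mul_comm]
    have hquad : ∀ x y : ι → ℝ, T f (x :: y :: w0 :: l) = ∑ i, ∑ j, A i j * x i * y j := by
      intro x y
      rw [T_expand]
      refine Finset.sum_congr rfl fun i _ => ?_
      rw [hrow, Finset.mul_sum]
      exact Finset.sum_congr rfl fun j _ => by ring
    have hppos : ∀ i, D.Ess i → 0 < p i := fun i hi => T_e_pos hC hf hi (by simp [hl']) (by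
      intro h hh
      simp only [List.mem_cons] at hh
      rcases hh with rfl | rfl | hh
      · exact hw0
      · exact hw0
      · exact hlC' h hh)
    have hp0 : ∀ i, ¬ D.Ess i → p i = 0 := fun i hi => T_e_iness hC hf hi _
    have hneg := bochner A (fun i j => T_swap _ _ _ _)
      (fun i j hij => T_ee_nonneg hC hf hij (by simp [hl']) hlC) w hwpos p
      (fun i => by
        rw [← hrow, hp]
        simp only
        rw [T_swap f _ w, hw, T_sub_lin hC hf, T_swap])
      (fun i => by
        by_cases hi : D.Ess i
        · exact Or.inl (hppos i hi)
        · exact Or.inr ⟨hp0 i hi, fun j => T_e_iness hC hf hi _⟩)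
      (fun g hg i j hi hj => by
        refine connected hC g (fun I hI i hi j hj => ?_) (by_contra fun h => ?_)
          (by_contra fun h => ?_)
        · by_cases hij : j = i
          · rw [hij]
          · exact hg i j hij (T_ee_pos hC hf hij hI hi hj (by simp [hl']) hlC)
        · exact hi.ne' (hp0 i h)
        · exact hj.ne' (hp0 j h))
      (fun x => by
        rw [← hquad]
        have h1 : T f (x :: x :: w0 :: l) = ∑ i, w i * T f (Pi.single i 1 :: x :: x :: l) := by
          rw [← T_expand, hw, T_sub_lin hC hf]
          apply T_perm
          exact (List.Perm.cons x (List.Perm.swap w0 x l)).trans (List.Perm.swap w0 x (x :: l))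
        rw [h1]
        refine Finset.sum_le_sum fun i _ => ?_
        rw [← hrow]
        by_cases hi : D.Ess i
        · have hpi := hppos i hi
          obtain ⟨F, π, c, g, hc, hg, hπ, hs, hE, hd⟩ := facet_alg hC hf hi
          have h2 := ih _ F g hg (π w0) (hπ _ hw0) (l.map π) (by simpa using hl') (by
            intro h hh
            obtain ⟨h', hh', rfl⟩ := List.mem_map.mp hh
            exact hπ _ (hlC' _ hh')) (π x)
          have h3 : T f (Pi.single i 1 :: x :: x :: l) * p i ≤
              T f (Pi.single i 1 :: x :: w0 :: l) ^ 2 := by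
            rw [hp]
            simp only
            rw [facet_T (D := D) hd, facet_T (D := D) hd, facet_T (D := D) hd]
            simp only [List.map_cons]
            nlinarith [mul_pos hc hc]
          rw [div_mul_eq_mul_div, le_div_iff₀ hpi, mul_assoc]
          exact mul_le_mul_of_nonneg_left h3 (hwpos i).le
        · rw [T_e_iness hC hf hi, T_e_iness hC hf hi]
          simp)
    have hneg' : ∀ x : ι → ℝ, T f (x :: w0 :: w0 :: l) = 0 → T f (x :: x :: w0 :: l) ≤ 0 := by
      intro x hx
      rw [hquad]
      apply hneg
      rw [← hx, T_expand]
    intro x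
    have hs : 0 < T f (v :: w0 :: w0 :: l) := T_pos _ _ D f hC hf _ (by simp [hl']) (by
      intro h hh
      simp only [List.mem_cons] at hh
      rcases hh with rfl | rfl | rfl | hh
      · exact hv
      · exact hw0
      · exact hw0
      · exact hlC' h hh)
    have hb : 0 < T f (v :: v :: w0 :: l) := T_pos _ _ D f hC hf _ (by simp [hl']) (by
      intro h hh
      simp only [List.mem_cons] at hh
      rcases hh with rfl | rfl | rfl | hh
      · exact hv
      · exact hv
      · exact hw0
      · exact hlC' h hh)
    set s := T f (v :: w0 :: w0 :: l) with hsd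
    set r := T f (x :: w0 :: w0 :: l) with hrd
    have hlin : ∀ y m, T f ((s • x + (-r) • v) :: y :: m) =
        s * T f (x :: y :: m) - r * T f (v :: y :: m) := by
      intro y m
      rw [T_cons_add, T_cons_smul, T_cons_smul]; ring
    have hz := hneg' (s • x + (-r) • v) (by rw [hlin]; ring)
    rw [hlin, T_swap f x (s • x + (-r) • v), T_swap f v (s • x + (-r) • v), hlin, hlin,
      T_swap f v x] at hz
    have hs2 : 0 < s ^ 2 := by positivity
    refine le_of_mul_le_mul_left ?_ hs2
    generalize T f (x :: x :: w0 :: l) = a at *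
    generalize T f (x :: v :: w0 :: l) = m at *
    generalize T f (v :: v :: w0 :: l) = b at *
    nlinarith [sq_nonneg (s * m - r * b), mul_le_mul_of_nonneg_right hz hb.le]

end AF

section Conseq
open MvPolynomial PDat

lemma logconc (a : ℕ → ℝ) (p : ℕ) (hpos : ∀ k ≤ p, 0 < a k)
    (hlc : ∀ k, k + 2 ≤ p → a k * a (k + 2) ≤ a (k + 1) ^ 2) :
    ∀ k, k + 1 ≤ p → a 0 ^ k * a (k + 1) ≤ a 1 ^ (k + 1) := by
  have h1 : ∀ k, k + 1 ≤ p → a (k + 1) * a 0 ≤ a k * a 1 := by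
    intro k
    induction k with
    | zero => intro _; rw [mul_comm]
    | succ k ih =>
      intro hk
      have h2 := ih (by omega)
      have h3 := hlc k hk
      have hk0 := hpos k (by omega)
      have hk1 := hpos (k + 1) (by omega)
      have h0 := hpos 0 (by omega)
      refine le_of_mul_le_mul_left ?_ hk0
      calc a k * (a (k + 1 + 1) * a 0) = (a k * a (k + 2)) * a 0 := by ring
        _ ≤ a (k + 1) ^ 2 * a 0 := mul_le_mul_of_nonneg_right h3 h0.le
        _ = a (k + 1) * (a (k + 1) * a 0) := by ring
        _ ≤ a (k + 1) * (a k * a 1) := mul_le_mul_of_nonneg_left h2 hk1.le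
        _ = _ := by ring
  intro k
  induction k with
  | zero => intro _; simp
  | succ k ih =>
    intro hk
    have h0 := hpos 0 (by omega)
    have h11 := hpos 1 (by omega)
    calc a 0 ^ (k + 1) * a (k + 1 + 1) = a 0 ^ k * (a (k + 1 + 1) * a 0) := by ring
      _ ≤ a 0 ^ k * (a (k + 1) * a 1) :=
          mul_le_mul_of_nonneg_left (h1 (k + 1) hk) (pow_nonneg h0.le _)
      _ = (a 0 ^ k * a (k + 1)) * a 1 := by ring
      _ ≤ a 1 ^ (k + 1) * a 1 := mul_le_mul_of_nonneg_right (ih (by omega)) h11.le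
      _ = _ := by ring

lemma prod_ineq {p : ℕ} (hp : 1 ≤ p) (m : Fin p → Fin p → ℝ) (h0 : ∀ i s, 0 ≤ m i s)
    (hm : ∀ i s, m i i ^ (p - 1) * m s s ≤ m i s ^ p) :
    ∏ s, m s s ^ (p - 1) ≤ ∏ s, ∏ i ∈ Finset.univ.erase s, m i s := by
  rw [← pow_le_pow_iff_left₀ (Finset.prod_nonneg fun s _ => pow_nonneg (h0 s s) _)
    (Finset.prod_nonneg fun s _ => Finset.prod_nonneg fun i _ => h0 i s) (show p ≠ 0 by omega)]
  have h1 : ∏ s, ∏ i ∈ Finset.univ.erase s, (m i i ^ (p - 1) * m s s) ≤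
      ∏ s, ∏ i ∈ Finset.univ.erase s, m i s ^ p :=
    Finset.prod_le_prod
      (fun s _ => Finset.prod_nonneg fun i _ => mul_nonneg (pow_nonneg (h0 i i) _) (h0 s s))
      (fun s _ => Finset.prod_le_prod (fun i _ => mul_nonneg (pow_nonneg (h0 i i) _) (h0 s s))
        (fun i _ => hm i s))
  have h2 : ∏ s, ∏ i ∈ Finset.univ.erase s, m i s ^ p =
      (∏ s, ∏ i ∈ Finset.univ.erase s, m i s) ^ p := by
    simp only [Finset.prod_pow]
  have h4 : ∏ s : Fin p, ∏ i ∈ Finset.univ.erase s, m i i ^ (p - 1) =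
      ∏ i, (m i i ^ (p - 1)) ^ (p - 1) := by
    have : ∏ s : Fin p, ∏ i ∈ Finset.univ.erase s, m i i ^ (p - 1) =
        ∏ i, ∏ s ∈ Finset.univ.erase i, m i i ^ (p - 1) := by
      apply Finset.prod_comm'
      intro s i
      simp [eq_comm]
    rw [this]
    refine Finset.prod_congr rfl fun i _ => ?_
    rw [Finset.prod_const, Finset.card_erase_of_mem (Finset.mem_univ _), Finset.card_univ,
      Fintype.card_fin]
  have h3 : ∏ s, ∏ i ∈ Finset.univ.erase s, (m i i ^ (p - 1) * m s s) =
      (∏ s, m s s ^ (p - 1)) ^ p := by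
    simp only [Finset.prod_mul_distrib]
    rw [h4]
    simp only [Finset.prod_const, Finset.card_erase_of_mem (Finset.mem_univ _), Finset.card_univ,
      Fintype.card_fin]
    rw [← Finset.prod_mul_distrib, ← Finset.prod_pow]
    refine Finset.prod_congr rfl fun i _ => ?_
    rw [← pow_succ]
    congr 1
    omega
  rw [← h2, ← h3]
  exact h1

lemma T_conseq {n : ℕ} {ι : Type} [Fintype ι] [DecidableEq ι] {D : PDat (n + 2) ι}
    {f : MvPolynomial ι ℝ} (hf : IsVol D f) {x y : ι → ℝ} (hx : x ∈ D.Ch) (hy : y ∈ D.Ch)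
    {l : List (ι → ℝ)} (hl : ∀ h ∈ l, h ∈ D.Ch) {q : ℕ} (hlen : l.length + (q + 1) = n + 2) :
    T f (List.replicate q x ++ x :: l) ^ q * T f (List.replicate q y ++ y :: l) ≤
      T f (List.replicate q x ++ y :: l) ^ (q + 1) := by
  set a : ℕ → ℝ := fun k => T f (List.replicate (q + 1 - k) x ++ (List.replicate k y ++ l)) with ha
  have hmem : ∀ (i j : ℕ), ∀ h ∈ List.replicate i x ++ (List.replicate j y ++ l), h ∈ D.Ch := by
    intro i j h hh
    simp only [List.mem_append, List.mem_replicate] at hh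
    rcases hh with ⟨-, rfl⟩ | ⟨-, rfl⟩ | hh
    · exact hx
    · exact hy
    · exact hl h hh
  have hsucc : ∀ (k : ℕ) (z : ι → ℝ), T f (List.replicate k z ++ z :: l) =
      T f (List.replicate (k + 1) z ++ l) := by
    intro k z
    apply T_perm
    rw [List.replicate_succ]
    exact List.perm_middle
  have key := logconc a (q + 1)
    (fun k hk => T_pos _ _ D f ⟨x, hx⟩ hf _ (by simp; omega) (hmem _ _))
    (fun k hk => by
      obtain ⟨d, hd⟩ : ∃ d, q + 1 = k + 2 + d := ⟨q + 1 - (k + 2), by omega⟩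
      have e0 : q + 1 - k = d + 2 := by omega
      have e1 : q + 1 - (k + 1) = d + 1 := by omega
      have e2 : q + 1 - (k + 2) = d := by omega
      have h1 := AF n ι D f hf y hy (List.replicate d x ++ (List.replicate k y ++ l))
        (by simp; omega) (hmem _ _) x
      simp only [ha, e0, e1, e2]
      have t1 : T f (List.replicate (d + 2) x ++ (List.replicate k y ++ l)) =
        T f (x :: x :: (List.replicate d x ++ (List.replicate k y ++ l))) := rfl
      have t2 : T f (List.replicate (d + 1) x ++ (List.replicate (k + 1) y ++ l)) =
        T f (x :: y :: (List.replicate d x ++ (List.replicate k y ++ l))) := by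
        apply T_perm
        exact List.Perm.cons x List.perm_middle
      have t3 : T f (List.replicate d x ++ (List.replicate (k + 2) y ++ l)) =
        T f (y :: y :: (List.replicate d x ++ (List.replicate k y ++ l))) := by
        apply T_perm
        exact List.perm_middle.trans (List.Perm.cons y List.perm_middle)
      rw [t1, t2, t3]
      exact h1) q le_rfl
  have a0 : a 0 = T f (List.replicate q x ++ x :: l) := by rw [hsucc]; rfl
  have a1 : a 1 = T f (List.replicate q x ++ y :: l) := rfl
  have aq : a (q + 1) = T f (List.replicate q y ++ y :: l) := by
    rw [hsucc]
    simp [ha]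
  rw [a0, a1, aq] at key
  exact key

end Conseq


section approxCore

variable {n : ℕ} {ι : Type} [Fintype ι] [DecidableEq ι]

/-- spanning sets of functionals -/
def Spg (a : ι → (Fin n → ℝ) →ₗ[ℝ] ℝ) (I : Finset ι) : Prop :=
  ∀ y, (∀ i ∈ I, a i y = 0) → y = 0

/-- basis -/
def Bas (a : ι → (Fin n → ℝ) →ₗ[ℝ] ℝ) (I : Finset ι) : Prop :=
  Spg a I ∧ ∃ X : (ι → ℝ) →ₗ[ℝ] (Fin n → ℝ), (∀ h, ∀ i ∈ I, a i (X h) = h i) ∧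
    ∀ j, j ∉ I → X (Pi.single j 1) = 0

lemma exists_bas {a : ι → (Fin n → ℝ) →ₗ[ℝ] ℝ} : ∀ J : Finset ι, Spg a J → ∃ I, I ⊆ J ∧ Bas a I := by
  intro J
  induction J using Finset.strongInduction with
  | H J ih =>
    intro hJ
    by_cases hmin : ∃ k ∈ J, Spg a (J.erase k)
    · obtain ⟨k, hk, hs⟩ := hmin
      obtain ⟨I, hI, hb⟩ := ih _ (Finset.erase_ssubset hk) hs
      exact ⟨I, hI.trans (Finset.erase_subset _ _), hb⟩
    · refine ⟨J, subset_rfl, hJ, ?_⟩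
      have hu : ∀ k, ∃ u : Fin n → ℝ, k ∈ J → (∀ i ∈ J, a i u = if i = k then 1 else 0) := by
        intro k
        by_cases hk : k ∈ J
        · have : ¬ Spg a (J.erase k) := fun h => hmin ⟨k, hk, h⟩
          unfold Spg at this
          push Not at this
          obtain ⟨y, hy, hy0⟩ := this
          have hne : a k y ≠ 0 := by
            intro h0
            apply hy0
            apply hJ
            intro i hi
            by_cases hik : i = k
            · rw [hik, h0]
            · exact hy i (Finset.mem_erase.mpr ⟨hik, hi⟩)
          refine ⟨(a k y)⁻¹ • y, fun _ i hi => ?_⟩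
          rw [map_smul, smul_eq_mul]
          split_ifs with hik
          · rw [hik, inv_mul_cancel₀ hne]
          · rw [hy i (Finset.mem_erase.mpr ⟨hik, hi⟩), mul_zero]
        · exact ⟨0, fun h => absurd h hk⟩
      choose u hu using hu
      refine ⟨∑ k ∈ J, (LinearMap.proj k : (ι → ℝ) →ₗ[ℝ] ℝ).smulRight (u k), ?_, ?_⟩
      · intro h i hi
        simp only [LinearMap.sum_apply, LinearMap.smulRight_apply, LinearMap.proj_apply, map_sum,
          map_smul, smul_eq_mul]
        rw [Finset.sum_eq_single i]
        · rw [hu i hi i hi]; simp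
        · intro k hk hki
          rw [hu k hk i hi, if_neg (Ne.symm hki), mul_zero]
        · intro h; exact absurd hi h
      · intro j hj
        simp only [LinearMap.sum_apply, LinearMap.smulRight_apply, LinearMap.proj_apply]
        apply Finset.sum_eq_zero
        intro k hk
        have : k ≠ j := fun h => hj (h ▸ hk)
        simp [Pi.single_apply, this]

lemma exists_small {a : ι → (Fin n → ℝ) →ₗ[ℝ] ℝ} {h : ι → ℝ} {x z : Fin n → ℝ}
    (hx : ∀ i, a i x ≤ h i) (hz : ∀ i, a i x = h i → a i z ≤ 0) :
    ∃ t : ℝ, 0 < t ∧ ∀ i, a i (x + t • z) ≤ h i := by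
  have : ∀ i, ∀ᶠ t : ℝ in nhdsWithin 0 (Set.Ioi 0), a i (x + t • z) ≤ h i := by
    intro i
    by_cases hi : a i x = h i
    · filter_upwards [self_mem_nhdsWithin] with t ht
      rw [map_add, map_smul, hi, smul_eq_mul]
      have := mul_nonpos_of_nonneg_of_nonpos (le_of_lt ht) (hz i hi)
      linarith
    · have hlt := lt_of_le_of_ne (hx i) hi
      have hc : ContinuousAt (fun t : ℝ => a i (x + t • z)) 0 := by
        simp only [map_add, map_smul, smul_eq_mul]
        fun_prop
      have := hc.eventually_lt (continuousAt_const (y := h i)) (by simpa using hlt)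
      exact (this.filter_mono nhdsWithin_le_nhds).mono fun t ht => ht.le
  have h2 := (Filter.eventually_all.mpr this).and (self_mem_nhdsWithin (a := (0:ℝ)) (s := Set.Ioi 0))
  obtain ⟨t, ht, ht0⟩ := h2.exists
  exact ⟨t, ht0, ht⟩

lemma dense_ne {φ : (ι → ℝ) →ₗ[ℝ] ℝ} {v : ι → ℝ} (hv : φ v ≠ 0) : Dense {h | φ h ≠ 0} := by
  intro h
  by_cases hh : φ h = 0
  · have hc : Filter.Tendsto (fun t : ℝ => h + t • v) (nhdsWithin 0 (Set.Ioi 0)) (nhds h) := by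
      have : ContinuousAt (fun t : ℝ => h + t • v) 0 := by fun_prop
      have h2 := this.tendsto
      simp only [zero_smul, add_zero] at h2
      exact h2.mono_left nhdsWithin_le_nhds
    refine mem_closure_of_tendsto hc ?_
    filter_upwards [self_mem_nhdsWithin] with t ht
    simp only [Set.mem_setOf_eq, map_add, map_smul, hh, zero_add, smul_eq_mul]
    exact mul_ne_zero (ne_of_gt ht) hv
  · exact subset_closure hh

open Classical in
lemma exists_PDat (a : ι → (Fin n → ℝ) →ₗ[ℝ] ℝ)
    (hbd : ∀ h : ι → ℝ, Bornology.IsBounded {y : Fin n → ℝ | ∀ i, a i y ≤ h i})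
    (H : ι → ℝ) (y0 : Fin n → ℝ) (hy0 : ∀ i, a i y0 ≤ H i) :
    ∃ D : PDat n ι, D.a = a ∧ D.Ch.Nonempty ∧ ∀ I ∈ D.B, ∀ j, a j (D.X I H) ≤ H j := by
  have hXex : ∀ I : Finset ι, ∃ X : (ι → ℝ) →ₗ[ℝ] (Fin n → ℝ), Bas a I →
      (∀ h, ∀ i ∈ I, a i (X h) = h i) ∧ ∀ j, j ∉ I → X (Pi.single j 1) = 0 := by
    intro I
    by_cases hI : Bas a I
    · obtain ⟨X, hX⟩ := hI.2
      exact ⟨X, fun _ => hX⟩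
    · exact ⟨0, fun h => absurd h hI⟩
  choose X hX using hXex
  let φ : Finset ι → ι → (ι → ℝ) →ₗ[ℝ] ℝ := fun I j => LinearMap.proj j - (a j).comp (X I)
  have hφ : ∀ I j h, φ I j h = h j - a j (X I h) := fun I j h => rfl
  -- choice of a generic parameter
  obtain ⟨h0, hh1, hh2, hh3⟩ : ∃ h0 : ι → ℝ, (∀ i, H i < h0 i) ∧
      (∀ I j, φ I j H < 0 → φ I j h0 < 0) ∧ (∀ I, Bas a I → ∀ j, j ∉ I → φ I j h0 ≠ 0) := by
    have hcont : ∀ I j, Continuous (φ I j) := fun I j =>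
      (φ I j).continuous_of_finiteDimensional
    have hd : Dense (⋂ q : {q : Finset ι × ι // Bas a q.1 ∧ q.2 ∉ q.1},
        {h : ι → ℝ | φ q.1.1 q.1.2 h ≠ 0}) := by
      apply dense_iInter_of_isOpen
      · rintro ⟨⟨I, j⟩, h1, h2⟩
        exact isOpen_ne_fun (hcont I j) continuous_const
      · rintro ⟨⟨I, j⟩, h1, h2⟩
        apply dense_ne (v := Pi.single j 1)
        rw [hφ]
        simp only at h1 h2
        rw [(hX I h1).2 j h2]
        simp
    have hU : IsOpen ({h : ι → ℝ | ∀ i, H i < h i} ∩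
        {h : ι → ℝ | ∀ I j, φ I j H < 0 → φ I j h < 0}) := by
      apply IsOpen.inter
      · simp only [Set.setOf_forall]
        exact isOpen_iInter_of_finite fun i => isOpen_lt continuous_const (continuous_apply i)
      · simp only [Set.setOf_forall]
        exact isOpen_iInter_of_finite fun I => isOpen_iInter_of_finite fun j =>
          isOpen_iInter_of_finite fun _ => isOpen_lt (hcont I j) continuous_const
    have hne : ({h : ι → ℝ | ∀ i, H i < h i} ∩
        {h : ι → ℝ | ∀ I j, φ I j H < 0 → φ I j h < 0}).Nonempty := by
      have hc : Filter.Tendsto (fun t : ℝ => H + t • (fun _ => (1:ℝ))) (nhdsWithin 0 (Set.Ioi 0))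
          (nhds H) := by
        have : ContinuousAt (fun t : ℝ => H + t • (fun _ : ι => (1:ℝ))) 0 := by fun_prop
        have h2 := this.tendsto
        simp only [zero_smul, add_zero] at h2
        exact h2.mono_left nhdsWithin_le_nhds
      have hW : IsOpen {h : ι → ℝ | ∀ I j, φ I j H < 0 → φ I j h < 0} := by
        simp only [Set.setOf_forall]
        exact isOpen_iInter_of_finite fun I => isOpen_iInter_of_finite fun j =>
          isOpen_iInter_of_finite fun _ => isOpen_lt (hcont I j) continuous_const
      have h3 := hc.eventually (hW.mem_nhds (x := H) (fun I j h => h))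
      obtain ⟨t, ht1, ht2⟩ := (h3.and (self_mem_nhdsWithin (a := (0:ℝ)) (s := Set.Ioi 0))).exists
      refine ⟨_, ?_, ht1⟩
      intro i
      simpa using ht2
    obtain ⟨h0, ⟨h1, h2⟩, h3⟩ := hd.inter_open_nonempty _ hU hne
    refine ⟨h0, h1, h2, fun I hI j hj => ?_⟩
    rw [Set.mem_iInter] at h3
    exact h3 ⟨(I, j), hI, hj⟩
  have huniq : ∀ I, Bas a I → ∀ h y, (∀ i ∈ I, a i y = h i) → X I h = y := by
    intro I hI h y hy
    rw [← sub_eq_zero]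
    apply hI.1
    intro i hi
    rw [map_sub, (hX I hI).1 h i hi, hy i hi, sub_self]
  let B : Finset (Finset ι) := Finset.univ.filter fun I => Bas a I ∧ ∀ i, a i (X I h0) ≤ h0 i
  have hB : ∀ I, I ∈ B ↔ Bas a I ∧ ∀ i, a i (X I h0) ≤ h0 i := by simp [B]
  have hstrict : ∀ I ∈ B, ∀ j, j ∉ I → a j (X I h0) < h0 j := by
    intro I hI j hj
    obtain ⟨h1, h2⟩ := (hB I).mp hI
    have := hh3 I h1 j hj
    rw [hφ] at this
    exact lt_of_le_of_ne (h2 j) fun h => this (by rw [h, sub_self])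
  have hact : ∀ y, (∀ i, a i y ≤ h0 i) → Spg a (Finset.univ.filter fun i => a i y = h0 i) →
      ∃ I ∈ B, X I h0 = y ∧ ∀ i, i ∈ I ↔ a i y = h0 i := by
    intro y hy hs
    obtain ⟨I, hI, hb⟩ := exists_bas _ hs
    have hxy : X I h0 = y := huniq I hb h0 y fun i hi => by
      have := hI hi
      simpa using this
    have hIB : I ∈ B := (hB I).mpr ⟨hb, by rw [hxy]; exact hy⟩
    refine ⟨I, hIB, hxy, fun i => ⟨fun hi => by simpa using hI hi, fun hi => ?_⟩⟩
    by_contra hni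
    have := hstrict I hIB i hni
    rw [hxy, hi] at this
    exact lt_irrefl _ this
  have hcl : ∀ h : ι → ℝ, IsCompact {y : Fin n → ℝ | ∀ i, a i y ≤ h i} := by
    intro h
    refine Metric.isCompact_of_isClosed_isBounded ?_ (hbd h)
    simp only [Set.setOf_forall]
    exact isClosed_iInter fun i =>
      isClosed_le (a i).continuous_of_finiteDimensional continuous_const
  have hBne : B.Nonempty := by
    have hne : {y : Fin n → ℝ | ∀ i, a i y ≤ h0 i}.Nonempty :=
      ⟨y0, fun i => (hy0 i).trans (hh1 i).le⟩
    obtain ⟨x, hx⟩ := (hcl h0).extremePoints_nonempty hne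
    have hxm : ∀ i, a i x ≤ h0 i := hx.1
    have hs : Spg a (Finset.univ.filter fun i => a i x = h0 i) := by
      intro z hz
      have hz' : ∀ i, a i x = h0 i → a i z = 0 := fun i hi => hz i (by simp [hi])
      obtain ⟨t, ht, h1⟩ := exists_small hxm (z := z) fun i hi => (hz' i hi).le
      obtain ⟨s, hs, h2⟩ := exists_small hxm (z := -z) fun i hi => by rw [map_neg, hz' i hi, neg_zero]
      have := hx.2 (x₁ := x + t • z) h1 (x₂ := x + s • (-z)) h2 ?_
      · have h4 : t • z = 0 := by simpa using this
        exact (smul_eq_zero.mp h4).resolve_left ht.ne'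
      · refine ⟨s / (s + t), t / (s + t), by positivity, by positivity, by field_simp, ?_⟩
        ext i
        simp
        field_simp
        ring
    obtain ⟨I, hI, _⟩ := hact x hxm hs
    exact ⟨I, hI⟩
  refine ⟨⟨a, B, X, fun I hI => (hX I ((hB I).mp hI).1).1, fun I hI => ((hB I).mp hI).1.1, hBne, ?_⟩,
    rfl, ⟨h0, hstrict⟩, ?_⟩
  · intro I hI k hk
    obtain ⟨hb, hfe⟩ := (hB I).mp hI
    have hXI := (hX I hb).1
    let F : Set (Fin n → ℝ) := {y | ∀ i, a i y ≤ h0 i} ∩ {y | ∀ i ∈ I.erase k, a i y = h0 i}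
    have hF : IsCompact F := by
      apply (hcl h0).inter_right
      simp only [Set.setOf_forall]
      exact isClosed_iInter fun i => isClosed_iInter fun _ =>
        isClosed_eq (a i).continuous_of_finiteDimensional continuous_const
    have hxF : X I h0 ∈ F := ⟨hfe, fun i hi => hXI h0 i (Finset.mem_of_mem_erase hi)⟩
    obtain ⟨y, hyF, hymin⟩ := hF.exists_isMinOn ⟨_, hxF⟩
      ((a k).continuous_of_finiteDimensional.continuousOn)
    have hmin : ∀ z ∈ F, a k y ≤ a k z := fun z hz => hymin hz
    have hky : a k y < h0 k := by
      obtain ⟨t, ht, h1⟩ := exists_small hfe (z := -(X I (Pi.single k 1))) fun i hi => by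
        have hiI : i ∈ I := by
          by_contra hni
          exact absurd hi (hstrict I hI i hni).ne
        rw [map_neg, hXI _ i hiI, Pi.single_apply]
        split_ifs <;> norm_num
      have h2 := hmin (X I h0 + t • -(X I (Pi.single k 1))) ⟨h1, fun i hi => ?_⟩
      · rw [map_add, map_smul, map_neg, hXI _ k hk, hXI _ k hk] at h2
        simp at h2
        linarith
      · have hi2 := Finset.mem_of_mem_erase hi
        rw [map_add, map_smul, map_neg, hXI _ i hi2, hXI _ i hi2]
        simp [Pi.single_apply, Finset.ne_of_mem_erase hi]
    have hs : Spg a (Finset.univ.filter fun i => a i y = h0 i) := by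
      intro z hz
      have hz' : ∀ i, a i y = h0 i → a i z = 0 := fun i hi => hz i (by simp [hi])
      obtain ⟨t, ht, h1⟩ := exists_small hyF.1 (z := z) fun i hi => (hz' i hi).le
      obtain ⟨s, hs, h2⟩ := exists_small hyF.1 (z := -z) fun i hi => by
        rw [map_neg, hz' i hi, neg_zero]
      have h3 := hmin _ ⟨h1, fun i hi => by
        rw [map_add, map_smul, hz' i (hyF.2 i hi), hyF.2 i hi]; simp⟩
      have h4 := hmin _ ⟨h2, fun i hi => by
        rw [map_add, map_smul, map_neg, hz' i (hyF.2 i hi), hyF.2 i hi]; simp⟩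
      simp at h3 h4
      have h5 : a k z = 0 := by
        rcases lt_trichotomy (a k z) 0 with h | h | h
        · nlinarith
        · exact h
        · nlinarith
      apply hb.1
      intro i hi
      by_cases hik : i = k
      · rw [hik, h5]
      · exact hz' i (hyF.2 i (Finset.mem_erase.mpr ⟨hik, hi⟩))
    obtain ⟨I', hI', _, hiff⟩ := hact y hyF.1 hs
    exact ⟨I', hI', fun i hi => (hiff i).mpr (hyF.2 i hi), fun h => hky.ne ((hiff k).mp h)⟩
  · intro I hI j
    obtain ⟨hb, hfe⟩ := (hB I).mp hI
    by_contra hcon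
    have h1 : φ I j H < 0 := by
      rw [hφ]
      simp only [not_le] at hcon
      linarith
    have h2 := hh2 I j h1
    rw [hφ] at h2
    have := hfe j
    linarith

end approxCore


section approxPoly

variable {n : ℕ}

/-- functional given by a vector -/
noncomputable def dl (v : Fin n → ℝ) : (Fin n → ℝ) →ₗ[ℝ] ℝ := ∑ i, v i • LinearMap.proj i

lemma dl_apply (v y : Fin n → ℝ) : dl v y = ∑ i, v i * y i := by
  simp [dl, LinearMap.sum_apply]

lemma dl_comm (v y : Fin n → ℝ) : dl v y = dl y v := by
  simp only [dl_apply, mul_comm]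

lemma extreme_spg {ι : Type} [Fintype ι] [DecidableEq ι] {a : ι → (Fin n → ℝ) →ₗ[ℝ] ℝ}
    {h0 : ι → ℝ} {x : Fin n → ℝ}
    (hx : x ∈ Set.extremePoints ℝ {y : Fin n → ℝ | ∀ i, a i y ≤ h0 i})
    (z : Fin n → ℝ) (hz' : ∀ i, a i x = h0 i → a i z = 0) : z = 0 := by
  have hxm : ∀ i, a i x ≤ h0 i := hx.1
  obtain ⟨t, ht, h1⟩ := exists_small hxm (z := z) fun i hi => (hz' i hi).le
  obtain ⟨s, hs, h2⟩ := exists_small hxm (z := -z) fun i hi => by rw [map_neg, hz' i hi, neg_zero]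
  have := hx.2 (x₁ := x + t • z) h1 (x₂ := x + s • (-z)) h2 ?_
  · have h4 : t • z = 0 := by simpa using this
    exact (smul_eq_zero.mp h4).resolve_left ht.ne'
  · refine ⟨s / (s + t), t / (s + t), by positivity, by positivity, by field_simp, ?_⟩
    ext i
    simp
    field_simp
    ring

lemma finite_extreme {ι : Type} [Fintype ι] [DecidableEq ι] (a : ι → (Fin n → ℝ) →ₗ[ℝ] ℝ)
    (h0 : ι → ℝ) : (Set.extremePoints ℝ {y : Fin n → ℝ | ∀ i, a i y ≤ h0 i}).Finite := by
  apply Set.Finite.of_finite_image (f := fun y => {i | a i y = h0 i}) (Set.toFinite _)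
  intro x hx y hy hxy
  have : y - x = 0 := by
    apply extreme_spg hx
    intro i hi
    have hi' : i ∈ {i | a i x = h0 i} := hi
    have h2 : i ∈ {i | a i y = h0 i} := by
      have h3 : {i | a i x = h0 i} = {i | a i y = h0 i} := hxy
      rwa [h3] at hi'
    rw [map_sub, hi, h2, sub_self]
  exact (sub_eq_zero.mp this).symm

lemma VH (X : Finset (Fin n → ℝ)) (q : Fin n → ℝ) {r : ℝ} (hr : 0 < r)
    (hb : Metric.closedBall q r ⊆ convexHull ℝ (X : Set (Fin n → ℝ))) :
    ∃ E : Finset (Fin n → ℝ), ∀ y, (∀ e ∈ E, ∃ x ∈ X, dl e y ≤ dl e x) →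
      y ∈ convexHull ℝ (X : Set (Fin n → ℝ)) := by
  classical
  let a : {x // x ∈ X} → (Fin n → ℝ) →ₗ[ℝ] ℝ := fun x => dl (x.1 - q)
  let C : Set (Fin n → ℝ) := {c | ∀ x, a x c ≤ (fun _ => (1:ℝ)) x}
  have hC : ∀ c, c ∈ C ↔ ∀ x ∈ X, dl c (x - q) ≤ 1 := by
    intro c
    constructor
    · intro h x hx
      rw [dl_comm]; exact h ⟨x, hx⟩
    · intro h x
      have := h x.1 x.2
      rw [dl_comm] at this; exact this
  have hfin : (Set.extremePoints ℝ C).Finite := finite_extreme a _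
  have hcv : Convex ℝ C := by
    have : C = ⋂ x, {c | a x c ≤ 1} := by ext; simp [C]
    rw [this]
    exact convex_iInter fun x => convex_halfSpace_le (a x).isLinear _
  have hcl : IsClosed C := by
    have : C = ⋂ x, {c | a x c ≤ 1} := by ext; simp [C]
    rw [this]
    exact isClosed_iInter fun x =>
      isClosed_le (a x).continuous_of_finiteDimensional continuous_const
  have hle : ∀ c ∈ C, ∀ z : Fin n → ℝ, ‖z‖ ≤ r → dl c z ≤ 1 := by
    intro c hc z hz
    have h1 : convexHull ℝ (X : Set (Fin n → ℝ)) ⊆ {w | dl c w ≤ 1 + dl c q} := by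
      apply convexHull_min
      · intro x hx
        have := (hC c).mp hc x hx
        rw [map_sub] at this
        simp only [Set.mem_setOf_eq]; linarith
      · exact convex_halfSpace_le (dl c).isLinear _
    have h2 := h1 (hb (show q + z ∈ Metric.closedBall q r by simpa using hz))
    simp only [Set.mem_setOf_eq, map_add] at h2
    linarith
  have hbd : C ⊆ Metric.closedBall 0 (1 / r) := by
    intro c hc
    rw [mem_closedBall_zero_iff, pi_norm_le_iff_of_nonneg (by positivity)]
    intro i
    have h1 := hle c hc (Pi.single i r) (by rw [Pi.norm_single]; simp [abs_of_pos hr])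
    have h2 := hle c hc (-Pi.single i r) (by rw [norm_neg, Pi.norm_single]; simp [abs_of_pos hr])
    rw [map_neg] at h2
    have h3 : dl c (Pi.single i r) = c i * r := by
      rw [dl_apply, Finset.sum_eq_single i] <;> simp +contextual [Pi.single_apply]
    rw [h3] at h1 h2
    rw [Real.norm_eq_abs, abs_le, le_div_iff₀ hr, neg_le, ]
    refine ⟨?_, h1⟩
    rw [le_div_iff₀ hr]; linarith
  have hcomp : IsCompact C :=
    Metric.isCompact_of_isClosed_isBounded hcl (Metric.isBounded_closedBall.subset hbd)
  refine ⟨hfin.toFinset, fun y hy => ?_⟩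
  by_contra hcon
  obtain ⟨f, u, hf1, hf2⟩ := geometric_hahn_banach_closed_point (convex_convexHull ℝ _)
      (X.finite_toSet.isCompact_convexHull ℝ).isClosed hcon
  have hq : f q < u := hf1 q (hb (Metric.mem_closedBall_self hr.le))
  let c0 : Fin n → ℝ := fun i => f (Pi.single i 1)
  have hc0 : ∀ y, dl c0 y = f y := by
    intro y
    rw [dl_apply]
    conv_rhs => rw [pi_eq_sum_univ' y]
    rw [map_sum]
    refine Finset.sum_congr rfl fun i _ => ?_
    rw [map_smul, smul_eq_mul, mul_comm]
  have hd : 0 < u - f q := by linarith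
  have hsm : ∀ y, dl ((u - f q)⁻¹ • c0) y = (u - f q)⁻¹ * f y := by
    intro y
    rw [dl_comm, map_smul, dl_comm, hc0, smul_eq_mul]
  have hcC : (u - f q)⁻¹ • c0 ∈ C := by
    rw [hC]
    intro x hx
    have := hf1 x (subset_convexHull ℝ _ hx)
    rw [hsm, map_sub, inv_mul_le_iff₀ hd]
    linarith
  rw [← closure_convexHull_extremePoints hcomp hcv] at hcC
  have hsub : closure (convexHull ℝ (Set.extremePoints ℝ C)) ⊆ {c | dl (y - q) c ≤ 1} := by
    apply closure_minimal
    · apply convexHull_min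
      · intro e he
        obtain ⟨x, hx, hxe⟩ := hy e (hfin.mem_toFinset.mpr he)
        have h1 := (hC e).mp he.1 x hx
        simp only [Set.mem_setOf_eq]
        rw [dl_comm, map_sub]
        rw [map_sub] at h1
        linarith
      · exact convex_halfSpace_le (dl (y - q)).isLinear _
    · exact isClosed_le (dl (y - q)).continuous_of_finiteDimensional continuous_const
  have h1 := hsub hcC
  simp only [Set.mem_setOf_eq] at h1
  rw [dl_comm, hsm, map_sub, inv_mul_le_iff₀ hd] at h1
  linarith

lemma cube_hull {ε : ℝ} (hε : 0 < ε) : ∃ V : Finset (Fin n → ℝ),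
    convexHull ℝ (V : Set (Fin n → ℝ)) = Metric.closedBall 0 ε := by
  have hf : (Set.pi Set.univ fun _ : Fin n => ({-ε, ε} : Set ℝ)).Finite :=
    Set.Finite.pi fun _ => Set.toFinite _
  refine ⟨hf.toFinset, ?_⟩
  rw [Set.Finite.coe_toFinset, convexHull_pi, closedBall_pi _ hε.le]
  congr 1
  ext i : 1
  rw [convexHull_pair, segment_eq_Icc (by linarith), Pi.zero_apply, Real.closedBall_eq_Icc]
  simp

/-- Outer polytopal approximation. -/
lemma outer_hull {K : Set (Fin n → ℝ)} (hne : K.Nonempty) (hc : IsCompact K) (hcv : Convex ℝ K)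
    {ε : ℝ} (hε : 0 < ε) : ∃ (X : Finset (Fin n → ℝ)) (q : Fin n → ℝ),
    K ⊆ convexHull ℝ (X : Set (Fin n → ℝ)) ∧
    convexHull ℝ (X : Set (Fin n → ℝ)) ⊆ K + Metric.closedBall 0 ε ∧
    Metric.closedBall q ε ⊆ convexHull ℝ (X : Set (Fin n → ℝ)) := by
  classical
  obtain ⟨V, hV⟩ := cube_hull (n := n) hε
  obtain ⟨t, htK, hfin, hcov⟩ := hc.finite_cover_balls hε
  have hX : convexHull ℝ (↑(hfin.toFinset + V) : Set (Fin n → ℝ)) =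
      convexHull ℝ t + Metric.closedBall 0 ε := by
    rw [Finset.coe_add, convexHull_add, hV, Set.Finite.coe_toFinset]
  have hsub : ∀ x ∈ t, Metric.closedBall x ε ⊆ convexHull ℝ t + Metric.closedBall 0 ε := by
    intro x hx y hy
    refine ⟨x, subset_convexHull ℝ _ hx, y - x, ?_, by simp⟩
    simpa [dist_eq_norm] using hy
  have hK : K ⊆ convexHull ℝ t + Metric.closedBall 0 ε := by
    intro y hy
    obtain ⟨x, hx⟩ := Set.mem_iUnion.mp (hcov hy)
    obtain ⟨hxt, hyx⟩ := Set.mem_iUnion.mp hx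
    exact hsub x hxt (Metric.ball_subset_closedBall hyx)
  obtain ⟨y, hy⟩ := hne
  obtain ⟨x, hx⟩ := Set.mem_iUnion.mp (hcov hy)
  obtain ⟨hxt, hyx⟩ := Set.mem_iUnion.mp hx
  refine ⟨hfin.toFinset + V, x, ?_, ?_, ?_⟩
  · rw [hX]; exact hK
  · rw [hX]; exact Set.add_subset_add_right (convexHull_min htK hcv)
  · rw [hX]; exact hsub x hxt

lemma approx {α : Type} [Fintype α] [Nonempty α] (K : α → Set (Fin n → ℝ))
    (hne : ∀ i, (K i).Nonempty) (hc : ∀ i, IsCompact (K i)) (hcv : ∀ i, Convex ℝ (K i))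
    {ε : ℝ} (hε : 0 < ε) :
    ∃ (ι : Type) (_ : Fintype ι) (_ : DecidableEq ι) (D : PDat n ι) (h : α → ι → ℝ),
      (∀ i, h i ∈ D.Ch) ∧ (∀ i, K i ⊆ D.P (h i)) ∧
      ∀ i, D.P (h i) ⊆ K i + Metric.closedBall 0 (2 * ε) := by
  classical
  choose X q hKX hXK hqX using fun i => outer_hull (hne i) (hc i) (hcv i) hε
  let XX : Finset (Fin n → ℝ) := ∑ i, X i
  have hXX : convexHull ℝ (XX : Set (Fin n → ℝ)) =
      ∑ i, convexHull ℝ (X i : Set (Fin n → ℝ)) := by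
    simp only [XX]
    rw [Finset.coe_sum, convexHull_sum]
  have hqm : ∀ i, q i ∈ convexHull ℝ (X i : Set (Fin n → ℝ)) := fun i =>
    hqX i (Metric.mem_closedBall_self hε.le)
  have hXne : ∀ i, (X i).Nonempty := fun i => by
    have := convexHull_nonempty_iff.mp ⟨_, hqm i⟩
    exact_mod_cast this
  have hball : Metric.closedBall (∑ i, q i) ε ⊆ convexHull ℝ (XX : Set (Fin n → ℝ)) := by
    intro w hw
    obtain ⟨i0⟩ := ‹Nonempty α›
    rw [hXX, Set.mem_fintype_sum]
    refine ⟨fun i => q i + if i = i0 then w - ∑ i, q i else 0, fun i => ?_, ?_⟩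
    · apply hqX i
      show q i + (if i = i0 then w - ∑ i, q i else 0) ∈ _
      split_ifs
      · rw [mem_closedBall_iff_norm] at hw ⊢
        simpa using hw
      · simpa using hε.le
    · simp [Finset.sum_add_distrib]
  obtain ⟨E, hE⟩ := VH XX _ hε hball
  let a : ({e // e ∈ E} ⊕ (Fin n ⊕ Fin n)) → (Fin n → ℝ) →ₗ[ℝ] ℝ := fun j =>
    match j with
    | Sum.inl e => dl e.1
    | Sum.inr (Sum.inl i) => LinearMap.proj i
    | Sum.inr (Sum.inr i) => -LinearMap.proj i
  have hbd : ∀ h : ({e // e ∈ E} ⊕ (Fin n ⊕ Fin n)) → ℝ,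
      Bornology.IsBounded {y : Fin n → ℝ | ∀ i, a i y ≤ h i} := by
    intro h
    apply (Metric.isBounded_Icc (fun i => - h (Sum.inr (Sum.inr i)))
      (fun i => h (Sum.inr (Sum.inl i)))).subset
    intro y hy
    refine ⟨fun i => ?_, fun i => hy (Sum.inr (Sum.inl i))⟩
    have : - y i ≤ h (Sum.inr (Sum.inr i)) := hy (Sum.inr (Sum.inr i))
    simp only
    linarith
  let h : α → ({e // e ∈ E} ⊕ (Fin n ⊕ Fin n)) → ℝ := fun i j =>
    (X i).sup' (hXne i) fun x => a j x
  have hQh : ∀ i, ∀ y ∈ convexHull ℝ (X i : Set (Fin n → ℝ)), ∀ j, a j y ≤ h i j := by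
    intro i y hy j
    have : convexHull ℝ (X i : Set (Fin n → ℝ)) ⊆ {y | a j y ≤ h i j} := by
      apply convexHull_min
      · intro x hx
        exact Finset.le_sup' (fun x => a j x) hx
      · exact convex_halfSpace_le (a j).isLinear _
    exact this hy
  have hatt : ∀ i j, ∃ x ∈ X i, h i j = a j x := fun i j =>
    Finset.exists_mem_eq_sup' (hXne i) _
  have hPQ : ∀ y, (∀ j, a j y ≤ (∑ i, h i) j) → y ∈ convexHull ℝ (XX : Set (Fin n → ℝ)) := by
    intro y hy
    apply hE
    intro e he
    choose x hx hxe using fun i => hatt i (Sum.inl ⟨e, he⟩)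
    refine ⟨∑ i, x i, ?_, ?_⟩
    · rw [← Finset.mem_coe]
      simp only [XX]
      rw [Finset.coe_sum, Set.mem_fintype_sum]
      exact ⟨x, fun i => by exact_mod_cast hx i, rfl⟩
    · have := hy (Sum.inl ⟨e, he⟩)
      rw [Finset.sum_apply, Finset.sum_congr rfl fun i _ => hxe i, ← map_sum] at this
      exact this
  obtain ⟨D, hDa, ⟨h0, hh0⟩, hDB⟩ := exists_PDat a hbd (∑ i, h i) (∑ i, q i) (by
    intro j
    rw [map_sum, Finset.sum_apply]
    exact Finset.sum_le_sum fun i _ => hQh i _ (hqm i) j)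
  have hmem : ∀ I ∈ D.B, ∀ i, D.X I (h i) ∈ convexHull ℝ (X i : Set (Fin n → ℝ)) := by
    intro I hI i
    have h1 := hPQ _ (hDB I hI)
    rw [hXX, Set.mem_fintype_sum] at h1
    obtain ⟨x, hx, hsum⟩ := h1
    have h2 : D.X I (h i) = x i := by
      apply PDat.X_eq hI
      intro j hj
      have h3 := D.hX I hI (∑ i, h i) j hj
      rw [← hsum, map_sum, Finset.sum_apply, hDa] at h3
      rw [hDa]
      exact (Finset.sum_eq_sum_iff_of_le fun i _ => hQh i _ (hx i) j).mp h3 i (Finset.mem_univ _)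
    rw [h2]; exact hx i
  -- a nonnegative element of the chamber
  obtain ⟨g, hg, hg0⟩ : ∃ g ∈ D.Ch, ∀ j, 0 ≤ g j := by
    obtain ⟨I0, hI0⟩ := D.ne
    refine ⟨fun j => h0 j - D.a j (D.X I0 h0), ?_, ?_⟩
    · intro I hI j hj
      have h1 := hh0 I hI j hj
      have h2 : D.X I (fun j => h0 j - D.a j (D.X I0 h0)) = D.X I h0 - D.X I0 h0 := by
        apply PDat.X_eq hI
        intro i hi
        rw [map_sub, D.hX I hI h0 i hi]
      rw [h2, map_sub]
      linarith
    · intro j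
      have := PDat.X_mem_P (PDat.Ch_le hh0) hI0 j
      linarith
  obtain ⟨M, hM, hMb⟩ : ∃ M : ℝ, 0 < M ∧ ∀ I ∈ D.B, ‖D.X I g‖ ≤ M := by
    refine ⟨∑ I ∈ D.B, ‖D.X I g‖ + 1, ?_, fun I hI => ?_⟩
    · have : 0 ≤ ∑ I ∈ D.B, ‖D.X I g‖ := Finset.sum_nonneg fun _ _ => norm_nonneg _
      linarith
    · have := Finset.single_le_sum (f := fun I => ‖D.X I g‖) (fun _ _ => norm_nonneg _) hI
      linarith
  have hδ : 0 < ε / M := by positivity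
  have hCh : ∀ i, h i + (ε / M) • g ∈ D.Ch := by
    intro i I hI j hj
    have h1 := hQh i _ (hmem I hI i) j
    have h2 := mul_lt_mul_of_pos_left (hg I hI j hj) hδ
    rw [← hDa] at h1
    simp only [map_add, map_smul, Pi.add_apply, Pi.smul_apply, smul_eq_mul]
    linarith
  refine ⟨_, inferInstance, inferInstance, D, fun i => h i + (ε / M) • g, hCh, ?_, ?_⟩
  · intro i y hy j
    have h1 := hQh i y (hKX i hy) j
    have h2 := mul_nonneg hδ.le (hg0 j)
    rw [hDa]
    simp only [Pi.add_apply, Pi.smul_apply, smul_eq_mul]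
    linarith
  · intro i
    have e1 : Metric.closedBall (0 : Fin n → ℝ) (2 * ε) =
        Metric.closedBall 0 ε + Metric.closedBall 0 ε := by
      rw [closedBall_add_closedBall hε.le hε.le, two_mul, add_zero]
    have h1 : convexHull ℝ (X i : Set (Fin n → ℝ)) + Metric.closedBall 0 ε ⊆
        K i + Metric.closedBall 0 (2 * ε) := by
      rw [e1, ← add_assoc]
      exact Set.add_subset_add_right (hXK i)
    refine subset_trans ?_ h1
    rw [PDat.P_eq ⟨_, hCh i⟩ (PDat.Ch_le (hCh i))]
    apply convexHull_min _ ((convex_convexHull ℝ _).add (convex_closedBall _ _))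
    rintro _ ⟨I, hI, rfl⟩
    refine ⟨_, hmem I hI i, D.X I ((ε / M) • g), ?_, (map_add (D.X I) _ _).symm⟩
    rw [mem_closedBall_zero_iff, map_smul, norm_smul, Real.norm_of_nonneg hδ.le]
    calc ε / M * ‖D.X I g‖ ≤ ε / M * M := mul_le_mul_of_nonneg_left (hMb I hI) hδ.le
      _ = ε := by field_simp

end approxPoly


section final

lemma MV_eq_sum (n : ℕ) (K : Fin n → Set (Fin n → ℝ)) :
    MV n K = ∑ S : Finset (Fin n), if S.Nonempty then
      (-1 : ℝ) ^ (n - S.card) * vol (∑ i ∈ S, K i) else 0 := by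
  rw [← Finset.powerset_univ, Finset.sum_powerset, Finset.card_univ, Fintype.card_fin,
    Finset.sum_range_succ']
  simp only [Finset.powersetCard_zero, Finset.sum_singleton, Finset.not_nonempty_empty, if_false,
    add_zero]
  unfold MV
  rw [Finset.range_eq_Ico, Finset.sum_Ico_add' (fun j => ∑ S ∈ Finset.univ.powersetCard j,
    if S.Nonempty then (-1 : ℝ) ^ (n - S.card) * vol (∑ i ∈ S, K i) else 0) 0 n 1]
  have : Finset.Icc 1 n = Finset.Ico (0 + 1) (n + 1) := by
    ext; simp
  rw [this]
  refine Finset.sum_congr rfl fun j hj => ?_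
  rw [Finset.mul_sum]
  refine Finset.sum_congr rfl fun S hS => ?_
  have hc := (Finset.mem_powersetCard.mp hS).2
  have hj1 := (Finset.mem_Ico.mp hj).1
  rw [if_pos (Finset.card_pos.mp (by omega)), hc]

lemma MV_eq_T {n : ℕ} (hn : 1 ≤ n) {ι : Type} [Fintype ι] [DecidableEq ι] {D : PDat n ι}
    {f : MvPolynomial ι ℝ} (hf : IsVol D f) (h : Fin n → ι → ℝ) (H : ∀ i, h i ∈ D.Ch) :
    MV n (fun i => D.P (h i)) = T f (List.ofFn h) := by
  rw [MV_eq_sum, ← polarization f hf.1]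
  refine Finset.sum_congr rfl fun S _ => ?_
  split_ifs with hS
  · obtain ⟨h1, h2⟩ := PDat.P_sum (D := D) S hS h H
    rw [← h2, hf.2 _ h1]
  · rw [Finset.not_nonempty_iff_eq_empty] at hS
    rw [hS]
    have h1 : MvPolynomial.coeff 0 f = 0 := hf.1.coeff_eq_zero (by simp; omega)
    have h2 : MvPolynomial.eval (0 : ι → ℝ) f = 0 := by
      rw [MvPolynomial.eval_zero, MvPolynomial.constantCoeff_eq, h1]
    rw [Finset.sum_empty, h2, mul_zero]

lemma isCompact_sum' {n : ℕ} {β : Type} (S : Finset β) (K : β → Set (Fin n → ℝ))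
    (hc : ∀ i, IsCompact (K i)) : IsCompact (∑ i ∈ S, K i) := by
  classical
  induction S using Finset.induction_on with
  | empty => simpa using isCompact_singleton
  | insert a s ha ih => rw [Finset.sum_insert ha]; exact (hc a).add ih

lemma sum_sub {n : ℕ} {β : Type} (S : Finset β) (K P : β → Set (Fin n → ℝ)) {δ : ℝ} (hδ : 0 ≤ δ)
    (h : ∀ i, P i ⊆ K i + Metric.closedBall 0 δ) :
    ∑ i ∈ S, P i ⊆ Metric.cthickening (S.card * δ) (∑ i ∈ S, K i) := by
  classical
  have : ∑ i ∈ S, P i ⊆ ∑ i ∈ S, K i + Metric.closedBall 0 (S.card * δ) := by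
    induction S using Finset.induction_on with
    | empty => simp
    | insert a s ha ih =>
      rw [Finset.sum_insert ha, Finset.sum_insert ha, Finset.card_insert_of_notMem ha]
      have e : Metric.closedBall (0 : Fin n → ℝ) (((s.card + 1 : ℕ) : ℝ) * δ) =
          Metric.closedBall 0 δ + Metric.closedBall 0 (s.card * δ) := by
        rw [closedBall_add_closedBall hδ (by positivity), add_zero]
        congr 1
        push_cast
        ring
      rw [e, add_add_add_comm]
      exact Set.add_subset_add (h a) ih
  refine this.trans ?_
  rintro _ ⟨x, hx, y, hy, rfl⟩
  refine Metric.mem_cthickening_of_dist_le _ x _ _ hx ?_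
  simpa using hy

lemma vol_tendsto {n : ℕ} {β : Type} (S : Finset β) (K : β → Set (Fin n → ℝ))
    (hc : ∀ i, IsCompact (K i)) (P : ℕ → β → Set (Fin n → ℝ)) (δ : ℕ → ℝ) (hδ : ∀ k, 0 ≤ δ k)
    (hδ0 : Filter.Tendsto δ Filter.atTop (nhds 0)) (h1 : ∀ k i, K i ⊆ P k i)
    (h2 : ∀ k i, P k i ⊆ K i + Metric.closedBall 0 (δ k)) :
    Filter.Tendsto (fun k => vol (∑ i ∈ S, P k i)) Filter.atTop (nhds (vol (∑ i ∈ S, K i))) := by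
  have hcs := isCompact_sum' S K hc
  refine (ENNReal.tendsto_toReal hcs.measure_lt_top.ne).comp ?_
  have hup : Filter.Tendsto (fun k => volume (Metric.cthickening (S.card * δ k) (∑ i ∈ S, K i)))
      Filter.atTop (nhds (volume (∑ i ∈ S, K i))) := by
    refine (tendsto_measure_cthickening_of_isCompact hcs).comp ?_
    simpa using hδ0.const_mul (S.card : ℝ)
  refine tendsto_of_tendsto_of_tendsto_of_le_of_le tendsto_const_nhds hup ?_ ?_
  · intro k
    exact measure_mono (Set.finset_sum_subset_finset_sum _ _ _ fun i _ => h1 k i)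
  · intro k
    exact measure_mono (sum_sub S K (P k) (hδ k) (h2 k))

lemma MV_tendsto {n : ℕ} (K : Fin n → Set (Fin n → ℝ))
    (hc : ∀ i, IsCompact (K i)) (P : ℕ → Fin n → Set (Fin n → ℝ)) (δ : ℕ → ℝ) (hδ : ∀ k, 0 ≤ δ k)
    (hδ0 : Filter.Tendsto δ Filter.atTop (nhds 0)) (h1 : ∀ k i, K i ⊆ P k i)
    (h2 : ∀ k i, P k i ⊆ K i + Metric.closedBall 0 (δ k)) :
    Filter.Tendsto (fun k => MV n (P k)) Filter.atTop (nhds (MV n K)) := by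
  unfold MV
  refine tendsto_finset_sum _ fun j _ => Filter.Tendsto.const_mul _ ?_
  exact tendsto_finset_sum _ fun S _ => vol_tendsto S K hc P δ hδ hδ0 h1 h2

lemma ofFn_fam {n p : ℕ} (hp1 : 1 ≤ p) (hpn : p ≤ n) {α : Type} (x y : α) (L : Fin (n - p) → α) :
    List.ofFn (fam hp1 hpn (fun _ => x) y L) = List.replicate (p - 1) x ++ y :: List.ofFn L := by
  apply List.ext_getElem
  · simp; omega
  · intro i h1 h2
    rw [List.getElem_ofFn, List.getElem_append]
    unfold fam
    simp only [List.length_replicate]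
    split_ifs with h3 h4
    · simp
    · simp [h4]
    · rw [List.getElem_cons]
      rw [dif_neg (by omega), List.getElem_ofFn]
      congr 2
      omega

lemma fam_comp {n p : ℕ} (hp1 : 1 ≤ p) (hpn : p ≤ n) {α : Type*} {β : Type*} (g : α → β) (x y : α)
    (L : Fin (n - p) → α) (j : Fin n) :
    g (fam hp1 hpn (fun _ => x) y L j) = fam hp1 hpn (fun _ => g x) (g y) (fun i => g (L i)) j := by
  unfold fam
  split_ifs <;> rfl

lemma key {n p : ℕ} (hp1 : 1 ≤ p) (hp2 : 2 ≤ p) (hpn : p ≤ n)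
    (K : Fin p → Set (Fin n → ℝ)) (L : Fin (n - p) → Set (Fin n → ℝ))
    (hKne : ∀ i, (K i).Nonempty) (hKc : ∀ i, IsCompact (K i)) (hKcv : ∀ i, Convex ℝ (K i))
    (hLne : ∀ i, (L i).Nonempty) (hLc : ∀ i, IsCompact (L i)) (hLcv : ∀ i, Convex ℝ (L i)) :
    (∀ i s, 0 ≤ MV n (fam hp1 hpn (fun _ => K i) (K s) L)) ∧
    ∀ i s, MV n (fam hp1 hpn (fun _ => K i) (K i) L) ^ (p - 1) *
        MV n (fam hp1 hpn (fun _ => K s) (K s) L) ≤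
      MV n (fam hp1 hpn (fun _ => K i) (K s) L) ^ p := by
  obtain ⟨N, rfl⟩ : ∃ N, n = N + 2 := ⟨n - 2, by omega⟩
  obtain ⟨q, rfl⟩ : ∃ q, p = q + 1 := ⟨p - 1, by omega⟩
  let G : Fin (q + 1) ⊕ Fin (N + 2 - (q + 1)) → Set (Fin (N + 2) → ℝ) := Sum.elim K L
  have hGne : ∀ i, (G i).Nonempty := by rintro (i | i); exacts [hKne i, hLne i]
  have hGc : ∀ i, IsCompact (G i) := by rintro (i | i); exacts [hKc i, hLc i]
  have hGcv : ∀ i, Convex ℝ (G i) := by rintro (i | i); exacts [hKcv i, hLcv i]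
  choose ι i1 i2 D h hCh hs1 hs2 using fun k : ℕ =>
    approx G hGne hGc hGcv (ε := 1 / ((k : ℝ) + 1)) (by positivity)
  let w : Fin (q + 1) → Fin (q + 1) → Fin (N + 2) → Fin (q + 1) ⊕ Fin (N + 2 - (q + 1)) :=
    fun i s => fam hp1 hpn (fun _ => Sum.inl i) (Sum.inl s) Sum.inr
  have hw : ∀ i s, fam hp1 hpn (fun _ => K i) (K s) L = fun j => G (w i s j) := by
    intro i s
    funext j
    exact (fam_comp hp1 hpn G (Sum.inl i) (Sum.inl s) Sum.inr j).symm
  let m : ℕ → Fin (q + 1) → Fin (q + 1) → ℝ := fun k i s =>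
    MV (N + 2) (fun j => (D k).P (h k (w i s j)))
  have hlim : ∀ i s, Filter.Tendsto (fun k => m k i s) Filter.atTop
      (nhds (MV (N + 2) (fam hp1 hpn (fun _ => K i) (K s) L))) := by
    intro i s
    rw [hw]
    refine MV_tendsto _ (fun j => hGc _) _ (fun k => 2 * (1 / ((k : ℝ) + 1)))
      (fun k => by positivity) ?_ (fun k j => hs1 k _) (fun k j => hs2 k _)
    simpa using (tendsto_one_div_add_atTop_nhds_zero_nat (𝕜 := ℝ)).const_mul 2
  have hT : ∀ k, ∃ f, IsVol (D k) f ∧ ∀ i s, m k i s = T f (List.replicate q (h k (Sum.inl i)) ++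
      h k (Sum.inl s) :: List.ofFn fun t => h k (Sum.inr t)) := by
    intro k
    obtain ⟨f, hf⟩ := exists_isVol _ _ (D k)
    refine ⟨f, hf, fun i s => ?_⟩
    simp only [m]
    rw [MV_eq_T (by omega) hf _ (fun j => hCh k _)]
    have : (fun j => h k (w i s j)) = fam hp1 hpn (fun _ => h k (Sum.inl i)) (h k (Sum.inl s))
        (fun t => h k (Sum.inr t)) := by
      funext j
      exact fam_comp hp1 hpn (h k) (Sum.inl i) (Sum.inl s) Sum.inr j
    rw [this, ofFn_fam]
    rfl
  constructor
  · intro i s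
    refine ge_of_tendsto' (hlim i s) fun k => ?_
    obtain ⟨f, hf, hm⟩ := hT k
    rw [hm]
    refine (T_pos _ _ (D k) f ⟨_, hCh k (Sum.inl i)⟩ hf _ ?_ ?_).le
    · simp; omega
    · intro g hg
      simp only [List.mem_append, List.mem_replicate, List.mem_cons, List.mem_ofFn] at hg
      rcases hg with ⟨_, rfl⟩ | rfl | ⟨t, rfl⟩ <;> exact hCh k _
  · intro i s
    refine le_of_tendsto_of_tendsto' (((hlim i i).pow _).mul (hlim s s)) ((hlim i s).pow _) fun k => ?_
    obtain ⟨f, hf, hm⟩ := hT k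
    simp only [hm, Nat.add_sub_cancel]
    apply T_conseq hf (hCh k _) (hCh k _)
    · intro g hg
      rw [List.mem_ofFn] at hg
      obtain ⟨t, rfl⟩ := hg
      exact hCh k _
    · simp; omega

end final

end AFProof

/-- Intermediate inequality (7.4) in the proof of Theorem 7.3:
`Π_{s=1}^{p} Π_{i ≠ s} MV(K_i^{(p−1)}, K_s, L₁, …, L_{n−p}) ≥
  Π_{s=1}^{p} MV(K_s^{(p)}, L₁, …, L_{n−p})^{p−1}`. -/
theorem intermediate_inequality_four {n p : ℕ} (hp2 : 2 ≤ p) (hpn : p ≤ n)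
    (K : Fin p → Set (Fin n → ℝ)) (L : Fin (n - p) → Set (Fin n → ℝ))
    (hKne : ∀ i, (K i).Nonempty) (hKc : ∀ i, IsCompact (K i)) (hKcv : ∀ i, Convex ℝ (K i))
    (hLne : ∀ i, (L i).Nonempty) (hLc : ∀ i, IsCompact (L i)) (hLcv : ∀ i, Convex ℝ (L i)) :
    ∏ s : Fin p, ∏ i ∈ Finset.univ.erase s,
        MV n (fam (by omega) hpn (fun _ => K i) (K s) L) ≥
      ∏ s : Fin p, MV n (fam (by omega) hpn (fun _ => K s) (K s) L) ^ (p - 1) := by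
  obtain ⟨h1, h2⟩ := AFProof.key (by omega) hp2 hpn K L hKne hKc hKcv hLne hLc hLcv
  exact AFProof.prod_ineq (by omega)
    (fun i s => MV n (fam (by omega) hpn (fun _ => K i) (K s) L)) h1 h2
end

section
/- For all nonempty compact convex sets K₁, …, K_n in ℝⁿ, the mixed volume is nonnegative: MV(K₁, …, K_n) ≥ 0. (This nonnegativity of degrees is used implicitly in the paper's proofs of the Hodge type inequalities when taking p-th roots.) -/
open scoped Pointwise
open MeasureTheory Finset

theorem md_aux {n : ℕ} {C : Finset (Fin n)} :
    0 ≤ ∑ S : Finset (Fin n), (-1 : ℝ) ^ (n - #S) * (if C ⊆ S then 1 else 0) := by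
  have h : ∏ i : Fin n, ((1:ℝ) + (-(if i ∈ C then 0 else 1))) = ∑ S : Finset (Fin n), (-1 : ℝ) ^ (n - #S) * (if C ⊆ S then 1 else 0) := by
    rw [Finset.prod_add, Finset.powerset_univ]
    refine Finset.sum_congr rfl fun S _ => ?_
    rw [Finset.prod_const_one, one_mul, Finset.prod_neg, Finset.card_sdiff_of_subset (Finset.subset_univ S), Finset.card_univ, Fintype.card_fin]
    congr 1
    split_ifs with h
    · apply Finset.prod_eq_one
      intro i hi
      rw [if_neg]
      intro hC
      exact (Finset.mem_sdiff.1 hi).2 (h hC)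
    · obtain ⟨i, hi, hS⟩ := Finset.not_subset.1 h
      exact Finset.prod_eq_zero (i := i) (by simp [hS]) (by simp [hi])
  rw [← h]
  refine Finset.prod_nonneg fun i _ => ?_
  split_ifs <;> simp

theorem det_expand {n : ℕ} (B : Fin n → Matrix (Fin n) (Fin n) ℝ) (S : Finset (Fin n)) :
    (∑ i ∈ S, (B i).transpose * B i).det =
      ∑ f : Fin n → Fin n × Fin n, (if univ.image (fun j => (f j).1) ⊆ S then 1 else 0) *
        ((∏ j, B (f j).1 (f j).2 j) * Matrix.det (Matrix.of fun j => B (f j).1 (f j).2)) := by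
  have h1 : (∑ i ∈ S, (B i).transpose * B i) = fun j => ∑ p : Fin n × Fin n,
      ((if p.1 ∈ S then 1 else 0) * B p.1 p.2 j) • B p.1 p.2 := by
    funext j k
    rw [Matrix.sum_apply, Fintype.sum_prod_type, Finset.sum_apply]
    simp only [Finset.sum_apply, Pi.smul_apply, smul_eq_mul, ite_mul, one_mul, zero_mul]
    rw [← Finset.sum_subset (Finset.subset_univ S)]
    · refine Finset.sum_congr rfl fun i hi => ?_
      simp [hi, Matrix.mul_apply]
    · intro i _ hi
      simp [hi]
  rw [h1]
  change (Matrix.detRowAlternating (R := ℝ)).toMultilinearMap _ = _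
  rw [MultilinearMap.map_sum]
  refine Finset.sum_congr rfl fun f _ => ?_
  rw [MultilinearMap.map_smul_univ, Finset.prod_mul_distrib, smul_eq_mul, mul_assoc]
  congr 1
  split_ifs with h
  · refine Finset.prod_eq_one fun j _ => if_pos (h (Finset.mem_image_of_mem _ (Finset.mem_univ j)))
  · obtain ⟨i, hi, hS⟩ := Finset.not_subset.1 h
    obtain ⟨j, -, rfl⟩ := Finset.mem_image.1 hi
    exact Finset.prod_eq_zero (Finset.mem_univ j) (if_neg hS)

open scoped MatrixOrder Matrix.Norms.L2Operator in
theorem md_nonneg {n : ℕ} (A : Fin n → Matrix (Fin n) (Fin n) ℝ) (hA : ∀ i, (A i).PosSemidef) :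
    0 ≤ ∑ S : Finset (Fin n), (-1 : ℝ) ^ (n - #S) * (∑ i ∈ S, A i).det := by
  have : ∀ i, ∃ B : Matrix (Fin n) (Fin n) ℝ, A i = B.transpose * B := by
    intro i
    obtain ⟨B, hB⟩ := CStarAlgebra.nonneg_iff_eq_star_mul_self.mp (hA i).nonneg
    refine ⟨B, ?_⟩
    rw [hB, Matrix.star_eq_conjTranspose, Matrix.conjTranspose_eq_transpose_of_trivial]
  choose B hB using this
  simp only [hB, det_expand]
  set c : (Fin n → Fin n × Fin n) → ℝ := fun f => ∑ S : Finset (Fin n), (-1 : ℝ) ^ (n - #S) *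
    (if univ.image (fun j => (f j).1) ⊆ S then 1 else 0) with hc
  set M : (Fin n → Fin n × Fin n) → Matrix (Fin n) (Fin n) ℝ :=
    fun f => Matrix.of fun j => B (f j).1 (f j).2 with hM
  have e : ∑ S : Finset (Fin n), (-1 : ℝ) ^ (n - #S) *
      ∑ f : Fin n → Fin n × Fin n, (if univ.image (fun j => (f j).1) ⊆ S then 1 else 0) *
        ((∏ j, B (f j).1 (f j).2 j) * Matrix.det (Matrix.of fun j => B (f j).1 (f j).2))
      = ∑ f, c f * ((∏ j, M f j j) * (M f).det) := by
    simp only [Finset.mul_sum, hc, Finset.sum_mul]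
    rw [Finset.sum_comm]
    simp only [hM, Matrix.of_apply, mul_assoc]
  rw [e]
  have e2 : ∀ σ : Equiv.Perm (Fin n), ∑ f, c f * ((∏ j, M f j j) * (M f).det)
      = ∑ f, c f * (((Equiv.Perm.sign σ : ℤ) : ℝ) * (∏ j, M f (σ j) j) * (M f).det) := by
    intro σ
    rw [← Equiv.sum_comp (Equiv.arrowCongr σ (Equiv.refl (Fin n × Fin n))).symm]
    refine Finset.sum_congr rfl fun f _ => ?_
    have h1 : ((Equiv.arrowCongr σ (Equiv.refl (Fin n × Fin n))).symm f) = fun j => f (σ j) := by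
      funext j; simp [Equiv.arrowCongr]
    rw [h1]
    have h2 : c (fun j => f (σ j)) = c f := by
      simp only [hc]
      have : univ.image (fun j => (f (σ j)).1) = univ.image (fun j => (f j).1) := by
        ext i
        simp only [Finset.mem_image, Finset.mem_univ, true_and]
        exact ⟨fun ⟨j, h⟩ => ⟨σ j, h⟩, fun ⟨j, h⟩ => ⟨σ.symm j, by simpa using h⟩⟩
      rw [this]
    have h3 : (M (fun j => f (σ j))).det = ((Equiv.Perm.sign σ : ℤ) : ℝ) * (M f).det := by
      rw [← Matrix.det_permute]; rfl
    rw [h2, h3]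
    have : (∏ j, M (fun j => f (σ j)) j j) = ∏ j, M f (σ j) j := rfl
    rw [this]; ring
  have e3 : (Fintype.card (Equiv.Perm (Fin n)) : ℝ) * ∑ f, c f * ((∏ j, M f j j) * (M f).det)
      = ∑ f, c f * ((M f).det * (M f).det) := by
    rw [← nsmul_eq_mul, ← Finset.card_univ, ← Finset.sum_const, Finset.sum_congr rfl fun σ _ => e2 σ,
      Finset.sum_comm]
    refine Finset.sum_congr rfl fun f _ => ?_
    rw [← Finset.mul_sum, ← Finset.sum_mul]
    congr 2
    rw [Matrix.det_apply']
  have e4 : 0 ≤ ∑ f, c f * ((M f).det * (M f).det) :=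
    Finset.sum_nonneg fun f _ => mul_nonneg md_aux (mul_self_nonneg _)
  rw [← e3] at e4
  exact nonneg_of_mul_nonneg_right e4 (by exact_mod_cast Fintype.card_pos)

noncomputable def dL {n : ℕ} (a : Fin n → ℝ) : (Fin n → ℝ) →L[ℝ] ℝ :=
  LinearMap.toContinuousLinearMap
    { toFun := fun x => a ⬝ᵥ x
      map_add' := fun x y => dotProduct_add a x y
      map_smul' := fun c x => dotProduct_smul c a x }

theorem dL_apply {n : ℕ} (a x : Fin n → ℝ) : dL a x = a ⬝ᵥ x := rfl

noncomputable def gZ {n : ℕ} (F : Finset (Fin n → ℝ)) (x : Fin n → ℝ) : ℝ :=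
  ∑ a ∈ F, Real.exp (dL a x)
noncomputable def gp {n : ℕ} (F : Finset (Fin n → ℝ)) (a x : Fin n → ℝ) : ℝ :=
  Real.exp (dL a x) * (gZ F x)⁻¹
noncomputable def gg {n : ℕ} (F : Finset (Fin n → ℝ)) (x : Fin n → ℝ) : Fin n → ℝ :=
  ∑ a ∈ F, gp F a x • a
noncomputable def gH {n : ℕ} (F : Finset (Fin n → ℝ)) (x : Fin n → ℝ) :
    Matrix (Fin n) (Fin n) ℝ :=
  ∑ a ∈ F, gp F a x • Matrix.vecMulVec (a - gg F x) (a - gg F x)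
noncomputable def gL {n : ℕ} (A : Matrix (Fin n) (Fin n) ℝ) : (Fin n → ℝ) →L[ℝ] (Fin n → ℝ) :=
  LinearMap.toContinuousLinearMap (Matrix.toLin' A)

theorem gL_apply {n : ℕ} (A : Matrix (Fin n) (Fin n) ℝ) (h : Fin n → ℝ) :
    gL A h = A.mulVec h := rfl

theorem gL_det {n : ℕ} (A : Matrix (Fin n) (Fin n) ℝ) : (gL A).det = A.det := by
  simp [gL, ContinuousLinearMap.det]

theorem gL_sum {n : ℕ} {ι : Type*} (S : Finset ι) (A : ι → Matrix (Fin n) (Fin n) ℝ) :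
    gL (∑ i ∈ S, A i) = ∑ i ∈ S, gL (A i) := by
  simp [gL]

theorem gZ_pos {n : ℕ} {F : Finset (Fin n → ℝ)} (hF : F.Nonempty) (x : Fin n → ℝ) : 0 < gZ F x :=
  Finset.sum_pos (fun _ _ => Real.exp_pos _) hF

theorem gp_pos {n : ℕ} {F : Finset (Fin n → ℝ)} (hF : F.Nonempty) (a x : Fin n → ℝ) :
    0 < gp F a x := mul_pos (Real.exp_pos _) (inv_pos.2 (gZ_pos hF x))

theorem gp_sum {n : ℕ} {F : Finset (Fin n → ℝ)} (hF : F.Nonempty) (x : Fin n → ℝ) :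
    ∑ a ∈ F, gp F a x = 1 := by
  unfold gp
  rw [← Finset.sum_mul]
  exact mul_inv_cancel₀ (gZ_pos hF x).ne'

theorem gg_mem {n : ℕ} {F : Finset (Fin n → ℝ)} (hF : F.Nonempty) (x : Fin n → ℝ) :
    gg F x ∈ convexHull ℝ (F : Set (Fin n → ℝ)) :=
  (convex_convexHull ℝ _).sum_mem (fun a _ => (gp_pos hF a x).le) (gp_sum hF x)
    (fun _ ha => subset_convexHull ℝ _ ha)

theorem gZ_deriv {n : ℕ} {F : Finset (Fin n → ℝ)} (hF : F.Nonempty) (x : Fin n → ℝ) :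
    HasFDerivAt (gZ F) (gZ F x • dL (gg F x)) x := by
  have h : HasFDerivAt (gZ F) (∑ a ∈ F, Real.exp (dL a x) • dL a) x := by
    unfold gZ
    exact HasFDerivAt.fun_sum fun a _ => (dL a).hasFDerivAt.exp
  convert h using 1
  ext1 v
  simp only [gg, gp, dL_apply, _root_.smul_apply, _root_.sum_apply,
    smul_eq_mul, sum_dotProduct, smul_dotProduct, Finset.mul_sum]
  refine Finset.sum_congr rfl fun a _ => ?_
  have := (gZ_pos hF x).ne'
  field_simp

theorem gp_deriv {n : ℕ} {F : Finset (Fin n → ℝ)} (hF : F.Nonempty) (a x : Fin n → ℝ) :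
    HasFDerivAt (gp F a) (gp F a x • dL (a - gg F x)) x := by
  have h1 : HasFDerivAt (fun x => Real.exp (dL a x)) (Real.exp (dL a x) • dL a) x :=
    (dL a).hasFDerivAt.exp
  have hz := (gZ_pos hF x).ne'
  have h2 : HasFDerivAt (fun x => (gZ F x)⁻¹) (-(gZ F x ^ 2)⁻¹ • (gZ F x • dL (gg F x))) x :=
    (hasDerivAt_inv hz).comp_hasFDerivAt x (gZ_deriv hF x)
  refine (h1.mul h2).congr_fderiv ?_
  ext1 v
  simp only [gp, dL_apply, _root_.smul_apply, _root_.add_apply,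
    smul_eq_mul, sub_dotProduct]
  field_simp
  ring

theorem gH_mulVec {n : ℕ} (F : Finset (Fin n → ℝ)) (x h : Fin n → ℝ) :
    (gH F x).mulVec h = ∑ a ∈ F, (gp F a x * ((a - gg F x) ⬝ᵥ h)) • (a - gg F x) := by
  unfold gH
  rw [Matrix.sum_mulVec]
  refine Finset.sum_congr rfl fun a _ => ?_
  rw [Matrix.smul_mulVec, Matrix.vecMulVec_mulVec, mul_smul, op_smul_eq_smul]

theorem gg_deriv {n : ℕ} {F : Finset (Fin n → ℝ)} (hF : F.Nonempty) (x : Fin n → ℝ) :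
    HasFDerivAt (gg F) (gL (gH F x)) x := by
  have h : HasFDerivAt (gg F) (∑ a ∈ F, (gp F a x • dL (a - gg F x)).smulRight a) x := by
    unfold gg
    exact HasFDerivAt.fun_sum fun a _ => (gp_deriv hF a x).smul_const a
  convert h using 1
  ext1 v
  rw [gL_apply, gH_mulVec]
  have h0 : ∑ a ∈ F, gp F a x * ((a - gg F x) ⬝ᵥ v) = 0 := by
    simp only [sub_dotProduct, mul_sub, Finset.sum_sub_distrib, ← Finset.sum_mul, gp_sum hF]
    simp [gg, sum_dotProduct, smul_dotProduct]
  simp only [smul_sub, Finset.sum_sub_distrib, ← Finset.sum_smul]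
  rw [h0]
  simp [dL_apply]

theorem gH_quad {n : ℕ} (F : Finset (Fin n → ℝ)) (x h : Fin n → ℝ) :
    h ⬝ᵥ (gH F x).mulVec h = ∑ a ∈ F, gp F a x * ((a - gg F x) ⬝ᵥ h) ^ 2 := by
  rw [gH_mulVec, dotProduct_sum]
  refine Finset.sum_congr rfl fun a _ => ?_
  rw [dotProduct_smul, dotProduct_comm h, smul_eq_mul]
  ring

theorem gH_psd {n : ℕ} {F : Finset (Fin n → ℝ)} (hF : F.Nonempty) (x : Fin n → ℝ) :
    (gH F x).PosSemidef := by
  rw [Matrix.posSemidef_iff_dotProduct_mulVec]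
  refine ⟨?_, fun h => ?_⟩
  · unfold gH
    rw [Matrix.IsHermitian, Matrix.conjTranspose_eq_transpose_of_trivial, Matrix.transpose_sum]
    refine Finset.sum_congr rfl fun a _ => ?_
    rw [Matrix.transpose_smul, Matrix.transpose_vecMulVec]
  · rw [star_trivial, gH_quad]
    exact Finset.sum_nonneg fun a _ => mul_nonneg (gp_pos hF a x).le (sq_nonneg _)

theorem gH_pos {n : ℕ} {F : Finset (Fin n → ℝ)} (hF : F.Nonempty)
    (hI : (interior (convexHull ℝ (F : Set (Fin n → ℝ)))).Nonempty) (x h : Fin n → ℝ) (hh : h ≠ 0) :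
    0 < h ⬝ᵥ (gH F x).mulVec h := by
  have hnn : ∀ a ∈ F, 0 ≤ gp F a x * ((a - gg F x) ⬝ᵥ h) ^ 2 :=
    fun a _ => mul_nonneg (gp_pos hF a x).le (sq_nonneg _)
  rw [gH_quad]
  refine lt_of_le_of_ne (Finset.sum_nonneg hnn) fun h0 => ?_
  rw [eq_comm, Finset.sum_eq_zero_iff_of_nonneg hnn] at h0
  have h1 : ∀ a ∈ F, dL h a = dL h (gg F x) := by
    intro a ha
    have := h0 a ha
    have h2 : (a - gg F x) ⬝ᵥ h = 0 := by
      simpa [(gp_pos hF a x).ne'] using this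
    rw [sub_dotProduct, sub_eq_zero] at h2
    rw [dL_apply, dL_apply, dotProduct_comm, h2, dotProduct_comm]
  have h3 : convexHull ℝ (F : Set (Fin n → ℝ)) ⊆ {a | dL h a = dL h (gg F x)} :=
    convexHull_min h1 (convex_hyperplane (dL h).toLinearMap.isLinear _)
  obtain ⟨y, hy⟩ := hI
  have h4 : ∀ᶠ t : ℝ in nhds 0, y + t • h ∈ interior (convexHull ℝ (F : Set (Fin n → ℝ))) := by
    have : Filter.Tendsto (fun t : ℝ => y + t • h) (nhds 0) (nhds (y + (0:ℝ) • h)) :=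
      Continuous.tendsto (by fun_prop) 0
    rw [zero_smul, add_zero] at this
    exact this.eventually (isOpen_interior.mem_nhds hy)
  obtain ⟨ε, he, hε⟩ := Metric.eventually_nhds_iff.1 h4
  have h5 := h3 (interior_subset (hε (y := ε / 2) (by simp [abs_of_pos he]; linarith)))
  have h6 := h3 (interior_subset hy)
  simp only [Set.mem_ofPred_eq] at h5 h6
  rw [map_add, h6, map_smul, dL_apply h h, smul_eq_mul] at h5
  have h7 : ε / 2 * (h ⬝ᵥ h) = 0 := by linarith
  rcases mul_eq_zero.1 h7 with h8 | h8
  · linarith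
  · exact hh (dotProduct_self_eq_zero.1 h8)

noncomputable def gT {n : ℕ} {ι : Type*} (F : ι → Finset (Fin n → ℝ)) (S : Finset ι)
    (x : Fin n → ℝ) : Fin n → ℝ := ∑ i ∈ S, gg (F i) x

theorem gT_deriv {n : ℕ} {ι : Type*} {F : ι → Finset (Fin n → ℝ)} (hF : ∀ i, (F i).Nonempty)
    (S : Finset ι) (x : Fin n → ℝ) :
    HasFDerivAt (gT F S) (gL (∑ i ∈ S, gH (F i) x)) x := by
  rw [gL_sum]
  unfold gT
  exact HasFDerivAt.fun_sum fun i _ => gg_deriv (hF i) x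

theorem gT_inj {n : ℕ} {ι : Type*} {F : ι → Finset (Fin n → ℝ)} (hF : ∀ i, (F i).Nonempty)
    (hI : ∀ i, (interior (convexHull ℝ (F i : Set (Fin n → ℝ)))).Nonempty)
    {S : Finset ι} (hS : S.Nonempty) : Function.Injective (gT F S) := by
  intro x y hxy
  by_contra hne
  set h := y - x with hh
  have hh0 : h ≠ 0 := sub_ne_zero.2 (Ne.symm hne)
  have hd : ∀ t : ℝ, HasDerivAt (fun t : ℝ => dL h (gT F S (x + t • h)))
      (dL h (gL (∑ i ∈ S, gH (F i) (x + t • h)) h)) t := by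
    intro t
    have h1 : HasDerivAt (fun t : ℝ => x + t • h) h t := by
      simpa using ((hasDerivAt_id t).smul_const h).const_add x
    exact (dL h).hasFDerivAt.comp_hasDerivAt t ((gT_deriv hF S _).comp_hasDerivAt t h1)
  have hm : StrictMono (fun t : ℝ => dL h (gT F S (x + t • h))) := by
    refine strictMono_of_deriv_pos fun t => ?_
    rw [(hd t).deriv, gL_apply, dL_apply, Matrix.sum_mulVec, dotProduct_sum]
    exact Finset.sum_pos (fun i _ => gH_pos (hF i) (hI i) _ h hh0) hS
  have := hm zero_lt_one
  simp only [zero_smul, add_zero, one_smul, hh, add_sub_cancel] at this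
  rw [hxy] at this
  exact lt_irrefl _ this

theorem gZ_log_le {n : ℕ} {F : Finset (Fin n → ℝ)} (x p : Fin n → ℝ)
    (hp : p ∈ convexHull ℝ (F : Set (Fin n → ℝ))) : dL x p ≤ Real.log (gZ F x) := by
  have h3 : convexHull ℝ (F : Set (Fin n → ℝ)) ⊆ {a | dL x a ≤ Real.log (gZ F x)} := by
    refine convexHull_min (fun a ha => ?_) (convex_halfSpace_le (dL x).toLinearMap.isLinear _)
    change dL x a ≤ _
    rw [dL_apply, dotProduct_comm, ← dL_apply]
    have : Real.exp (dL a x) ≤ gZ F x :=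
      Finset.single_le_sum (f := fun a => Real.exp (dL a x)) (fun _ _ => (Real.exp_pos _).le) ha
    rwa [Real.le_log_iff_exp_le ((Real.exp_pos _).trans_le this)]
  exact h3 hp

theorem gT_surj {n : ℕ} {ι : Type*} {F : ι → Finset (Fin n → ℝ)} (hF : ∀ i, (F i).Nonempty)
    (S : Finset ι) :
    interior (∑ i ∈ S, convexHull ℝ (F i : Set (Fin n → ℝ))) ⊆ Set.range (gT F S) := by
  intro y hy
  obtain ⟨δ, hδ, hb⟩ := Metric.nhds_basis_closedBall.mem_iff.1 (mem_interior_iff_mem_nhds.1 hy)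
  set Φ : (Fin n → ℝ) → ℝ := fun x => ∑ i ∈ S, Real.log (gZ (F i) x) - dL y x with hΦ
  have hd : ∀ x, HasFDerivAt Φ (∑ i ∈ S, dL (gg (F i) x) - dL y) x := by
    intro x
    refine HasFDerivAt.sub (HasFDerivAt.fun_sum fun i _ => ?_) (dL y).hasFDerivAt
    have hz := (gZ_pos (hF i) x).ne'
    have := (gZ_deriv (hF i) x).log hz
    rwa [smul_smul, inv_mul_cancel₀ hz, one_smul] at this
  have hlow : ∀ x, δ * ‖x‖ ≤ Φ x := by
    intro x
    have key : ∀ z ∈ ∑ i ∈ S, convexHull ℝ (F i : Set (Fin n → ℝ)),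
        dL x z ≤ ∑ i ∈ S, Real.log (gZ (F i) x) := by
      intro z hz
      obtain ⟨g, hg, rfl⟩ := (Set.mem_finsetSum _ _ _).1 hz
      rw [map_sum]
      exact Finset.sum_le_sum fun i hi => gZ_log_le x _ (hg hi)
    have hyx : dL x y = dL y x := by
      rw [dL_apply, dL_apply, dotProduct_comm]
    rcases eq_or_ne x 0 with rfl | hx
    · have := key y (hb (Metric.mem_closedBall_self hδ.le))
      simp only [hΦ]
      rw [← hyx, norm_zero]; linarith
    · have hx0 : 0 < ‖x‖ := norm_pos_iff.2 hx
      have := key (y + (δ / ‖x‖) • x) (hb (by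
        rw [Metric.mem_closedBall, dist_eq_norm, add_sub_cancel_left, norm_smul, Real.norm_eq_abs,
          abs_of_pos (div_pos hδ hx0), div_mul_cancel₀ _ hx0.ne']))
      rw [map_add, map_smul, hyx, dL_apply x x, smul_eq_mul] at this
      have h2 : ‖x‖ ^ 2 ≤ x ⬝ᵥ x := by
        have h3 : ‖x‖ ≤ Real.sqrt (x ⬝ᵥ x) := by
          refine (pi_norm_le_iff_of_nonneg (Real.sqrt_nonneg _)).2 fun i => ?_
          rw [Real.norm_eq_abs]
          refine Real.abs_le_sqrt ?_
          rw [sq]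
          exact Finset.single_le_sum (f := fun i => x i * x i) (fun i _ => mul_self_nonneg _)
            (Finset.mem_univ i)
        have h0 : 0 ≤ x ⬝ᵥ x := Finset.sum_nonneg fun i _ => mul_self_nonneg _
        calc ‖x‖ ^ 2 ≤ Real.sqrt (x ⬝ᵥ x) ^ 2 := by gcongr
          _ = _ := Real.sq_sqrt h0
      have h4 : δ * ‖x‖ = δ / ‖x‖ * ‖x‖ ^ 2 := by field_simp
      have h5 : δ / ‖x‖ * ‖x‖ ^ 2 ≤ δ / ‖x‖ * (x ⬝ᵥ x) := by gcongr
      simp only [hΦ]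
      linarith
  have hcont : Continuous Φ := continuous_iff_continuousAt.2 fun x => (hd x).continuousAt
  have hlim : Filter.Tendsto Φ (Filter.cocompact _) Filter.atTop :=
    Filter.tendsto_atTop_mono hlow ((tendsto_norm_cocompact_atTop).const_mul_atTop hδ)
  obtain ⟨x, hx⟩ := hcont.exists_forall_le hlim
  have hmin : IsLocalMin Φ x := Filter.Eventually.of_forall hx
  have h0 := hmin.hasFDerivAt_eq_zero (hd x)
  refine ⟨x, ?_⟩
  have h1 := congrArg (fun L => L (gT F S x - y)) h0
  simp only [_root_.sub_apply, _root_.sum_apply, dL_apply, _root_.zero_apply,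
    ← sum_dotProduct, ← sub_dotProduct] at h1
  exact sub_eq_zero.1 (dotProduct_self_eq_zero.1 h1)

theorem poly_vol {n : ℕ} {ι : Type*} {F : ι → Finset (Fin n → ℝ)} (hF : ∀ i, (F i).Nonempty)
    (hI : ∀ i, (interior (convexHull ℝ (F i : Set (Fin n → ℝ)))).Nonempty)
    {S : Finset ι} (hS : S.Nonempty) :
    Integrable (fun x => (∑ i ∈ S, gH (F i) x).det) ∧
    vol (∑ i ∈ S, convexHull ℝ (F i : Set (Fin n → ℝ))) = ∫ x, (∑ i ∈ S, gH (F i) x).det := by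
  set P := ∑ i ∈ S, convexHull ℝ (F i : Set (Fin n → ℝ)) with hP
  have hPc : Convex ℝ P := by
    rw [hP, ← convexHull_sum]; exact convex_convexHull _ _
  have hPk : IsCompact P := by
    have : P = convexHull ℝ ((∑ i ∈ S, F i : Finset (Fin n → ℝ)) : Set (Fin n → ℝ)) := by
      rw [hP, ← convexHull_sum, Finset.coe_sum]
    rw [this]
    exact (Finset.finite_toSet (∑ i ∈ S, F i)).isCompact_convexHull ℝ
  have hsub : gT F S '' Set.univ ⊆ P := by
    rintro _ ⟨x, -, rfl⟩
    exact Set.finsetSum_mem_finsetSum _ _ _ fun i _ => gg_mem (hF i) x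
  have hsup : interior P ⊆ gT F S '' Set.univ := by
    rw [Set.image_univ]; exact gT_surj hF S
  have hvol : volume (gT F S '' Set.univ) = volume P := by
    refine le_antisymm (measure_mono hsub) ?_
    rw [← measure_congr (interior_ae_eq_of_null_frontier (hPc.addHaar_frontier volume))]
    exact measure_mono hsup
  have hdet : ∀ x, |(gL (∑ i ∈ S, gH (F i) x)).det| = (∑ i ∈ S, gH (F i) x).det := by
    intro x
    rw [gL_det]
    exact abs_of_nonneg (Matrix.posSemidef_sum S fun i _ => gH_psd (hF i) x).det_nonneg
  have hder : ∀ x ∈ Set.univ, HasFDerivWithinAt (gT F S) (gL (∑ i ∈ S, gH (F i) x)) Set.univ x :=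
    fun x _ => (gT_deriv hF S x).hasFDerivWithinAt
  have hinj : Set.InjOn (gT F S) Set.univ := (gT_inj hF hI hS).injOn
  have h1 := integrableOn_image_iff_integrableOn_abs_det_fderiv_smul volume MeasurableSet.univ
    hder hinj (fun _ => (1 : ℝ))
  have h2 := integral_image_eq_integral_abs_det_fderiv_smul volume MeasurableSet.univ
    hder hinj (fun _ => (1 : ℝ))
  simp only [hdet, smul_eq_mul, mul_one, setIntegral_univ, integrableOn_univ] at h1 h2
  refine ⟨h1.1 ?_, ?_⟩
  · refine integrableOn_const ?_
    rw [hvol]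
    exact hPk.measure_lt_top.ne
  · rw [← h2, setIntegral_const, smul_eq_mul, mul_one, Measure.real, hvol, vol]

theorem MV_eq {n : ℕ} (K : Fin n → Set (Fin n → ℝ)) :
    MV n K = ∑ S : Finset (Fin n), if S.Nonempty then
      (-1 : ℝ) ^ (n - #S) * vol (∑ i ∈ S, K i) else 0 := by
  unfold MV
  rw [← Finset.powerset_univ, Finset.sum_powerset, Finset.card_univ, Fintype.card_fin,
    Finset.range_eq_Ico, Finset.sum_eq_sum_Ico_succ_bot (Nat.succ_pos n)]
  simp only [Finset.powersetCard_zero, Finset.sum_singleton, Finset.not_nonempty_empty, if_false,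
    zero_add]
  refine Finset.sum_congr (by ext; simp) fun j hj => ?_
  rw [Finset.mul_sum]
  refine Finset.sum_congr rfl fun S hS => ?_
  rw [Finset.mem_powersetCard] at hS
  rw [Finset.mem_Ico] at hj
  rw [if_pos (Finset.card_pos.1 (by omega)), hS.2]

theorem MV_poly {n : ℕ} {F : Fin n → Finset (Fin n → ℝ)} (hF : ∀ i, (F i).Nonempty)
    (hI : ∀ i, (interior (convexHull ℝ (F i : Set (Fin n → ℝ)))).Nonempty) :
    0 ≤ MV n fun i => convexHull ℝ (F i : Set (Fin n → ℝ)) := by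
  rcases Nat.eq_zero_or_pos n with rfl | hn
  · simp [MV]
  have e : MV n (fun i => convexHull ℝ (F i : Set (Fin n → ℝ))) =
      ∫ x, ∑ S : Finset (Fin n), (-1 : ℝ) ^ (n - #S) * (∑ i ∈ S, gH (F i) x).det := by
    have h0 : ∀ x, (∑ i ∈ (∅ : Finset (Fin n)), gH (F i) x).det = 0 := by
      intro x
      have : Nonempty (Fin n) := ⟨⟨0, hn⟩⟩
      simp
    rw [MV_eq, integral_finsetSum]
    · refine Finset.sum_congr rfl fun S _ => ?_
      split_ifs with hS
      · rw [(poly_vol hF hI hS).2, integral_const_mul]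
      · rw [Finset.not_nonempty_iff_eq_empty.1 hS]
        simp only [h0]; simp
    · intro S _
      rcases S.eq_empty_or_nonempty with rfl | hS
      · simp only [h0]; simp
      · exact (poly_vol hF hI hS).1.const_mul _
  rw [e]
  exact integral_nonneg fun x => md_nonneg _ fun i => gH_psd (hF i) x

/-- Nonnegativity of the mixed volume: for all nonempty compact convex sets
`K₁, …, K_n ⊆ ℝⁿ`, `MV(K₁, …, K_n) ≥ 0`. -/
theorem mixed_volume_nonneg {n : ℕ} (K : Fin n → Set (Fin n → ℝ))
    (hne : ∀ i, (K i).Nonempty) (hcpt : ∀ i, IsCompact (K i))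
    (hconv : ∀ i, Convex ℝ (K i)) :
    MV n K ≥ 0 := by
  have hex : ∀ (m : ℕ) (i : Fin n), ∃ u : Finset (Fin n → ℝ), K i ⊆ interior (convexHull ℝ u) ∧
      convexHull ℝ (u : Set (Fin n → ℝ)) ⊆ Metric.cthickening (1 / ((m : ℝ) + 1)) (K i) := by
    intro m i
    refine (hconv i).exists_subset_interior_convexHull_finset_of_isCompact (hcpt i) ?_
    exact Metric.cthickening_mem_nhdsSet _ (by positivity)
  choose F hF1 hF2 using hex
  have hI : ∀ m i, (interior (convexHull ℝ (F m i : Set (Fin n → ℝ)))).Nonempty :=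
    fun m i => (hne i).mono (hF1 m i)
  have hF : ∀ m i, (F m i).Nonempty := by
    intro m i
    have := (hI m i).mono interior_subset
    rwa [convexHull_nonempty_iff, Finset.coe_nonempty] at this
  have hlim : Filter.Tendsto (fun m => MV n fun i => convexHull ℝ (F m i : Set (Fin n → ℝ)))
      Filter.atTop (nhds (MV n K)) := by
    unfold MV
    refine tendsto_finsetSum _ fun j _ => Filter.Tendsto.const_mul _ ?_
    refine tendsto_finsetSum _ fun S hS => ?_
    clear hS
    unfold vol
    have hk : IsCompact (∑ i ∈ S, K i) := by
      clear hF1 hF2 hI hF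
      induction S using Finset.cons_induction with
      | empty => simp only [Finset.sum_empty]; exact isCompact_singleton
      | cons a s ha ih => rw [Finset.sum_cons]; exact (hcpt a).add ih
    refine (ENNReal.tendsto_toReal hk.measure_lt_top.ne).comp ?_
    have hr : Filter.Tendsto (fun m : ℕ => (#S : ℝ) * (1 / ((m : ℝ) + 1))) Filter.atTop (nhds 0) := by
      simpa using tendsto_one_div_add_atTop_nhds_zero_nat.const_mul (#S : ℝ)
    refine tendsto_of_tendsto_of_tendsto_of_le_of_le tendsto_const_nhds
      ((tendsto_measure_cthickening_of_isCompact (μ := volume) hk).comp hr) (fun m => ?_)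
      (fun m => ?_)
    · exact measure_mono (Set.finsetSum_subset_finsetSum S _ _ fun i _ =>
        (hF1 m i).trans interior_subset)
    · refine measure_mono ?_
      intro z hz
      obtain ⟨g, hg, rfl⟩ := (Set.mem_finsetSum _ _ _).1 hz
      have hc : ∀ i, ∃ k ∈ K i, i ∈ S → dist (g i) k ≤ 1 / ((m : ℝ) + 1) := by
        intro i
        by_cases hi : i ∈ S
        · have := hF2 m i (hg hi)
          rw [(hcpt i).cthickening_eq_biUnion_closedBall (by positivity)] at this
          obtain ⟨k, hk, hd⟩ := Set.mem_iUnion₂.1 this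
          exact ⟨k, hk, fun _ => hd⟩
        · exact ⟨(hne i).some, (hne i).some_mem, fun h => absurd h hi⟩
      choose k hkK hkd using hc
      refine Metric.mem_cthickening_of_dist_le _ (∑ i ∈ S, k i) _ _
        (Set.finsetSum_mem_finsetSum _ _ _ fun i _ => hkK i) ?_
      refine (dist_sum_sum_le S g k).trans ?_
      refine (Finset.sum_le_card_nsmul S _ _ fun i hi => hkd i hi).trans ?_
      rw [nsmul_eq_mul]
  exact ge_of_tendsto' hlim fun m => MV_poly (hF m) (hI m)
end

section
/- (Extension claim in Theorem 4.3.) Let φ : ℚⁿ → ℚ be conical, i.e., φ(λ·v) = λ·φ(v) for all λ ∈ ℚ with λ ≥ 0 and all v ∈ ℚⁿ, and ℚ-concave, i.e., φ(t·x + (1−t)·y) ≥ t·φ(x) + (1−t)·φ(y) for all x, y ∈ ℚⁿ and all t ∈ ℚ with 0 ≤ t ≤ 1. Then there exists a unique function φ̄ : ℝⁿ → ℝ extending φ which is concave and conical (φ̄(λ·v) = λ·φ̄(v) for all real λ ≥ 0 and v ∈ ℝⁿ). -/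
theorem cce_superadd {n : ℕ} (φ : (Fin n → ℚ) → ℚ)
    (hconical : ∀ l : ℚ, 0 ≤ l → ∀ v : Fin n → ℚ, φ (l • v) = l * φ v)
    (hconcave : ∀ x y : Fin n → ℚ, ∀ t : ℚ, 0 ≤ t → t ≤ 1 →
      t * φ x + (1 - t) * φ y ≤ φ (t • x + (1 - t) • y)) (x y : Fin n → ℚ) :
    φ x + φ y ≤ φ (x + y) := by
  have h := hconcave x y (1/2) (by norm_num) (by norm_num)
  have e : ((1/2 : ℚ) • x + (1 - 1/2 : ℚ) • y) = (1/2 : ℚ) • (x + y) := by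
    rw [smul_add]; norm_num
  rw [e, hconical _ (by norm_num)] at h
  linarith

theorem cce_lower {n : ℕ} (φ : (Fin n → ℚ) → ℚ)
    (hconical : ∀ l : ℚ, 0 ≤ l → ∀ v : Fin n → ℚ, φ (l • v) = l * φ v)
    (hsup : ∀ x y, φ x + φ y ≤ φ (x + y)) :
    ∃ C : ℚ, 0 ≤ C ∧ ∀ x : Fin n → ℚ, ∀ r : ℚ, (∀ i, |x i| ≤ r) → -(C * r) ≤ φ x := by
  have h0 : φ 0 = 0 := by simpa using hconical 0 le_rfl 0
  have hsum : ∀ (s : Finset (Fin n)) (f : Fin n → Fin n → ℚ),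
      ∑ i ∈ s, φ (f i) ≤ φ (∑ i ∈ s, f i) := by
    intro s f
    classical
    induction s using Finset.induction_on with
    | empty => simp [h0]
    | insert a s ha ih =>
      rw [Finset.sum_insert ha, Finset.sum_insert ha]
      linarith [hsup (f a) (∑ i ∈ s, f i)]
  refine ⟨∑ i, (|φ (Pi.single i 1)| + |φ (-Pi.single i 1)|), by positivity, ?_⟩
  intro x r hr
  have hx : ∑ i, Pi.single i (x i) = x := Finset.univ_sum_single x
  have h1 := hsum Finset.univ (fun i => Pi.single i (x i))
  rw [hx] at h1
  refine le_trans ?_ h1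
  rw [Finset.sum_mul, ← Finset.sum_neg_distrib]
  refine Finset.sum_le_sum fun i _ => ?_
  have key : -((|φ (Pi.single i 1)| + |φ (-Pi.single i 1)|) * |x i|) ≤ φ (Pi.single i (x i)) := by
    rcases le_total 0 (x i) with h | h
    · have e : (Pi.single i (x i) : Fin n → ℚ) = x i • Pi.single i 1 := by
        rw [← Pi.single_smul]; simp
      rw [e, hconical _ h, abs_of_nonneg h]
      nlinarith [neg_abs_le (φ (Pi.single i 1)), abs_nonneg (φ (-Pi.single i 1))]
    · have e : (Pi.single i (x i) : Fin n → ℚ) = (-x i) • (-Pi.single i 1) := by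
        rw [smul_neg, neg_smul, neg_neg, ← Pi.single_smul]; simp
      rw [e, hconical _ (by linarith), abs_of_nonpos h]
      nlinarith [neg_abs_le (φ (-Pi.single i 1)), abs_nonneg (φ (Pi.single i 1))]
  refine le_trans ?_ key
  have := mul_le_mul_of_nonneg_left (hr i)
    (by positivity : 0 ≤ |φ (Pi.single i 1)| + |φ (-Pi.single i 1)|)
  linarith

/-- Extension claim in Theorem 4.3: a conical, ℚ-concave function `φ : ℚⁿ → ℚ`
extends uniquely to a concave conical function `φ̄ : ℝⁿ → ℝ`. -/
theorem conical_concave_extension {n : ℕ} (φ : (Fin n → ℚ) → ℚ)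
    (hconical : ∀ l : ℚ, 0 ≤ l → ∀ v : Fin n → ℚ, φ (l • v) = l * φ v)
    (hconcave : ∀ x y : Fin n → ℚ, ∀ t : ℚ, 0 ≤ t → t ≤ 1 →
      t * φ x + (1 - t) * φ y ≤ φ (t • x + (1 - t) • y)) :
    ∃! g : (Fin n → ℝ) → ℝ,
      (∀ v : Fin n → ℚ, g (fun i => (v i : ℝ)) = (φ v : ℝ)) ∧
      (∀ x y : Fin n → ℝ, ∀ t : ℝ, 0 ≤ t → t ≤ 1 →
        t * g x + (1 - t) * g y ≤ g (t • x + (1 - t) • y)) ∧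
      (∀ l : ℝ, 0 ≤ l → ∀ v : Fin n → ℝ, g (l • v) = l * g v) := by
  have hsup := cce_superadd φ hconical hconcave
  obtain ⟨C, hC, hlow⟩ := cce_lower φ hconical hsup
  let e : (Fin n → ℚ) → (Fin n → ℝ) := fun v i => (v i : ℝ)
  have he_dense : DenseRange e :=
    DenseRange.piMap (fun _ : Fin n => (Rat.denseRange_cast : DenseRange ((↑) : ℚ → ℝ)))
  have he_iso : Isometry e := by
    refine Isometry.of_dist_eq fun x y => ?_
    rw [dist_pi_def, dist_pi_def]
    congr 2
  have hdiff : ∀ x y : Fin n → ℚ, (φ x : ℝ) - φ y ≤ C * dist x y := by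
    intro x y
    by_contra hcon
    push Not at hcon
    have hex : ∃ r : ℚ, dist x y ≤ r ∧ (C : ℝ) * r < φ x - φ y := by
      have hc : Filter.Tendsto (fun r : ℝ => (C : ℝ) * r) (nhdsWithin (dist x y) (Set.Ioi (dist x y)))
          (nhds (C * dist x y)) :=
        ((continuous_const.mul continuous_id).tendsto _).mono_left nhdsWithin_le_nhds
      have hev := hc.eventually (gt_mem_nhds hcon)
      obtain ⟨u, hu, hu'⟩ := (mem_nhdsGT_iff_exists_Ioo_subset).1 hev
      obtain ⟨r, hr1, hr2⟩ := exists_rat_btwn (Set.mem_Ioi.1 hu)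
      exact ⟨r, hr1.le, hu' ⟨hr1, hr2⟩⟩
    obtain ⟨r, hr, hr'⟩ := hex
    have h1 := hlow (y - x) r (fun i => by
      have := (dist_le_pi_dist x y i).trans hr
      rw [dist_comm, Rat.dist_eq] at this
      simp only [Pi.sub_apply]
      exact_mod_cast this)
    have h2 := hsup x (y - x)
    rw [add_sub_cancel] at h2
    have h3 : φ x - φ y ≤ C * r := by linarith
    have h4 : (φ x : ℝ) - φ y ≤ C * r := by exact_mod_cast h3
    linarith
  have hlip : LipschitzWith (Real.toNNReal C) (fun v => (φ v : ℝ)) := by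
    refine LipschitzWith.of_dist_le_mul fun x y => ?_
    rw [Real.coe_toNNReal _ (by exact_mod_cast hC), Real.dist_eq, abs_le]
    have := hdiff y x
    rw [dist_comm] at this
    exact ⟨by linarith, hdiff x y⟩
  have hdi : IsDenseInducing e := ⟨he_iso.isUniformInducing.isInducing, he_dense⟩
  let g := hdi.extend (fun v => (φ v : ℝ))
  have hgc : Continuous g :=
    (uniformContinuous_uniformly_extend he_iso.isUniformInducing he_dense
      hlip.uniformContinuous).continuous
  have hge : ∀ v, g (e v) = φ v := fun v => hdi.extend_eq hlip.continuous v
  have hgsup : ∀ x y, g x + g y ≤ g (x + y) := by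
    intro x y
    refine he_dense.induction_on₂ (p := fun x y => g x + g y ≤ g (x + y)) ?_ ?_ x y
    · exact isClosed_le (by fun_prop) (by fun_prop)
    · intro a b
      have : e a + e b = e (a + b) := by ext i; simp [e]
      rw [this, hge, hge, hge]
      exact_mod_cast hsup a b
  have hgcon : ∀ (l : ℝ) v, g (|l| • v) = |l| * g v := by
    intro l v
    have hd : DenseRange (Prod.map ((↑) : ℚ → ℝ) e) := Rat.denseRange_cast.prodMap he_dense
    refine hd.induction_on (p := fun q : ℝ × (Fin n → ℝ) => g (|q.1| • q.2) = |q.1| * g q.2)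
      (l, v) ?_ ?_
    · exact isClosed_eq (by fun_prop) (by fun_prop)
    · rintro ⟨a, b⟩
      have : |(a : ℝ)| • e b = e (|a| • b) := by ext i; simp [e]
      simp only [Prod.map]
      rw [this, hge, hge, hconical _ (abs_nonneg a)]
      push_cast; rfl
  have hgcon' : ∀ l : ℝ, 0 ≤ l → ∀ v : Fin n → ℝ, g (l • v) = l * g v := by
    intro l hl v
    simpa [abs_of_nonneg hl] using hgcon l v
  refine ⟨g, ⟨hge, ?_, hgcon'⟩, ?_⟩
  · intro x y t h0 h1
    rw [← hgcon' t h0, ← hgcon' (1 - t) (by linarith)]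
    exact hgsup _ _
  · rintro f ⟨hfe, hfc, -⟩
    have hconc : ConcaveOn ℝ Set.univ f := by
      refine ⟨convex_univ, fun x _ y _ a b ha hb hab => ?_⟩
      obtain rfl : b = 1 - a := by linarith
      exact hfc x y a ha (by linarith)
    have hfcont : Continuous f :=
      continuousOn_univ.1 (hconc.continuousOn isOpen_univ)
    refine he_dense.equalizer hfcont hgc (funext fun v => ?_)
    exact (hfe v).trans (hge v).symm
end

section
/- (Example in Section 3.) Define h : ℝ² → ℝ by h(x, y) = x·y/(x + y) if x ≥ 0, y ≥ 0 and x + y > 0, and h(x, y) = min(x, y) otherwise. Then: (i) h is concave; (ii) h is conical, i.e., h(λ·v) = λ·h(v) for all real λ ≥ 0 and v ∈ ℝ²; and (iii) the stability set K_h := {(a, b) ∈ ℝ² : a·x + b·y ≥ h(x, y) for all (x, y) ∈ ℝ²} equals {(a, b) ∈ ℝ² : a ≥ 0, b ≥ 0, a + b ≤ 1, √a + √b ≥ 1}. -/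
/-- The function `h(x, y) = x·y/(x + y)` for `x, y ≥ 0` with `x + y > 0`, and
`h(x, y) = min(x, y)` otherwise. -/
noncomputable def hfun : ℝ × ℝ → ℝ := fun p =>
  if 0 ≤ p.1 ∧ 0 ≤ p.2 ∧ 0 < p.1 + p.2 then p.1 * p.2 / (p.1 + p.2) else min p.1 p.2

theorem hfun_le_aux (s : ℝ) (h0 : 0 ≤ s) (h1 : s ≤ 1) (v : ℝ × ℝ) :
    hfun v ≤ s ^ 2 * v.1 + (1 - s) ^ 2 * v.2 := by
  obtain ⟨x, y⟩ := v
  unfold hfun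
  dsimp only
  split_ifs with h
  · obtain ⟨hx, hy, hxy⟩ := h
    rw [div_le_iff₀ hxy]
    nlinarith [sq_nonneg (s * x - (1 - s) * y)]
  · have hm : min x y ≤ 0 := by
      by_contra hc
      push Not at hc
      have := lt_min_iff.1 hc
      exact h ⟨this.1.le, this.2.le, by linarith [this.1, this.2]⟩
    have hx := min_le_left x y
    have hy := min_le_right x y
    nlinarith [mul_nonneg (sq_nonneg s) (sub_nonneg.2 hx),
      mul_nonneg (sq_nonneg (1 - s)) (sub_nonneg.2 hy),
      mul_nonneg (mul_nonneg h0 (sub_nonneg.2 h1)) (neg_nonneg.2 hm)]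

theorem hfun_eq_aux (v : ℝ × ℝ) :
    ∃ s : ℝ, 0 ≤ s ∧ s ≤ 1 ∧ hfun v = s ^ 2 * v.1 + (1 - s) ^ 2 * v.2 := by
  obtain ⟨x, y⟩ := v
  unfold hfun
  dsimp only
  split_ifs with h
  · obtain ⟨hx, hy, hxy⟩ := h
    refine ⟨y / (x + y), by positivity, (div_le_one hxy).2 (by linarith), ?_⟩
    field_simp
    ring
  · rcases le_total x y with h | h
    · exact ⟨1, by norm_num, le_rfl, by simp [h]⟩
    · exact ⟨0, le_rfl, by norm_num, by simp [h]⟩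

/-- Example in Section 3: the function `hfun` is concave and conical, and its stability
set `K_h = {(a,b) : a·x + b·y ≥ h(x,y) for all (x,y)}` equals
`{(a, b) : a ≥ 0, b ≥ 0, a + b ≤ 1, √a + √b ≥ 1}`. -/
theorem hfun_concave_conical_stability :
    (∀ x y : ℝ × ℝ, ∀ t : ℝ, 0 ≤ t → t ≤ 1 →
      t * hfun x + (1 - t) * hfun y ≤ hfun (t • x + (1 - t) • y)) ∧
    (∀ l : ℝ, 0 ≤ l → ∀ v : ℝ × ℝ, hfun (l • v) = l * hfun v) ∧
    {q : ℝ × ℝ | ∀ v : ℝ × ℝ, hfun v ≤ q.1 * v.1 + q.2 * v.2} =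
      {q : ℝ × ℝ | 0 ≤ q.1 ∧ 0 ≤ q.2 ∧ q.1 + q.2 ≤ 1 ∧
        1 ≤ Real.sqrt q.1 + Real.sqrt q.2} := by
  refine ⟨?_, ?_, ?_⟩
  · intro x y t h0 h1
    obtain ⟨s, hs0, hs1, hs⟩ := hfun_eq_aux (t • x + (1 - t) • y)
    rw [hs]
    have hx := mul_le_mul_of_nonneg_left (hfun_le_aux s hs0 hs1 x) h0
    have hy := mul_le_mul_of_nonneg_left (hfun_le_aux s hs0 hs1 y) (sub_nonneg.2 h1)
    simp only [Prod.fst_add, Prod.snd_add, Prod.smul_fst, Prod.smul_snd, smul_eq_mul]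
    linarith
  · intro l hl v
    apply le_antisymm
    · obtain ⟨s, hs0, hs1, hs⟩ := hfun_eq_aux v
      have := hfun_le_aux s hs0 hs1 (l • v)
      simp only [Prod.smul_fst, Prod.smul_snd, smul_eq_mul] at this
      rw [hs]
      linarith
    · obtain ⟨s, hs0, hs1, hs⟩ := hfun_eq_aux (l • v)
      have := mul_le_mul_of_nonneg_left (hfun_le_aux s hs0 hs1 v) hl
      simp only [Prod.smul_fst, Prod.smul_snd, smul_eq_mul] at hs
      rw [hs]
      linarith
  · ext ⟨a, b⟩
    simp only [Set.mem_setOf_eq]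
    constructor
    · intro H
      have ha : 0 ≤ a := by
        have := H (1, 0)
        norm_num [hfun] at this
        exact this
      have hb : 0 ≤ b := by
        have := H (0, 1)
        norm_num [hfun] at this
        exact this
      refine ⟨ha, hb, ?_, ?_⟩
      · have := H (-1, -1)
        norm_num [hfun] at this
        linarith
      · by_contra hc
        push Not at hc
        have hα := Real.sqrt_nonneg a
        have hβ := Real.sqrt_nonneg b
        have ha2 := Real.sq_sqrt ha
        have hb2 := Real.sq_sqrt hb
        set α := Real.sqrt a
        set β := Real.sqrt b
        obtain ⟨s, hs1, hs2⟩ : ∃ s, α < s ∧ s < 1 - β := exists_between (by linarith)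
        have h1 : 0 < s := by linarith
        have h2 : 0 < 1 - s := by linarith
        have := H (1 - s, s)
        have e : hfun (1 - s, s) = (1 - s) * s := by
          unfold hfun
          dsimp only
          rw [if_pos ⟨h2.le, h1.le, by linarith⟩]
          simp
        rw [e] at this
        dsimp only at this
        have p1 : a < s ^ 2 := by rw [← ha2]; gcongr
        have p2 : b < (1 - s) ^ 2 := by rw [← hb2]; gcongr; linarith
        nlinarith [mul_lt_mul_of_pos_right p1 h2, mul_lt_mul_of_pos_right p2 h1]
    · rintro ⟨ha, hb, hab, hs⟩ ⟨x, y⟩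
      dsimp only
      by_cases h : 0 ≤ x ∧ 0 ≤ y
      · have hb1 : Real.sqrt b ≤ 1 := Real.sqrt_le_one.2 (by linarith)
        have := hfun_le_aux (1 - Real.sqrt b) (by linarith)
          (by linarith [Real.sqrt_nonneg b]) (x, y)
        dsimp only at this
        have e : (1 - (1 - Real.sqrt b)) ^ 2 = b := by
          rw [sub_sub_cancel, Real.sq_sqrt hb]
        rw [e] at this
        have p : (1 - Real.sqrt b) ^ 2 ≤ a := by
          have q : (1 - Real.sqrt b) ^ 2 ≤ Real.sqrt a ^ 2 :=
            pow_le_pow_left₀ (by linarith) (by linarith) 2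
          rwa [Real.sq_sqrt ha] at q
        nlinarith [mul_le_mul_of_nonneg_right p h.1]
      · have e : hfun (x, y) = min x y := by
          unfold hfun
          dsimp only
          rw [if_neg (fun h' => h ⟨h'.1, h'.2.1⟩)]
        rw [e]
        have hm : min x y ≤ 0 := by
          by_contra hc
          push Not at hc
          have := lt_min_iff.1 hc
          exact h ⟨this.1.le, this.2.le⟩
        nlinarith [mul_le_mul_of_nonneg_left (min_le_left x y) ha,
          mul_le_mul_of_nonneg_left (min_le_right x y) hb,
          mul_nonneg (sub_nonneg.2 hab) (neg_nonneg.2 hm)]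
end
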